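/- arXiv:2108.07475 — 2 statements merged into one kernel-verified Lean document; each statement's English description precedes it below -/
import Mathlib

section
/- Let c > 0 and A_c = {ζ ∈ ℂ : 1 < |ζ| < e^c}. Let F : ℂ × A_c → ℂ × A_c be a biholomorphism. Then there exist holomorphic functions β, γ : A_c → ℂ with β nowhere vanishing, and a constant α ∈ ℂ with |α| = 1, such that either F(u,v) = (β(v)·u + γ(v), α·v) for all (u,v) ∈ ℂ × A_c, or F(u,v) = (β(v)·u + γ(v), α·e^c/v) for all (u,v) ∈ ℂ × A_c. -/
open Filter Topology Set

noncomputable section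

/-- `f : U → V` and `g : V → U` are mutually inverse holomorphic maps, i.e.
`f` is a biholomorphism from `U` onto `V` with inverse `g`. -/
def IsBiholoOn (f g : ℂ × ℂ → ℂ × ℂ) (U V : Set (ℂ × ℂ)) : Prop :=
  DifferentiableOn ℂ f U ∧ DifferentiableOn ℂ g V ∧
    Set.MapsTo f U V ∧ Set.MapsTo g V U ∧
    (∀ z ∈ U, g (f z) = z) ∧ (∀ w ∈ V, f (g w) = w)

lemma inv_tendsto_aux {f g : ℂ → ℂ} (hf : Differentiable ℂ f) (hg : Differentiable ℂ g)
    (hgf : ∀ z, g (f z) = z) (hfg : ∀ z, f (g z) = z) :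
    Tendsto f (cocompact ℂ) (cocompact ℂ) := by
  let e : ℂ ≃ₜ ℂ := ⟨⟨f, g, hgf, hfg⟩, hf.continuous, hg.continuous⟩
  exact e.isClosedEmbedding.tendsto_cocompact

lemma inv_diff_aux {f g : ℂ → ℂ} (hf : Differentiable ℂ f) (hg : Differentiable ℂ g)
    (hgf : ∀ z, g (f z) = z) (hfg : ∀ z, f (g z) = z) (h0 : f 0 = 0) :
    DifferentiableAt ℂ (fun z => (f z⁻¹)⁻¹) 0 := by
  have ht := inv_tendsto_aux hf hg hgf hfg
  apply AnalyticAt.differentiableAt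
  apply Complex.analyticAt_of_differentiable_on_punctured_nhds_of_continuousAt
  · filter_upwards [self_mem_nhdsWithin] with z hz
    have hz' : z ≠ 0 := hz
    have : f z⁻¹ ≠ 0 := by
      intro h
      have h1 := hgf z⁻¹
      have h2 := hgf 0
      rw [h] at h1; rw [h0] at h2
      rw [h2] at h1
      exact hz' (inv_eq_zero.mp h1.symm)
    have h3 : DifferentiableAt ℂ (fun z => f z⁻¹) z :=
      (hf _).comp z (differentiableAt_inv hz')
    exact h3.inv this
  · rw [continuousAt_iff_punctured_nhds]
    have h1 : Tendsto (fun z : ℂ => f z⁻¹) (𝓝[≠] 0) (cocompact ℂ) := by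
      refine ht.comp ?_
      rw [← Metric.cobounded_eq_cocompact]
      exact tendsto_inv₀_nhdsNE_zero
    have h2 : Tendsto (fun z : ℂ => (f z⁻¹)⁻¹) (𝓝[≠] 0) (𝓝 0) := by
      rw [← Metric.cobounded_eq_cocompact] at h1
      exact tendsto_inv₀_cobounded.comp h1
    simpa [h0] using h2

lemma affine_aux0 {f g : ℂ → ℂ} (hf : Differentiable ℂ f) (hg : Differentiable ℂ g)
    (hgf : ∀ z, g (f z) = z) (hfg : ∀ z, f (g z) = z) (h0 : f 0 = 0) :
    ∃ L : ℂ, ∀ z, f z = L * z := by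
  have hg0 : g 0 = 0 := by rw [← h0, hgf, h0]
  have hF := inv_diff_aux hf hg hgf hfg h0
  have hG := inv_diff_aux hg hf hfg hgf hg0
  set P : ℂ → ℂ := fun z => (f z⁻¹)⁻¹ with hP
  set Q : ℂ → ℂ := fun z => (g z⁻¹)⁻¹ with hQ
  have hP0 : P 0 = 0 := by simp [hP, h0]
  have hd : deriv P 0 ≠ 0 := by
    intro hd0
    have h1 : HasDerivAt P 0 0 := by
      have h := hF.hasDerivAt
      rwa [hd0] at h
    have h2 : HasDerivAt Q (deriv Q 0) (P 0) := by rw [hP0]; exact hG.hasDerivAt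
    have h3 := h2.comp (0:ℂ) h1
    have h4 : Q ∘ P = id := by
      funext z; simp [hP, hQ, hgf]
    rw [h4] at h3
    have := h3.unique (hasDerivAt_id (0:ℂ))
    simp at this
  have hs : Tendsto (fun z => z⁻¹ * P z) (𝓝[≠] 0) (𝓝 (deriv P 0)) := by
    have := hasDerivAt_iff_tendsto_slope.mp hF.hasDerivAt
    refine this.congr fun z => ?_
    simp [slope, hP0]
  have hs2 : Tendsto (dslope f 0) (cocompact ℂ) (𝓝 (deriv P 0)⁻¹) := by
    have h1 := (hs.inv₀ hd).comp (f := fun z : ℂ => z⁻¹) (x := cocompact ℂ) (by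
      rw [← Metric.cobounded_eq_cocompact]
      exact tendsto_inv₀_cobounded')
    refine h1.congr' ?_
    have : ∀ᶠ z : ℂ in cocompact ℂ, z ≠ 0 :=
      (isCompact_singleton (x := (0:ℂ))).compl_mem_cocompact
    filter_upwards [this] with z hz
    rw [dslope_of_ne _ hz]
    simp [slope, hP, h0, mul_comm]
  have hdd : Differentiable ℂ (dslope f 0) := by
    rw [← differentiableOn_univ, Complex.differentiableOn_dslope univ_mem]
    exact hf.differentiableOn
  refine ⟨(deriv P 0)⁻¹, fun z => ?_⟩
  have h1 := hdd.apply_eq_of_tendsto_cocompact z hs2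
  have h2 := sub_smul_dslope f 0 z
  rw [h1, h0] at h2
  simp at h2
  rw [← h2, mul_comm]

lemma affine_aux {f g : ℂ → ℂ} (hf : Differentiable ℂ f) (hg : Differentiable ℂ g)
    (hgf : ∀ z, g (f z) = z) (hfg : ∀ z, f (g z) = z) :
    f 1 - f 0 ≠ 0 ∧ ∀ z, f z = (f 1 - f 0) * z + f 0 := by
  constructor
  · intro h
    have h1 := hgf 1
    rw [sub_eq_zero.mp h, hgf] at h1
    exact zero_ne_one h1
  · obtain ⟨L, hL⟩ := affine_aux0 (f := fun z => f z - f 0) (g := fun z => g (z + f 0))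
      (by fun_prop) (by fun_prop) (by intro z; simp [hgf]) (by intro z; simp [hfg]) (by simp)
    intro z
    have h1 := hL 1
    have h2 := hL z
    simp only [mul_one] at h1
    rw [h1, ← h2]; ring

/-- open annulus -/
def Ann (s t : ℝ) : Set ℂ := {ζ : ℂ | s < ‖ζ‖ ∧ ‖ζ‖ < t}

lemma Ann_open (s t : ℝ) : IsOpen (Ann s t) :=
  (isOpen_lt continuous_const continuous_norm).inter (isOpen_lt continuous_norm continuous_const)

lemma Ann_preconn {s t : ℝ} (hs : 0 ≤ s) : IsPreconnected (Ann s t) := by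
  have h : Ann s t = (fun p : ℝ × ℝ => (p.1 : ℂ) * Complex.exp (p.2 * Complex.I)) ''
      (Ioo s t ×ˢ univ) := by
    ext z
    constructor
    · intro hz
      exact ⟨(‖z‖, z.arg), ⟨⟨hz.1, hz.2⟩, trivial⟩, Complex.norm_mul_exp_arg_mul_I z⟩
    · rintro ⟨⟨r, θ⟩, ⟨⟨h1, h2⟩, -⟩, rfl⟩
      have : ‖(r : ℂ) * Complex.exp (θ * Complex.I)‖ = r := by
        rw [norm_mul, Complex.norm_exp_ofReal_mul_I, Complex.norm_real, mul_one,
          Real.norm_of_nonneg (hs.trans h1.le)]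
      simp only [Ann, mem_ofPred_eq, this]
      exact ⟨h1, h2⟩
  rw [h]
  refine (isPreconnected_Ioo.prod isPreconnected_univ).image _ ?_
  fun_prop

/-- properness -/
lemma proper_aux {R : ℝ} {φ ψ : ℂ → ℂ}
    (hψ : DifferentiableOn ℂ ψ (Ann 1 R))
    (mψ : MapsTo ψ (Ann 1 R) (Ann 1 R)) (mφ : MapsTo φ (Ann 1 R) (Ann 1 R))
    (hψφ : ∀ z ∈ Ann 1 R, ψ (φ z) = z) {a b : ℝ} (ha : 1 < a) (hab : a ≤ b) (hb : b < R) :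
    ∃ a' b', 1 < a' ∧ a' ≤ b' ∧ b' < R ∧ ∀ z ∈ Ann 1 R, (‖z‖ < a' ∨ b' < ‖z‖) →
      (‖φ z‖ < a ∨ b < ‖φ z‖) := by
  let K : Set ℂ := {z | a ≤ ‖z‖ ∧ ‖z‖ ≤ b}
  have hK : IsCompact K := by
    refine Metric.isCompact_of_isClosed_isBounded
      ((isClosed_le continuous_const continuous_norm).inter
        (isClosed_le continuous_norm continuous_const)) ?_
    refine (Metric.isBounded_closedBall (x := (0:ℂ)) (r := b)).subset ?_
    intro z hz
    simpa using hz.2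
  have hKA : K ⊆ Ann 1 R := fun z hz => ⟨ha.trans_le hz.1, hz.2.trans_lt hb⟩
  have hne : K.Nonempty := ⟨(a : ℂ), by
    have : ‖(a:ℂ)‖ = a := by rw [Complex.norm_real, Real.norm_of_nonneg (by linarith)]
    simp only [K, mem_ofPred_eq, this]
    exact ⟨le_rfl, hab⟩⟩
  have hc : ContinuousOn (fun z => ‖ψ z‖) K := (hψ.continuousOn.mono hKA).norm
  obtain ⟨x, hx, hxm⟩ := hK.exists_isMinOn hne hc
  obtain ⟨y, hy, hym⟩ := hK.exists_isMaxOn hne hc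
  refine ⟨‖ψ x‖, ‖ψ y‖, (mψ (hKA hx)).1, hxm hy, (mψ (hKA hy)).2, ?_⟩
  intro z hz h
  by_contra hcon
  push Not at hcon
  have hzK : φ z ∈ K := hcon
  have h1 : ‖ψ x‖ ≤ ‖ψ (φ z)‖ := hxm hzK
  have h2 : ‖ψ (φ z)‖ ≤ ‖ψ y‖ := hym hzK
  rw [hψφ z hz] at h1 h2
  rcases h with h | h <;> linarith

/-- dichotomy on collars -/
lemma collar_aux {R s t m : ℝ} {φ : ℂ → ℂ} (hφ : ContinuousOn φ (Ann 1 R)) (hs : 1 ≤ s)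
    (ht : t ≤ R) (h : ∀ z ∈ Ann s t, ‖φ z‖ < m ∨ m < ‖φ z‖) :
    (∀ z ∈ Ann s t, ‖φ z‖ < m) ∨ (∀ z ∈ Ann s t, m < ‖φ z‖) := by
  have hsub : Ann s t ⊆ Ann 1 R := fun z hz => ⟨hs.trans_lt hz.1, hz.2.trans_le ht⟩
  have hp : IsPreconnected ((fun z => ‖φ z‖) '' Ann s t) :=
    (Ann_preconn (by linarith)).image _ (hφ.mono hsub).norm
  by_contra hcon
  push Not at hcon
  obtain ⟨⟨x, hx, hx'⟩, y, hy, hy'⟩ := hcon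
  have := hp.Icc_subset (mem_image_of_mem _ hy) (mem_image_of_mem _ hx) ⟨hy', hx'⟩
  obtain ⟨z, hz, hzm⟩ := this
  have hzm' : ‖φ z‖ = m := hzm
  rcases h z hz with h | h <;> linarith

/-- maximum principle -/
lemma max_aux {s t C : ℝ} {h : ℂ → ℂ} {U : Set ℂ} (hh : DifferentiableOn ℂ h U)
    (hU : ∀ z, s ≤ ‖z‖ → ‖z‖ ≤ t → z ∈ U) (hst : s ≠ t)
    (hb : ∀ z, ‖z‖ = s ∨ ‖z‖ = t → ‖h z‖ ≤ C) {z : ℂ} (hz : z ∈ Ann s t) : ‖h z‖ ≤ C := by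
  have hcl : closure (Ann s t) ⊆ {z | s ≤ ‖z‖ ∧ ‖z‖ ≤ t} :=
    closure_minimal (fun z hz => ⟨hz.1.le, hz.2.le⟩)
      ((isClosed_le continuous_const continuous_norm).inter
        (isClosed_le continuous_norm continuous_const))
  refine Complex.norm_le_of_forall_mem_frontier_norm_le (U := Ann s t) ?_ ?_ ?_
    (subset_closure hz)
  · refine (Metric.isBounded_closedBall (x := (0:ℂ)) (r := t)).subset ?_
    intro z hz
    simpa using hz.2.le
  · exact (hh.mono fun z hz => hU z (hcl hz).1 (hcl hz).2).diffContOnCl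
  · intro z hz
    apply hb
    have h1 := hcl hz.1
    have h2 : z ∉ Ann s t := by
      rw [← (Ann_open s t).interior_eq]; exact hz.2
    by_contra hcon
    push Not at hcon
    exact h2 ⟨lt_of_le_of_ne h1.1 hcon.1.symm, lt_of_le_of_ne h1.2 hcon.2⟩

lemma ident_case {R : ℝ} (hR : 1 < R) {φ ψ : ℂ → ℂ}
    (hφ : DifferentiableOn ℂ φ (Ann 1 R)) (hψ : DifferentiableOn ℂ ψ (Ann 1 R))
    (mφ : MapsTo φ (Ann 1 R) (Ann 1 R)) (mψ : MapsTo ψ (Ann 1 R) (Ann 1 R))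
    (hψφ : ∀ z ∈ Ann 1 R, ψ (φ z) = z)
    {m a b : ℝ} (ha : 1 < a) (hb : b < R) (hm1 : 1 < m) (hm2 : m < R)
    (hlow : ∀ z ∈ Ann 1 a, ‖φ z‖ < m) (hhigh : ∀ z ∈ Ann b R, m < ‖φ z‖) :
    ∃ α : ℂ, ‖α‖ = 1 ∧ ∀ z ∈ Ann 1 R, φ z = α * z := by
  have hz0 : ∀ z ∈ Ann 1 R, z ≠ 0 := by
    intro z hz h
    have := hz.1
    rw [h, norm_zero] at this
    linarith
  have hφ0 : ∀ z ∈ Ann 1 R, φ z ≠ 0 := fun z hz => hz0 _ (mφ hz)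
  have key : ∀ z ∈ Ann 1 R, ∀ ε, 1 < ε → ‖φ z / z‖ ≤ ε ∧ ‖z / φ z‖ ≤ ε := by
    intro z hz ε hε
    -- choose a target window
    obtain ⟨p, hp1, hp2⟩ := exists_between (lt_min hε hm1)
    obtain ⟨q, hq1, hq2⟩ := exists_between (max_lt (div_lt_self (by linarith : 0 < R) hε) hm2)
    have hpε := hp2.trans_le (min_le_left _ _)
    have hpm := hp2.trans_le (min_le_right _ _)
    have hqε := (le_max_left _ _).trans_lt hq1
    have hqm := (le_max_right _ _).trans_lt hq1
    obtain ⟨a', b', ha', hab', hb', hP⟩ := proper_aux hψ mψ mφ hψφ hp1 (hpm.trans hqm).le hq2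
    obtain ⟨s, hs1, hs2⟩ := exists_between
      (lt_min (lt_min ha ha') (lt_min hp1 hz.1))
    obtain ⟨t, ht1, ht2⟩ := exists_between
      (max_lt (max_lt hb hb') (max_lt hq2 hz.2))
    simp only [lt_min_iff, max_lt_iff] at hs2 ht1
    obtain ⟨⟨hsa, hsa'⟩, hsp, hsz⟩ := hs2
    obtain ⟨⟨htb, htb'⟩, htq, htz⟩ := ht1
    have hst : s < t := hsz.trans htz
    have hU : ∀ z : ℂ, s ≤ ‖z‖ → ‖z‖ ≤ t → z ∈ Ann 1 R := fun z h1 h2 =>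
      ⟨hs1.trans_le h1, h2.trans_lt ht2⟩
    have hεR : R < q * ε := (div_lt_iff₀ (by linarith)).mp hqε
    have hbd : ∀ w : ℂ, ‖w‖ = s ∨ ‖w‖ = t → ‖φ w‖ ≤ ε * ‖w‖ ∧ ‖w‖ ≤ ε * ‖φ w‖ := by
      intro w hw
      have hwA : w ∈ Ann 1 R := hU w (by rcases hw with h | h <;> linarith)
        (by rcases hw with h | h <;> linarith)
      have hφA := mφ hwA
      obtain ⟨f1, f2⟩ := hφA
      rcases hw with h | h
      · have h1 := hlow w ⟨by linarith, by linarith⟩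
        have h2 := hP w hwA (Or.inl (by linarith))
        have h3 : ‖φ w‖ < p := by
          rcases h2 with h2 | h2
          · exact h2
          · linarith
        rw [h]
        constructor <;> nlinarith
      · have h1 := hhigh w ⟨by linarith, by linarith⟩
        have h2 := hP w hwA (Or.inr (by linarith))
        have h3 : q < ‖φ w‖ := by
          rcases h2 with h2 | h2
          · linarith
          · exact h2
        rw [h]
        constructor <;> nlinarith
    constructor
    · refine max_aux (hφ.div differentiableOn_id hz0) hU hst.ne ?_ ⟨hsz, htz⟩
      intro w hw
      have hwA : w ∈ Ann 1 R := hU w (by rcases hw with h | h <;> linarith)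
        (by rcases hw with h | h <;> linarith)
      simp only [Pi.div_apply, id]
      rw [norm_div, div_le_iff₀ (norm_pos_iff.mpr (hz0 w hwA))]
      exact (hbd w hw).1
    · refine max_aux (differentiableOn_id.div hφ hφ0) hU hst.ne ?_ ⟨hsz, htz⟩
      intro w hw
      have hwA : w ∈ Ann 1 R := hU w (by rcases hw with h | h <;> linarith)
        (by rcases hw with h | h <;> linarith)
      simp only [Pi.div_apply, id]
      rw [norm_div, div_le_iff₀ (norm_pos_iff.mpr (hφ0 w hwA))]
      exact (hbd w hw).2
  have hone : ∀ z ∈ Ann 1 R, ‖φ z / z‖ = 1 := by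
    intro z hz
    have h1 : ‖φ z / z‖ ≤ 1 := le_of_forall_gt_imp_ge_of_dense fun ε hε => (key z hz ε hε).1
    have h2 : ‖z / φ z‖ ≤ 1 := le_of_forall_gt_imp_ge_of_dense fun ε hε => (key z hz ε hε).2
    have h3 : 0 < ‖z‖ := norm_pos_iff.mpr (hz0 z hz)
    have h4 : 0 < ‖φ z‖ := norm_pos_iff.mpr (hφ0 z hz)
    rw [norm_div, div_le_one (by assumption)] at h1 h2
    rw [norm_div, div_eq_one_iff_eq h3.ne']
    linarith
  obtain ⟨r, hr1, hr2⟩ := exists_between hR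
  have hrA : (r : ℂ) ∈ Ann 1 R := by
    have : ‖(r:ℂ)‖ = r := by rw [Complex.norm_real, Real.norm_of_nonneg (by linarith)]
    simp only [Ann, mem_ofPred_eq, this]
    exact ⟨hr1, hr2⟩
  refine ⟨φ r / r, hone _ hrA, ?_⟩
  have hmax : IsMaxOn (norm ∘ fun z => φ z / z) (Ann 1 R) (r : ℂ) := by
    intro z hz
    simp only [mem_ofPred_eq, Function.comp]
    rw [hone z hz, hone _ hrA]
  have := Complex.eqOn_of_isPreconnected_of_isMaxOn_norm (f := fun z => φ z / z)
    (Ann_preconn zero_le_one) (Ann_open 1 R) (hφ.div differentiableOn_id hz0) hrA hmax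
  intro z hz
  have h := this hz
  simp only [Function.const] at h
  rw [← h, div_mul_cancel₀ _ (hz0 z hz)]

lemma ann_aut {R : ℝ} (hR : 1 < R) {φ ψ : ℂ → ℂ}
    (hφ : DifferentiableOn ℂ φ (Ann 1 R)) (hψ : DifferentiableOn ℂ ψ (Ann 1 R))
    (mφ : MapsTo φ (Ann 1 R) (Ann 1 R)) (mψ : MapsTo ψ (Ann 1 R) (Ann 1 R))
    (hψφ : ∀ z ∈ Ann 1 R, ψ (φ z) = z) (hφψ : ∀ z ∈ Ann 1 R, φ (ψ z) = z) :
    ∃ α : ℂ, ‖α‖ = 1 ∧ ((∀ z ∈ Ann 1 R, φ z = α * z) ∨ (∀ z ∈ Ann 1 R, φ z = α * R / z)) := by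
  obtain ⟨m, hm1, hm2⟩ := exists_between hR
  obtain ⟨a, b, ha, hab, hb, hP⟩ := proper_aux hψ mψ mφ hψφ hm1 le_rfl hm2
  have hin := collar_aux (s := 1) (t := a) (m := m) hφ.continuousOn le_rfl (by linarith)
    (fun z hz => hP z ⟨hz.1, by linarith [hz.2]⟩ (Or.inl hz.2))
  have hout := collar_aux (s := b) (t := R) (m := m) hφ.continuousOn (by linarith) le_rfl
    (fun z hz => hP z ⟨by linarith [hz.1], hz.2⟩ (Or.inr hz.1))
  -- points of the target near a boundary come from near the boundary
  obtain ⟨c, d, hc, hcd, hd, hQ⟩ := proper_aux hφ mφ mψ hφψ ha hab hb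
  have hcirc : ∀ r, 1 < r → r < R → (r : ℂ) ∈ Ann 1 R ∧ ‖(r:ℂ)‖ = r := by
    intro r h1 h2
    have : ‖(r:ℂ)‖ = r := by rw [Complex.norm_real, Real.norm_of_nonneg (by linarith)]
    refine ⟨?_, this⟩
    simp only [Ann, mem_ofPred_eq, this]
    exact ⟨h1, h2⟩
  rcases hin with hin | hin <;> rcases hout with hout | hout
  · exfalso
    obtain ⟨r, hr1, hr2⟩ := exists_between (max_lt hd hm2)
    simp only [max_lt_iff] at hr1
    obtain ⟨hrA, hrn⟩ := hcirc r (by linarith) hr2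
    have hA := mψ hrA
    have hval := hφψ _ hrA
    rcases hQ r hrA (Or.inr (by linarith)) with h | h
    · have := hin _ ⟨hA.1, h⟩
      rw [hval, hrn] at this; linarith
    · have := hout _ ⟨h, hA.2⟩
      rw [hval, hrn] at this; linarith
  · obtain ⟨α, h1, h2⟩ := ident_case hR hφ hψ mφ mψ hψφ ha hb hm1 hm2 hin hout
    exact ⟨α, h1, Or.inl h2⟩
  · have hR0 : (R : ℂ) ≠ 0 := by exact_mod_cast (by linarith : R ≠ 0)
    have hz0 : ∀ z ∈ Ann 1 R, z ≠ 0 := by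
      intro z hz h
      have := hz.1
      rw [h, norm_zero] at this
      linarith
    have hnR : ‖(R:ℂ)‖ = R := by rw [Complex.norm_real, Real.norm_of_nonneg (by linarith)]
    have minv : MapsTo (fun z : ℂ => R / z) (Ann 1 R) (Ann 1 R) := by
      intro z hz
      have h0 : 0 < ‖z‖ := norm_pos_iff.mpr (hz0 z hz)
      simp only [Ann, mem_ofPred_eq, norm_div, hnR]
      rw [lt_div_iff₀ h0, div_lt_iff₀ h0]
      refine ⟨by linarith [hz.2], by nlinarith [hz.1]⟩
    have dinv : DifferentiableOn ℂ (fun z : ℂ => R / z) (Ann 1 R) :=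
      (differentiableOn_const _).div differentiableOn_id hz0
    have hm0 : 0 < m := by linarith
    obtain ⟨α, h1, h2⟩ := ident_case hR (φ := fun z => R / φ z) (ψ := fun z => ψ (R / z))
      (m := R / m) (dinv.comp hφ mφ) (hψ.comp dinv minv) (minv.comp mφ) (mψ.comp minv)
      (by
        intro z hz
        rw [div_div_cancel₀ hR0, hψφ z hz]) ha hb
      (by rw [lt_div_iff₀ hm0]; linarith) (by rw [div_lt_iff₀ hm0]; nlinarith)
      (by
        intro z hz
        rw [norm_div, hnR]
        exact div_lt_div_of_pos_left (by linarith) hm0 (hin z hz))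
      (by
        intro z hz
        rw [norm_div, hnR]
        refine div_lt_div_of_pos_left (by linarith) ?_ (hout z hz)
        exact norm_pos_iff.mpr (hz0 _ (mφ ⟨by linarith [hz.1], hz.2⟩)))
    refine ⟨α⁻¹, by rw [norm_inv, h1, inv_one], Or.inr ?_⟩
    intro z hz
    have h3 := h2 z hz
    have hα : α ≠ 0 := by
      intro h; rw [h, norm_zero] at h1; exact zero_ne_one h1
    have h4 := hz0 _ (mφ hz)
    have h5 := hz0 z hz
    field_simp at h3 ⊢
    rw [h3]
  · exfalso
    obtain ⟨r, hr1, hr2⟩ := exists_between (lt_min hc hm1)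
    simp only [lt_min_iff] at hr2
    obtain ⟨hrA, hrn⟩ := hcirc r (by linarith) (by linarith)
    have hA := mψ hrA
    have hval := hφψ _ hrA
    rcases hQ r hrA (Or.inl (by linarith)) with h | h
    · have := hin _ ⟨hA.1, h⟩
      rw [hval, hrn] at this; linarith
    · have := hout _ ⟨h, hA.2⟩
      rw [hval, hrn] at this; linarith

/-- Liouville in the fibre direction. -/
lemma fibre_const {R : ℝ} {F : ℂ × ℂ → ℂ × ℂ}
    (dF : DifferentiableOn ℂ F (univ ×ˢ Ann 1 R))
    (mF : MapsTo F (univ ×ˢ Ann 1 R) (univ ×ˢ Ann 1 R)) {v : ℂ} (hv : v ∈ Ann 1 R) :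
    Differentiable ℂ (fun u => F (u, v)) ∧ ∀ u, (F (u, v)).2 = (F (0, v)).2 := by
  have hd : Differentiable ℂ (fun u => F (u, v)) := by
    rw [← differentiableOn_univ]
    exact dF.comp (by fun_prop) (fun u _ => ⟨trivial, hv⟩)
  refine ⟨hd, fun u => ?_⟩
  refine Differentiable.apply_eq_apply_of_bounded (f := fun u => (F (u, v)).2) hd.snd ?_ u 0
  refine (Metric.isBounded_closedBall (x := (0:ℂ)) (r := R)).subset ?_
  rintro _ ⟨u, rfl⟩
  simpa using (mF (show (u, v) ∈ univ ×ˢ Ann 1 R from ⟨trivial, hv⟩)).2.2.le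

lemma main_aux {R : ℝ} (hR : 1 < R) (F G : ℂ × ℂ → ℂ × ℂ)
    (hF : IsBiholoOn F G (univ ×ˢ Ann 1 R) (univ ×ˢ Ann 1 R)) :
    ∃ β γ : ℂ → ℂ, DifferentiableOn ℂ β (Ann 1 R) ∧ DifferentiableOn ℂ γ (Ann 1 R) ∧
      (∀ v ∈ Ann 1 R, β v ≠ 0) ∧ ∃ α : ℂ, ‖α‖ = 1 ∧
        ((∀ u : ℂ, ∀ v ∈ Ann 1 R, F (u, v) = (β v * u + γ v, α * v)) ∨
         (∀ u : ℂ, ∀ v ∈ Ann 1 R, F (u, v) = (β v * u + γ v, α * R / v))) := by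
  obtain ⟨dF, dG, mF, mG, hGF, hFG⟩ := hF
  have memU : ∀ u : ℂ, ∀ v ∈ Ann 1 R, (u, v) ∈ univ ×ˢ Ann 1 R := fun u v hv => ⟨trivial, hv⟩
  have sl : ∀ {H : ℂ × ℂ → ℂ × ℂ}, DifferentiableOn ℂ H (univ ×ˢ Ann 1 R) → ∀ u : ℂ,
      DifferentiableOn ℂ (fun v => H (u, v)) (Ann 1 R) := fun dH u =>
    dH.comp (by fun_prop) (fun v hv => memU u v hv)
  have cF := fun v hv => fibre_const dF mF (v := v) hv
  have cG := fun v hv => fibre_const dG mG (v := v) hv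
  have eF : ∀ u : ℂ, ∀ v ∈ Ann 1 R, F (u, v) = ((F (u, v)).1, (F (0, v)).2) := by
    intro u v hv
    rw [← (cF v hv).2 u]
  have eG : ∀ u : ℂ, ∀ v ∈ Ann 1 R, G (u, v) = ((G (u, v)).1, (G (0, v)).2) := by
    intro u v hv
    rw [← (cG v hv).2 u]
  have mφ : MapsTo (fun v => (F (0, v)).2) (Ann 1 R) (Ann 1 R) := fun v hv =>
    (mF (memU 0 v hv)).2
  have mψ : MapsTo (fun v => (G (0, v)).2) (Ann 1 R) (Ann 1 R) := fun v hv =>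
    (mG (memU 0 v hv)).2
  have hψφ : ∀ v ∈ Ann 1 R, (G (0, (F (0, v)).2)).2 = v := by
    intro v hv
    have h := hGF _ (memU 0 v hv)
    rw [eF 0 v hv, eG _ _ (mφ hv)] at h
    exact congrArg Prod.snd h
  have hφψ : ∀ v ∈ Ann 1 R, (F (0, (G (0, v)).2)).2 = v := by
    intro v hv
    have h := hFG _ (memU 0 v hv)
    rw [eG 0 v hv, eF _ _ (mψ hv)] at h
    exact congrArg Prod.snd h
  have aff : ∀ v ∈ Ann 1 R, (F (1, v)).1 - (F (0, v)).1 ≠ 0 ∧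
      ∀ u, (F (u, v)).1 = ((F (1, v)).1 - (F (0, v)).1) * u + (F (0, v)).1 := by
    intro v hv
    refine affine_aux (f := fun u => (F (u, v)).1) (g := fun u => (G (u, (F (0, v)).2)).1)
      (cF v hv).1.fst (cG _ (mφ hv)).1.fst ?_ ?_
    · intro u
      have h := hGF _ (memU u v hv)
      rw [eF u v hv] at h
      exact congrArg Prod.fst h
    · intro u
      have h := hFG _ (memU u _ (mφ hv))
      rw [eG u _ (mφ hv), hψφ v hv] at h
      exact congrArg Prod.fst h
  obtain ⟨α, hα, h⟩ := ann_aut hR (sl dF 0).snd (sl dG 0).snd mφ mψ hψφ hφψ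
  refine ⟨fun v => (F (1, v)).1 - (F (0, v)).1, fun v => (F (0, v)).1,
    (sl dF 1).fst.sub (sl dF 0).fst, (sl dF 0).fst, fun v hv => (aff v hv).1, α, hα, ?_⟩
  refine h.imp (fun h u v hv => ?_) (fun h u v hv => ?_)
  · rw [← (aff v hv).2 u, ← h v hv]
    exact eF u v hv
  · rw [← (aff v hv).2 u, ← h v hv]
    exact eF u v hv

/-- Let `c > 0`, `A_c = {ζ ∈ ℂ : 1 < |ζ| < e^c}` and let
`F : ℂ × A_c → ℂ × A_c` be a biholomorphism. Then there are holomorphic `β, γ` on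
`A_c` with `β` nowhere vanishing, and a constant `α` with `|α| = 1`, such that either
`F(u,v) = (β(v)·u + γ(v), α·v)` on `ℂ × A_c`, or
`F(u,v) = (β(v)·u + γ(v), α·e^c/v)` on `ℂ × A_c`. -/
theorem stmt_14 (c : ℝ) (hc : 0 < c)
    (F Finv : ℂ × ℂ → ℂ × ℂ)
    (hF : IsBiholoOn F Finv
      ((Set.univ : Set ℂ) ×ˢ {ζ : ℂ | 1 < ‖ζ‖ ∧ ‖ζ‖ < Real.exp c})
      ((Set.univ : Set ℂ) ×ˢ {ζ : ℂ | 1 < ‖ζ‖ ∧ ‖ζ‖ < Real.exp c})) :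
    ∃ β γ : ℂ → ℂ,
      DifferentiableOn ℂ β {ζ : ℂ | 1 < ‖ζ‖ ∧ ‖ζ‖ < Real.exp c} ∧
      DifferentiableOn ℂ γ {ζ : ℂ | 1 < ‖ζ‖ ∧ ‖ζ‖ < Real.exp c} ∧
      (∀ v ∈ {ζ : ℂ | 1 < ‖ζ‖ ∧ ‖ζ‖ < Real.exp c}, β v ≠ 0) ∧
      ∃ α : ℂ, ‖α‖ = 1 ∧
        ((∀ u : ℂ, ∀ v ∈ {ζ : ℂ | 1 < ‖ζ‖ ∧ ‖ζ‖ < Real.exp c},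
            F (u, v) = (β v * u + γ v, α * v)) ∨
         (∀ u : ℂ, ∀ v ∈ {ζ : ℂ | 1 < ‖ζ‖ ∧ ‖ζ‖ < Real.exp c},
            F (u, v) = (β v * u + γ v, α * Real.exp c / v))) := by
  exact main_aux (Real.one_lt_exp_iff.mpr hc) F Finv hF
end
end

section
/- Let c > 0. For any ℓ₁, ℓ₂ with c/d < ℓ₁ < ℓ₂ < c, there is no biholomorphism from Ω_{ℓ₁} onto Ω_{ℓ₂}; that is, the family {Ω_ℓ : c/d < ℓ < c} is a continuum of pairwise non-biholomorphic Short ℂ²'s. Moreover, for every ℓ with c/d < ℓ < c, every automorphism of Ω_c restricts to an automorphism of Ω_ℓ. -/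
open Filter Topology Set

noncomputable section

open Filter Topology Set

noncomputable section

/-- the Henon map -/
def hen (P : ℂ → ℂ) (a : ℂ) (z : ℂ × ℂ) : ℂ × ℂ := (z.2, P z.2 - a * z.1)

/-- Data of a Henon map with Green function and quantitative constants. -/
structure HD where
  d : ℕ
  hd : 2 ≤ d
  a : ℂ
  ha : a ≠ 0
  P : ℂ → ℂ
  hP : Differentiable ℂ P
  G : ℂ × ℂ → ℝ
  hGcont : Continuous G
  hGnonneg : ∀ z, 0 ≤ G z
  hGlim : ∀ z : ℂ × ℂ, Tendsto (fun n : ℕ => Real.log (max ‖(hen P a)^[n] z‖ 1) / (d : ℝ) ^ n)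
    atTop (𝓝 (G z))
  C1 : ℝ
  C2 : ℝ
  R : ℝ
  hC1 : 1 ≤ C1
  hC2 : 1 ≤ C2
  hA : ∀ x y : ℂ, R ≤ ‖y‖ → ‖x‖ ≤ ‖y‖ → ‖P y - a * x - y ^ d‖ * ‖y‖ ≤ C1 * ‖y‖ ^ d
  hB : ∀ y δ δ' : ℂ, R ≤ ‖y‖ → ‖δ‖ ≤ 6 * C1 + 2 → ‖δ'‖ ≤ 6 * C1 + 2 →
    ‖P (y + δ) - P (y + δ') - d * y ^ (d - 1) * (δ - δ')‖ * ‖y‖ ≤ C2 * ‖y‖ ^ (d - 1) * ‖δ - δ'‖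
  hR : 1000 * (d * (C1 * (C2 * ((1 + ‖a‖) * (1 + ‖a‖⁻¹))))) ≤ R

namespace HD
variable (D : HD)

def H : ℂ × ℂ → ℂ × ℂ := hen D.P D.a

def Hi (z : ℂ × ℂ) : ℂ × ℂ := ((D.P z.1 - z.2) / D.a, z.1)

lemma H_fst (z) : (D.H z).1 = z.2 := rfl
lemma H_snd (z) : (D.H z).2 = D.P z.2 - D.a * z.1 := rfl

lemma Hi_H (z) : D.Hi (D.H z) = z := by
  have := D.ha
  ext
  · simp [Hi, H, hen]
    field_simp
  · simp [Hi, H, hen]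

lemma H_Hi (z) : D.H (D.Hi z) = z := by
  have := D.ha
  ext
  · simp [Hi, H, hen]
  · simp [Hi, H, hen]
    field_simp
    ring

lemma H_diff : Differentiable ℂ D.H := by
  have := D.hP
  unfold H hen
  fun_prop

lemma Hi_diff : Differentiable ℂ D.Hi := by
  have := D.hP
  unfold Hi
  fun_prop

lemma Hn_diff (n : ℕ) : Differentiable ℂ (D.H^[n]) := by
  induction n with
  | zero => simp
  | succ n ih => rw [Function.iterate_succ]; exact ih.comp D.H_diff

lemma Hin_diff (n : ℕ) : Differentiable ℂ (D.Hi^[n]) := by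
  induction n with
  | zero => simp
  | succ n ih => rw [Function.iterate_succ]; exact ih.comp D.Hi_diff

lemma Hin_Hn (n : ℕ) (z) : D.Hi^[n] (D.H^[n] z) = z :=
  (Function.LeftInverse.iterate D.Hi_H n) z

lemma Hn_Hin (n : ℕ) (z) : D.H^[n] (D.Hi^[n] z) = z :=
  (Function.LeftInverse.iterate D.H_Hi n) z

lemma d_pos : (0:ℝ) < D.d := by have := D.hd; positivity
lemma d_two : (2:ℝ) ≤ D.d := by exact_mod_cast D.hd
lemma d_ne : (D.d : ℂ) ≠ 0 := by have := D.hd; exact_mod_cast (by omega : D.d ≠ 0)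
lemma a_pos : 0 < ‖D.a‖ := norm_pos_iff.2 D.ha

lemma R_all : 1000 ≤ D.R ∧ 1000 * D.C1 ≤ D.R ∧ 1000 * D.C2 ≤ D.R ∧ 1000 * ‖D.a‖ ≤ D.R ∧
    1000 * ‖D.a‖⁻¹ ≤ D.R ∧ 1000 * (D.d * D.C1) ≤ D.R ∧ 1000 * D.d ≤ D.R ∧
    1000 * (D.C1 * (1 + ‖D.a‖)) ≤ D.R ∧ 1000 * (D.C2 * (1 + ‖D.a‖)) ≤ D.R ∧
    1000 * (D.C1 * (D.C2 * (1 + ‖D.a‖))) ≤ D.R := by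
  have h1 := D.hC1
  have h2 := D.hC2
  have h3 := D.d_two
  have h4 : 1 ≤ 1 + ‖D.a‖ := by have := D.a_pos; linarith
  have h5 : 1 ≤ 1 + ‖D.a‖⁻¹ := by have := inv_pos.2 D.a_pos; linarith
  have hR := D.hR
  have h6 : ‖D.a‖ ≤ 1 + ‖D.a‖ := by linarith
  have h7 : ‖D.a‖⁻¹ ≤ 1 + ‖D.a‖⁻¹ := by linarith
  have h3' : (1:ℝ) ≤ D.d := by linarith
  set A := 1 + ‖D.a‖ with hA
  set B := 1 + ‖D.a‖⁻¹ with hB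
  have key : ∀ e1 e2 e3 e4 e5 : ℝ, 0 ≤ e1 → 0 ≤ e2 → 0 ≤ e3 → 0 ≤ e4 → 0 ≤ e5 →
      e1 ≤ D.d → e2 ≤ D.C1 → e3 ≤ D.C2 → e4 ≤ A → e5 ≤ B →
      1000 * (e1 * (e2 * (e3 * (e4 * e5)))) ≤ D.R := by
    intro e1 e2 e3 e4 e5 p1 p2 p3 p4 p5 q1 q2 q3 q4 q5
    refine le_trans ?_ hR
    gcongr
  have na := norm_nonneg D.a
  have na' : 0 ≤ ‖D.a‖⁻¹ := by positivity
  refine ⟨?_, ?_, ?_, ?_, ?_, ?_, ?_, ?_, ?_, ?_⟩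
  · simpa using key 1 1 1 1 1 (by norm_num) (by norm_num) (by norm_num) (by norm_num) (by norm_num) h3' h1 h2 h4 h5
  · simpa using key 1 D.C1 1 1 1 (by norm_num) (by linarith) (by norm_num) (by norm_num) (by norm_num) h3' le_rfl h2 h4 h5
  · simpa using key 1 1 D.C2 1 1 (by norm_num) (by norm_num) (by linarith) (by norm_num) (by norm_num) h3' h1 le_rfl h4 h5
  · simpa using key 1 1 1 ‖D.a‖ 1 (by norm_num) (by norm_num) (by norm_num) na (by norm_num) h3' h1 h2 h6 h5
  · simpa using key 1 1 1 1 ‖D.a‖⁻¹ (by norm_num) (by norm_num) (by norm_num) (by norm_num) na' h3' h1 h2 h4 h7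
  · simpa using key D.d D.C1 1 1 1 (by linarith) (by linarith) (by norm_num) (by norm_num) (by norm_num) le_rfl le_rfl h2 h4 h5
  · simpa using key D.d 1 1 1 1 (by linarith) (by norm_num) (by norm_num) (by norm_num) (by norm_num) le_rfl h1 h2 h4 h5
  · simpa using key 1 D.C1 1 A 1 (by norm_num) (by linarith) (by norm_num) (by linarith) (by norm_num) h3' le_rfl h2 le_rfl h5
  · simpa using key 1 1 D.C2 A 1 (by norm_num) (by norm_num) (by linarith) (by linarith) (by norm_num) h3' h1 le_rfl le_rfl h5
  · simpa using key 1 D.C1 D.C2 A 1 (by norm_num) (by linarith) (by linarith) (by linarith) (by norm_num) h3' le_rfl le_rfl le_rfl h5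

/-- the escaping cone -/
def V : Set (ℂ × ℂ) := {z | D.R < ‖z.2‖ ∧ ‖z.1‖ < ‖z.2‖}

lemma V_open : IsOpen D.V := by
  have h1 : IsOpen {z : ℂ × ℂ | D.R < ‖z.2‖} := isOpen_lt (by fun_prop) (by fun_prop)
  have h2 : IsOpen {z : ℂ × ℂ | ‖z.1‖ < ‖z.2‖} := isOpen_lt (by fun_prop) (by fun_prop)
  exact h1.inter h2

/-- second coordinates of the orbit -/
def Y (n : ℕ) (z : ℂ × ℂ) : ℂ := (D.H^[n] z).2
/-- first coordinates of the orbit -/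
def X (n : ℕ) (z : ℂ × ℂ) : ℂ := (D.H^[n] z).1

lemma X_succ (n z) : D.X (n+1) z = D.Y n z := by
  simp [X, Y, Function.iterate_succ_apply', H_fst]
lemma Y_succ (n z) : D.Y (n+1) z = D.P (D.Y n z) - D.a * D.X n z := by
  simp [X, Y, Function.iterate_succ_apply', H_snd]
lemma Y_zero (z) : D.Y 0 z = z.2 := rfl
lemma X_zero (z) : D.X 0 z = z.1 := rfl
lemma Y_add (n m z) : D.Y (n+m) z = D.Y n (D.H^[m] z) := by
  simp [Y, Function.iterate_add_apply]
lemma X_add (n m z) : D.X (n+m) z = D.X n (D.H^[m] z) := by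
  simp [X, Function.iterate_add_apply]

lemma V_y {z} (hz : z ∈ D.V) : D.R < ‖z.2‖ := hz.1

/-- basic step estimate -/
lemma step {z} (hz : z ∈ D.V) : ‖(D.H z).2 - z.2 ^ D.d‖ * ‖z.2‖ ≤ D.C1 * ‖z.2‖ ^ D.d := by
  rw [H_snd]; exact D.hA _ _ hz.1.le hz.2.le

lemma step_ratio {z} (hz : z ∈ D.V) : ‖(D.H z).2 / z.2 ^ D.d - 1‖ ≤ D.C1 / ‖z.2‖ := by
  have h := D.step hz
  have hp : 0 < ‖z.2‖ := by have := D.R_all.1; have := hz.1; linarith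
  have hne : z.2 ≠ 0 := norm_pos_iff.1 hp
  have : (D.H z).2 / z.2 ^ D.d - 1 = ((D.H z).2 - z.2 ^ D.d) / z.2 ^ D.d := by
    field_simp
  rw [this, norm_div, norm_pow, div_le_div_iff₀ (by positivity) hp]
  linarith

lemma C1_div {z} (hz : z ∈ D.V) : D.C1 / ‖z.2‖ ≤ 1/1000 := by
  have := D.R_all.2.1
  have h0 := D.R_all.1
  have := hz.1
  rw [div_le_iff₀ (by linarith)]; linarith

lemma step_bounds {z} (hz : z ∈ D.V) :
    ‖z.2‖ ^ D.d * (999/1000) ≤ ‖(D.H z).2‖ ∧ ‖(D.H z).2‖ ≤ ‖z.2‖ ^ D.d * (1001/1000) := by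
  have h := D.step hz
  have h1 := D.C1_div hz
  have hp : 0 < ‖z.2‖ := by have := D.R_all.1; have := hz.1; linarith
  have h2 : ‖(D.H z).2 - z.2 ^ D.d‖ ≤ ‖z.2‖ ^ D.d * (1/1000) := by
    have : ‖(D.H z).2 - z.2 ^ D.d‖ ≤ (D.C1 / ‖z.2‖) * ‖z.2‖ ^ D.d := by
      rw [div_mul_eq_mul_div, le_div_iff₀ hp]; exact h
    refine this.trans ?_
    rw [mul_comm]; gcongr
  have h3 := norm_sub_norm_le (z.2 ^ D.d) (D.H z).2
  have h4 := norm_sub_norm_le (D.H z).2 (z.2 ^ D.d)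
  rw [norm_sub_rev] at h3
  rw [norm_pow] at h3 h4
  constructor <;> linarith

lemma step_sq {z} (hz : z ∈ D.V) : ‖z.2‖ ^ 2 / 2 ≤ ‖(D.H z).2‖ := by
  have h := (D.step_bounds hz).1
  have hp : 1 ≤ ‖z.2‖ := by have := D.R_all.1; have := hz.1; linarith
  have := pow_le_pow_right₀ hp D.hd
  nlinarith

lemma step_lin {z} (hz : z ∈ D.V) : D.R / 2 * ‖z.2‖ ≤ ‖(D.H z).2‖ := by
  have h := D.step_sq hz
  have := hz.1
  have := D.R_all.1
  nlinarith

lemma H_V {z} (hz : z ∈ D.V) : D.H z ∈ D.V := by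
  have h := D.step_lin hz
  have h1 := hz.1
  have h2 := D.R_all.1
  have : ‖z.2‖ < ‖(D.H z).2‖ := by nlinarith
  exact ⟨by linarith, by rw [H_fst]; exact this⟩

lemma Hn_V {z} (hz : z ∈ D.V) (n : ℕ) : D.H^[n] z ∈ D.V := by
  induction n with
  | zero => exact hz
  | succ n ih => rw [Function.iterate_succ_apply']; exact D.H_V ih

lemma Y_lower {z} (hz : z ∈ D.V) (n : ℕ) : (D.R / 2) ^ n * ‖z.2‖ ≤ ‖D.Y n z‖ := by
  have h2 := D.R_all.1
  induction n with
  | zero => simp [Y_zero]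
  | succ n ih =>
    have := D.step_lin (D.Hn_V hz n)
    rw [← Function.iterate_succ_apply' D.H n z] at this
    change _ ≤ ‖D.Y (n+1) z‖ at this
    change D.R / 2 * ‖D.Y n z‖ ≤ _ at this
    calc (D.R / 2) ^ (n+1) * ‖z.2‖ = D.R / 2 * ((D.R / 2) ^ n * ‖z.2‖) := by ring
      _ ≤ D.R / 2 * ‖D.Y n z‖ := by gcongr
      _ ≤ _ := this

lemma V_ne {z} (hz : z ∈ D.V) : z.2 ≠ 0 := by
  have := hz.1; have := D.R_all.1
  exact norm_pos_iff.1 (by linarith)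

lemma Y_ne {z} (hz : z ∈ D.V) (n : ℕ) : D.Y n z ≠ 0 := D.V_ne (D.Hn_V hz n)

lemma Y_tendsto {z} (hz : z ∈ D.V) : Tendsto (fun n => ‖D.Y n z‖) atTop atTop := by
  have h2 := D.R_all.1
  have := hz.1
  refine tendsto_atTop_mono (D.Y_lower hz) ?_
  exact (tendsto_pow_atTop_atTop_of_one_lt (by linarith)).atTop_mul_const (by linarith)

lemma norm_Hn_V {z} (hz : z ∈ D.V) (n : ℕ) : ‖D.H^[n] z‖ = ‖D.Y n z‖ := by
  have := D.Hn_V hz n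
  rw [Prod.norm_def]
  exact max_eq_right this.2.le

lemma G_H (z) : D.G (D.H z) = D.d * D.G z := by
  have h1 := D.hGlim (D.H z)
  have h2 := ((D.hGlim z).comp (tendsto_add_atTop_nat 1)).const_mul (D.d : ℝ)
  refine tendsto_nhds_unique h1 (h2.congr ?_)
  intro n
  have := D.d_pos
  simp only [Function.comp, Function.iterate_succ_apply, pow_succ]
  change _ = Real.log (max ‖(hen D.P D.a)^[n] (hen D.P D.a z)‖ 1) / _
  field_simp

lemma G_Hn (n : ℕ) (z) : D.G (D.H^[n] z) = (D.d:ℝ)^n * D.G z := by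
  induction n with
  | zero => simp
  | succ n ih => rw [Function.iterate_succ_apply', G_H, ih]; ring

lemma escape {z} (hz : 0 < D.G z) : ∃ n, D.H^[n] z ∈ D.V := by
  by_contra! hcon
  have hb : ∀ n, ‖D.Y n z‖ ≤ max ‖z.1‖ D.R ∧ ‖D.X n z‖ ≤ max ‖z.1‖ D.R := by
    intro n
    induction n with
    | zero =>
      refine ⟨?_, le_max_left _ _⟩
      have := hcon 0
      by_contra! h
      rw [Y_zero, max_lt_iff] at h
      exact this ⟨h.2, h.1⟩
    | succ n ih =>
      have hx : ‖D.X (n+1) z‖ ≤ max ‖z.1‖ D.R := by rw [X_succ]; exact ih.1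
      refine ⟨?_, hx⟩
      have := hcon (n+1)
      by_contra! h
      exact this ⟨(le_max_right _ _).trans_lt h, hx.trans_lt h⟩
  set M := max ‖z.1‖ D.R
  have hd := D.d_two
  have h0 : Tendsto (fun n : ℕ => Real.log (max M 1) / (D.d:ℝ)^n) atTop (𝓝 0) := by
    refine Tendsto.const_div_atTop ?_ _
    exact tendsto_pow_atTop_atTop_of_one_lt (by linarith)
  have := le_of_tendsto_of_tendsto' (D.hGlim z) h0 (by
    intro n
    gcongr
    have : ‖(hen D.P D.a)^[n] z‖ ≤ M := by
      rw [Prod.norm_def]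
      exact max_le (hb n).2 (hb n).1
    exact this)
  linarith

lemma escape' {z} {m : ℕ} (h : D.H^[m] z ∈ D.V) {n : ℕ} (hn : m ≤ n) : D.H^[n] z ∈ D.V := by
  obtain ⟨k, rfl⟩ := Nat.exists_eq_add_of_le hn
  rw [add_comm, Function.iterate_add_apply]
  exact D.Hn_V h k

end HD
end

open Filter Topology Set
noncomputable section
namespace HD
variable (D : HD)

/-- terms of the series defining the Bottcher-type function -/
def sTerm (k : ℕ) (z : ℂ × ℂ) : ℂ :=
  Complex.log (D.Y (k+1) z / (D.Y k z) ^ D.d) / (D.d : ℂ) ^ (k+1)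

def S (z : ℂ × ℂ) : ℂ := ∑' k, D.sTerm k z

def phi (z : ℂ × ℂ) : ℂ := z.2 * Complex.exp (D.S z)

lemma sTerm_succ (k z) : D.sTerm (k+1) z = D.sTerm k (D.H z) / D.d := by
  have := D.d_ne
  simp only [sTerm]
  have e1 : D.Y (k+1+1) z = D.Y (k+1) (D.H z) := D.Y_add (k+1) 1 z
  have e2 : D.Y (k+1) z = D.Y k (D.H z) := D.Y_add k 1 z
  rw [e1, e2, pow_succ (D.d:ℂ) (k+1)]
  field_simp

lemma ratio_bound {z} (hz : z ∈ D.V) (k : ℕ) :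
    ‖D.Y (k+1) z / (D.Y k z) ^ D.d - 1‖ ≤ D.C1 / ‖z.2‖ := by
  have h := D.step_ratio (D.Hn_V hz k)
  rw [← Function.iterate_succ_apply' D.H k z] at h
  refine h.trans ?_
  have h1 := D.Y_lower hz k
  have h2 := D.R_all.1
  have h3 := hz.1
  have h4 : ‖z.2‖ ≤ ‖(D.H^[k] z).2‖ := by
    refine le_trans ?_ h1
    have : 1 ≤ (D.R/2)^k := one_le_pow₀ (by linarith)
    nlinarith
  have := D.hC1
  gcongr
  linarith

lemma log_bound {z} (hz : z ∈ D.V) (k : ℕ) :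
    ‖Complex.log (D.Y (k+1) z / (D.Y k z) ^ D.d)‖ ≤ 3/2 * (D.C1 / ‖z.2‖) := by
  have h := D.ratio_bound hz k
  have h1 := D.C1_div hz
  have := Complex.norm_log_one_add_half_le_self (z := D.Y (k+1) z / (D.Y k z) ^ D.d - 1)
    (by linarith)
  rw [add_sub_cancel] at this
  linarith

lemma sTerm_bound {z} (hz : z ∈ D.V) (k : ℕ) :
    ‖D.sTerm k z‖ ≤ 3/2 * (D.C1 / ‖z.2‖) * ((1/2) ^ (k+1)) := by
  have h := D.log_bound hz k
  have hd := D.d_two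
  rw [sTerm, norm_div, norm_pow, Complex.norm_natCast, div_eq_mul_inv, ← inv_pow]
  have : (D.d:ℝ)⁻¹ ≤ 1/2 := by rw [one_div]; exact inv_anti₀ (by norm_num) hd
  have h0 : 0 ≤ (D.d:ℝ)⁻¹ := by positivity
  have h9 : 0 ≤ 3 / 2 * (D.C1 / ‖z.2‖) := by have := D.hC1; positivity
  gcongr

lemma geo_sum : HasSum (fun k : ℕ => ((1:ℝ)/2)^(k+1)) 1 := by
  have := (hasSum_geometric_two).mul_left (1/2 : ℝ)
  have e : (fun k : ℕ => ((1:ℝ)/2)^(k+1)) = fun i => 1 / 2 * (1 / 2) ^ i := by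
    funext k; rw [pow_succ]; ring
  rw [e]; simpa using this

lemma S_summable {z} (hz : z ∈ D.V) : Summable (fun k => D.sTerm k z) :=
  Summable.of_norm_bounded (geo_sum.summable.mul_left _) (D.sTerm_bound hz)

lemma S_bound {z} (hz : z ∈ D.V) : ‖D.S z‖ ≤ 3/2 * (D.C1 / ‖z.2‖) := by
  have := tsum_of_norm_bounded (geo_sum.mul_left (3/2 * (D.C1 / ‖z.2‖))) (D.sTerm_bound hz)
  rw [mul_one] at this
  exact this

lemma S_H {z} (hz : z ∈ D.V) :
    D.S (D.H z) = D.d * D.S z - Complex.log (D.Y 1 z / z.2 ^ D.d) := by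
  have hd := D.d_ne
  have h := (D.S_summable hz).tsum_eq_zero_add
  have h2 : ∑' k, D.sTerm (k+1) z = D.S (D.H z) / D.d := by
    simp only [sTerm_succ, S, tsum_div_const]
  rw [h2] at h
  change D.S z = _ at h
  rw [h]
  simp only [sTerm, Y_zero]
  field_simp
  ring

lemma phi_H {z} (hz : z ∈ D.V) : D.phi (D.H z) = D.phi z ^ D.d := by
  have hz2 := D.V_ne hz
  have hz3 : D.Y 1 z ≠ 0 := D.Y_ne hz 1
  have e : (D.H z).2 = D.Y 1 z := rfl
  rw [phi, phi, D.S_H hz, Complex.exp_sub, Complex.exp_log (by positivity), mul_pow,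
    ← Complex.exp_nat_mul, e]
  field_simp

lemma phi_Hn {z} (hz : z ∈ D.V) (n : ℕ) : D.phi (D.H^[n] z) = D.phi z ^ (D.d ^ n) := by
  induction n with
  | zero => simp
  | succ n ih => rw [Function.iterate_succ_apply', D.phi_H (D.Hn_V hz n), ih, ← pow_mul, pow_succ]

lemma phi_sub {z} (hz : z ∈ D.V) : ‖D.phi z - z.2‖ ≤ 3 * D.C1 := by
  have h := D.S_bound hz
  have h1 := D.C1_div hz
  have hp : 0 < ‖z.2‖ := norm_pos_iff.2 (D.V_ne hz)
  have h2 := Complex.norm_exp_sub_one_le (x := D.S z) (by linarith)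
  have : D.phi z - z.2 = z.2 * (Complex.exp (D.S z) - 1) := by rw [phi]; ring
  rw [this, norm_mul]
  calc ‖z.2‖ * ‖Complex.exp (D.S z) - 1‖ ≤ ‖z.2‖ * (2 * (3/2 * (D.C1 / ‖z.2‖))) := by
        gcongr; linarith
    _ = 3 * D.C1 := by field_simp

lemma phi_norm {z} (hz : z ∈ D.V) : ‖z.2‖ / 2 ≤ ‖D.phi z‖ ∧ ‖D.phi z‖ ≤ 2 * ‖z.2‖ := by
  have h := D.phi_sub hz
  have h1 := D.R_all.2.1
  have h2 := hz.1
  have h3 := norm_sub_norm_le (D.phi z) z.2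
  have h4 := norm_sub_norm_le z.2 (D.phi z)
  rw [norm_sub_rev] at h4
  have := D.hC1
  constructor <;> linarith

lemma phi_ne {z} (hz : z ∈ D.V) : D.phi z ≠ 0 := by
  have := (D.phi_norm hz).1
  have hp : 0 < ‖z.2‖ := norm_pos_iff.2 (D.V_ne hz)
  exact norm_pos_iff.1 (by linarith)

lemma log_Y_phi {z} (hz : z ∈ D.V) (n : ℕ) :
    |Real.log ‖D.Y n z‖ - (D.d:ℝ)^n * Real.log ‖D.phi z‖| ≤ Real.log 2 := by
  have h := D.phi_norm (D.Hn_V hz n)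
  change ‖D.Y n z‖ / 2 ≤ _ ∧ _ ≤ 2 * ‖D.Y n z‖ at h
  have hp : 0 < ‖D.Y n z‖ := norm_pos_iff.2 (D.Y_ne hz n)
  have hq : 0 < ‖D.phi (D.H^[n] z)‖ := norm_pos_iff.2 (D.phi_ne (D.Hn_V hz n))
  have e : (D.d:ℝ)^n * Real.log ‖D.phi z‖ = Real.log ‖D.phi (D.H^[n] z)‖ := by
    rw [D.phi_Hn hz, norm_pow, Real.log_pow]; push_cast; rfl
  rw [e]
  have h1 := Real.log_le_log (by positivity) h.1
  have h2 := Real.log_le_log hq h.2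
  rw [Real.log_div (by positivity) (by norm_num)] at h1
  rw [Real.log_mul (by norm_num) (by positivity)] at h2
  rw [abs_le]; constructor <;> linarith

lemma G_phi {z} (hz : z ∈ D.V) : D.G z = Real.log ‖D.phi z‖ := by
  refine tendsto_nhds_unique (D.hGlim z) ?_
  have hd := D.d_two
  rw [tendsto_iff_dist_tendsto_zero]
  refine squeeze_zero (fun _ => dist_nonneg) (g := fun n : ℕ => Real.log 2 / (D.d:ℝ)^n) ?_ ?_
  · intro n
    have h := D.log_Y_phi hz n
    have e1 : max ‖(hen D.P D.a)^[n] z‖ 1 = ‖D.Y n z‖ := by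
      have := D.norm_Hn_V hz n
      have h2 := (D.Hn_V hz n).1
      change D.R < ‖D.Y n z‖ at h2
      have := D.R_all.1
      change max ‖D.H^[n] z‖ 1 = _
      rw [D.norm_Hn_V hz n]; exact max_eq_left (by linarith)
    rw [e1, Real.dist_eq]
    have hp : (0:ℝ) < (D.d:ℝ)^n := by positivity
    rw [le_div_iff₀ hp]
    have : |Real.log ‖D.Y n z‖ / (D.d:ℝ)^n - Real.log ‖D.phi z‖| * (D.d:ℝ)^n =
        |Real.log ‖D.Y n z‖ - (D.d:ℝ)^n * Real.log ‖D.phi z‖| := by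
      nth_rewrite 2 [← abs_of_pos hp]
      rw [← abs_mul]; congr 1; field_simp
    rw [this]; exact h
  · refine Tendsto.const_div_atTop ?_ _
    exact tendsto_pow_atTop_atTop_of_one_lt (by linarith)

lemma log_Y {z} (hz : z ∈ D.V) (n : ℕ) :
    |Real.log ‖D.Y n z‖ - (D.d:ℝ)^n * D.G z| ≤ Real.log 2 := by
  rw [D.G_phi hz]; exact D.log_Y_phi hz n

lemma G_lower {z} (hz : z ∈ D.V) : Real.log ‖z.2‖ - Real.log 2 ≤ D.G z := by
  have := D.log_Y hz 0
  rw [abs_le] at this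
  simp only [Y_zero, pow_zero, one_mul] at this
  linarith

lemma G_pos {z} (hz : z ∈ D.V) : 0 < D.G z := by
  have h := D.G_lower hz
  have h1 := hz.1
  have h2 := D.R_all.1
  have : Real.log 2 < Real.log ‖z.2‖ := Real.log_lt_log (by norm_num) (by linarith)
  linarith

lemma Y_diff (n : ℕ) : Differentiable ℂ (D.Y n) := by
  have := D.Hn_diff n
  unfold Y; fun_prop

lemma X_diff (n : ℕ) : Differentiable ℂ (D.X n) := by
  have := D.Hn_diff n
  unfold X; fun_prop

lemma sTerm_diff (k : ℕ) {q : ℂ → ℂ × ℂ} {U : Set ℂ} (hU : IsOpen U) (hq : DifferentiableOn ℂ q U)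
    (hm : MapsTo q U D.V) : DifferentiableOn ℂ (fun t => D.sTerm k (q t)) U := by
  intro t ht
  refine DifferentiableAt.differentiableWithinAt ?_
  have hz := hm ht
  have hqt : DifferentiableAt ℂ q t := hq.differentiableAt (hU.mem_nhds ht)
  have h := D.ratio_bound hz k
  have h1 := D.C1_div hz
  unfold sTerm
  refine DifferentiableAt.div_const ?_ _
  have y1 : DifferentiableAt ℂ (fun t => D.Y (k+1) (q t)) t := (D.Y_diff (k+1) _).comp t hqt
  have y0 : DifferentiableAt ℂ (fun t => D.Y k (q t)) t := (D.Y_diff k _).comp t hqt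
  refine DifferentiableAt.clog ?_ ?_
  · exact y1.div (y0.pow _) (pow_ne_zero _ (D.Y_ne hz k))
  · have := Complex.mem_slitPlane_of_norm_lt_one
      (z := D.Y (k+1) (q t) / (D.Y k (q t)) ^ D.d - 1) (by linarith)
    rwa [add_sub_cancel] at this

lemma S_diff {q : ℂ → ℂ × ℂ} {U : Set ℂ} (hU : IsOpen U) (hq : DifferentiableOn ℂ q U)
    (hm : MapsTo q U D.V) : DifferentiableOn ℂ (fun t => D.S (q t)) U := by
  refine Complex.differentiableOn_tsum_of_summable_norm (u := fun k : ℕ => ((1/2:ℝ)^(k+1)))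
    geo_sum.summable (fun k => D.sTerm_diff k hU hq hm) hU ?_
  intro k t ht
  refine (D.sTerm_bound (hm ht) k).trans ?_
  have h1 := D.C1_div (hm ht)
  have : (0:ℝ) < (1/2)^(k+1) := by positivity
  nlinarith

lemma phi_diff {q : ℂ → ℂ × ℂ} {U : Set ℂ} (hU : IsOpen U) (hq : DifferentiableOn ℂ q U)
    (hm : MapsTo q U D.V) : DifferentiableOn ℂ (fun t => D.phi (q t)) U := by
  have h := D.S_diff hU hq hm
  unfold phi
  have h2 : DifferentiableOn ℂ (fun t => (q t).2) U := by fun_prop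
  exact h2.mul h.cexp

end HD
end

open Filter Topology Set
noncomputable section

lemma seq1 (T : ℕ → ℂ) (β : ℝ) (hβ0 : 0 ≤ β) (hβ : β ≤ 1/8)
    (h : ∀ n, ‖T n - T (n+1)‖ ≤ β * (1/2)^n * ‖T (n+1)‖) :
    ∃ τ, Tendsto T atTop (𝓝 τ) ∧ ∀ n, ‖τ - T n‖ ≤ 8 * β * (1/2)^n * ‖T 0‖ := by
  have hpow : ∀ n : ℕ, ((1:ℝ)/2)^n ≤ 1 := fun n => pow_le_one₀ (by norm_num) (by norm_num)
  have hpos : ∀ n : ℕ, 0 < ((1:ℝ)/2)^n := fun n => by positivity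
  have h1 : ∀ n, ‖T n - T (n+1)‖ ≤ 2 * β * (1/2)^n * ‖T n‖ := by
    intro n
    have a1 := h n
    have a2 := norm_sub_norm_le (T (n+1)) (T n)
    rw [norm_sub_rev] at a2
    have b1 : β * (1/2)^n ≤ 1/8 := by have := hpow n; have := hpos n; nlinarith
    have b0 : 0 ≤ β * (1/2)^n := by positivity
    have : ‖T (n+1)‖ ≤ 2 * ‖T n‖ := by
      have := norm_nonneg (T (n+1)); nlinarith
    calc _ ≤ _ := a1
      _ ≤ β * (1/2)^n * (2 * ‖T n‖) := by gcongr
      _ = _ := by ring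
  have h2 : ∀ n, ‖T n‖ ≤ ‖T 0‖ * (2 - (1/2)^n) := by
    intro n
    induction n with
    | zero => norm_num
    | succ n ih =>
      have a1 := h1 n
      have a2 := norm_sub_norm_le (T (n+1)) (T n)
      rw [norm_sub_rev] at a2
      have b0 := hpos n
      have b1 := hpow n
      have a3 : ‖T (n+1)‖ ≤ (1 + 2 * β * (1/2)^n) * ‖T n‖ := by linarith
      refine a3.trans ?_
      have a4 : (1 + 2 * β * (1/2)^n) * ‖T n‖ ≤ (1 + 2 * β * (1/2)^n) * (‖T 0‖ * (2 - (1/2)^n)) := by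
        gcongr
      refine a4.trans ?_
      have t0 := norm_nonneg (T 0)
      rw [pow_succ]
      set x := ((1:ℝ)/2)^n
      have : (1 + 2 * β * x) * (2 - x) ≤ 2 - x * (1/2) := by
        nlinarith [mul_nonneg hβ0 b0.le, mul_nonneg (mul_nonneg hβ0 b0.le) b0.le]
      nlinarith
  have h3 : ∀ n, ‖T n - T (n+1)‖ ≤ 4 * β * ‖T 0‖ * (1/2)^n := by
    intro n
    refine (h1 n).trans ?_
    have : ‖T n‖ ≤ 2 * ‖T 0‖ := by
      have := h2 n; have := hpos n; have := norm_nonneg (T 0); nlinarith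
    calc _ ≤ 2 * β * (1/2)^n * (2 * ‖T 0‖) := by gcongr
      _ = _ := by ring
  have h4 : ∀ n, dist (T n) (T (n+1)) ≤ 4 * β * ‖T 0‖ * (1/2)^n := by
    intro n; rw [dist_eq_norm]; exact h3 n
  have hc := cauchySeq_of_le_geometric (1/2:ℝ) (4 * β * ‖T 0‖) (by norm_num) h4
  obtain ⟨τ, hτ⟩ := cauchySeq_tendsto_of_complete hc
  refine ⟨τ, hτ, fun n => ?_⟩
  have := dist_le_of_le_geometric_of_tendsto (1/2:ℝ) (4 * β * ‖T 0‖) (by norm_num) h4 hτ n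
  rw [dist_comm, dist_eq_norm] at this
  refine this.trans (le_of_eq ?_)
  ring

namespace HD
variable (D : HD)

def lam : ℂ := D.d / D.a
lemma lam_ne : D.lam ≠ 0 := div_ne_zero D.d_ne D.ha
lemma lam_norm : ‖D.lam‖ = D.d / ‖D.a‖ := by simp [lam]

def Stab (z w : ℂ × ℂ) : Prop := Tendsto (fun n => D.Y n w - D.Y n z) atTop (𝓝 0)

variable {D}
lemma Stab.symm {z w} (h : D.Stab z w) : D.Stab w z := by
  have := Filter.Tendsto.neg h
  simpa [Stab] using this
lemma Stab.trans {z w v} (h : D.Stab z w) (h2 : D.Stab w v) : D.Stab z v := by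
  have := Filter.Tendsto.add h h2
  unfold Stab
  simpa [Stab] using this
lemma Stab.refl (z) : D.Stab z z := by simp [Stab]
variable (D)
lemma Stab_Hn (m : ℕ) (z w) : D.Stab (D.H^[m] z) (D.H^[m] w) ↔ D.Stab z w := by
  unfold Stab
  simp only [← Y_add]
  exact tendsto_add_atTop_iff_nat (f := fun n => D.Y n w - D.Y n z) m

lemma rec_raw {z w w' : ℂ × ℂ} (hz : z ∈ D.V) (h1 : ‖w.2 - z.2‖ ≤ 6 * D.C1 + 2)
    (h2 : ‖w'.2 - z.2‖ ≤ 6 * D.C1 + 2) :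
    ‖z.2 * (w.1 - w'.1) - D.lam * (D.H z).2 * (w.2 - w'.2)‖ ≤
      2 * (D.C1 + D.C2) / ‖z.2‖ * ‖D.lam * (D.H z).2 * (w.2 - w'.2)‖ +
        ‖z.2‖ / ‖D.a‖ * ‖(D.H w).2 - (D.H w').2‖ := by
  have ha := D.ha
  have hb := D.hB z.2 _ _ hz.1.le h1 h2
  rw [add_sub_cancel, add_sub_cancel] at hb
  have hst := D.step hz
  have hlow := (D.step_bounds hz).1
  have hp : 0 < ‖z.2‖ := norm_pos_iff.2 (D.V_ne hz)
  have ap := D.a_pos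
  have hd := D.d_two
  set y := z.2
  set y1 := (D.H z).2
  set Δ := w.2 - w'.2 with hΔ
  have eΔ : w.2 - y - (w'.2 - y) = Δ := by rw [hΔ]; ring
  rw [eΔ] at hb
  set err := D.P w.2 - D.P w'.2 - D.d * y ^ (D.d - 1) * Δ with herr
  have hyd : y ^ D.d = y * y ^ (D.d - 1) := by
    rw [← pow_succ']; congr 1; have := D.hd; omega
  have key : y * (w.1 - w'.1) - D.lam * y1 * Δ =
      - (D.lam * (y1 - y ^ D.d) * Δ) + y / D.a * err - y / D.a * ((D.H w).2 - (D.H w').2) := by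
    rw [herr, H_snd, H_snd, lam, hyd]
    field_simp
    ring
  rw [key]
  have n1 : ‖D.lam * (y1 - y ^ D.d) * Δ‖ ≤ 1002/1000 * D.C1 / ‖y‖ * ‖D.lam * y1 * Δ‖ := by
    rw [norm_mul, norm_mul, norm_mul, norm_mul]
    have : ‖y1 - y ^ D.d‖ ≤ 1002/1000 * D.C1 / ‖y‖ * ‖y1‖ := by
      rw [div_mul_eq_mul_div, le_div_iff₀ hp]
      have := D.hC1
      have := norm_nonneg y1
      nlinarith
    calc ‖D.lam‖ * ‖y1 - y ^ D.d‖ * ‖Δ‖ ≤ ‖D.lam‖ * (1002/1000 * D.C1 / ‖y‖ * ‖y1‖) * ‖Δ‖ := by gcongr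
      _ = _ := by ring
  have n2 : ‖y / D.a * err‖ ≤ 1002/1000 * D.C2 / ‖y‖ * ‖D.lam * y1 * Δ‖ := by
    rw [norm_mul, norm_mul, norm_mul, norm_div, lam_norm]
    have hc2 := D.hC2
    have q : ‖y‖ * ‖y‖ ^ (D.d - 1) = ‖y‖ ^ D.d := by
      rw [← pow_succ']; congr 1; have := D.hd; omega
    have e1 : ‖err‖ * ‖y‖ * ‖y‖ ≤ D.C2 * (1002/1000 * ‖y1‖) * ‖Δ‖ := by
      calc ‖err‖ * ‖y‖ * ‖y‖ ≤ D.C2 * ‖y‖ ^ (D.d - 1) * ‖Δ‖ * ‖y‖ := by gcongr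
        _ = D.C2 * (‖y‖ * ‖y‖ ^ (D.d - 1)) * ‖Δ‖ := by ring
        _ ≤ _ := by rw [q]; gcongr; linarith [norm_nonneg y1]
    have e2 : D.C2 * (1002/1000 * ‖y1‖) * ‖Δ‖ ≤ D.C2 * (1002/1000 * ‖y1‖) * ‖Δ‖ * D.d := by
      have : 0 ≤ D.C2 * (1002/1000 * ‖y1‖) * ‖Δ‖ := by positivity
      nlinarith
    have e3 := e1.trans e2
    calc ‖y‖ / ‖D.a‖ * ‖err‖ = (‖err‖ * ‖y‖ * ‖y‖) / (‖D.a‖ * ‖y‖) := by field_simp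
      _ ≤ (D.C2 * (1002/1000 * ‖y1‖) * ‖Δ‖ * D.d) / (‖D.a‖ * ‖y‖) := by gcongr
      _ = _ := by field_simp
  have n3 : ‖y / D.a * ((D.H w).2 - (D.H w').2)‖ = ‖y‖ / ‖D.a‖ * ‖(D.H w).2 - (D.H w').2‖ := by
    rw [norm_mul, norm_div]
  have t1 := norm_sub_le (- (D.lam * (y1 - y ^ D.d) * Δ) + y / D.a * err)
    (y / D.a * ((D.H w).2 - (D.H w').2))
  have t2 := norm_add_le (- (D.lam * (y1 - y ^ D.d) * Δ)) (y / D.a * err)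
  rw [norm_neg] at t2
  rw [n3] at t1
  have fin : 1002/1000 * D.C1 / ‖y‖ * ‖D.lam * y1 * Δ‖ + 1002/1000 * D.C2 / ‖y‖ * ‖D.lam * y1 * Δ‖
      ≤ 2 * (D.C1 + D.C2) / ‖y‖ * ‖D.lam * y1 * Δ‖ := by
    rw [← add_mul]
    gcongr
    rw [← add_div]
    gcongr
    have := D.hC1; have := D.hC2
    linarith
  linarith

/-- cone field lemma, one step -/
lemma grow_step {z w : ℂ × ℂ} (hz : z ∈ D.V) (h1 : ‖w.2 - z.2‖ ≤ 6 * D.C1 + 2)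
    (h : ‖w.1 - z.1‖ ≤ ‖w.2 - z.2‖) : 2 * ‖w.2 - z.2‖ ≤ ‖(D.H w).2 - (D.H z).2‖ := by
  have hb := D.hB z.2 _ 0 hz.1.le h1 (by have := D.hC1; simp; linarith)
  rw [add_sub_cancel, add_zero, sub_zero] at hb
  have hp : 0 < ‖z.2‖ := norm_pos_iff.2 (D.V_ne hz)
  set y := z.2
  set Δ := w.2 - y with hΔ
  set err := D.P w.2 - D.P y - D.d * y ^ (D.d - 1) * Δ with herr
  have key : (D.H w).2 - (D.H z).2 = D.d * y ^ (D.d - 1) * Δ + err - D.a * (w.1 - z.1) := by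
    rw [H_snd, H_snd, herr]; ring
  have hRR := D.R_all
  have hzR := hz.1
  have hyR : D.R < ‖y‖ := hzR
  have hpow : ‖y‖ ≤ ‖y‖ ^ (D.d - 1) := by
    calc ‖y‖ = ‖y‖^1 := (pow_one _).symm
      _ ≤ _ := pow_le_pow_right₀ (by linarith) (by have := D.hd; omega)
  have e1 : ‖err‖ ≤ ‖y‖ ^ (D.d - 1) * ‖Δ‖ * (1/1000) := by
    have : ‖err‖ * ‖y‖ ≤ ‖y‖ ^ (D.d - 1) * ‖Δ‖ * (1/1000) * ‖y‖ := by
      refine hb.trans ?_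
      have : D.C2 ≤ 1/1000 * ‖y‖ := by linarith
      calc D.C2 * ‖y‖ ^ (D.d - 1) * ‖Δ‖ ≤ (1/1000 * ‖y‖) * ‖y‖ ^ (D.d - 1) * ‖Δ‖ := by gcongr
        _ = _ := by ring
    exact le_of_mul_le_mul_right this hp
  have e2 : ‖D.d * y ^ (D.d - 1) * Δ‖ = D.d * (‖y‖ ^ (D.d - 1) * ‖Δ‖) := by
    rw [norm_mul, norm_mul, norm_pow, Complex.norm_natCast]; ring
  have e3 : ‖D.a * (w.1 - z.1)‖ ≤ ‖D.a‖ * ‖Δ‖ := by rw [norm_mul]; gcongr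
  have t1 : ‖D.d * y ^ (D.d - 1) * Δ‖ ≤ ‖(D.H w).2 - (D.H z).2‖ + ‖err‖ + ‖D.a * (w.1 - z.1)‖ := by
    have : D.d * y ^ (D.d - 1) * Δ = ((D.H w).2 - (D.H z).2) - err + D.a * (w.1 - z.1) := by
      rw [key]; ring
    rw [this]
    exact (norm_add_le _ _).trans (by gcongr; exact norm_sub_le _ _)
  have hd := D.d_two
  have q : ‖y‖ * ‖Δ‖ ≤ ‖y‖ ^ (D.d - 1) * ‖Δ‖ := by gcongr
  have hΔ0 := norm_nonneg Δ
  have q2 : 2 * (‖y‖ ^ (D.d - 1) * ‖Δ‖) ≤ D.d * (‖y‖ ^ (D.d - 1) * ‖Δ‖) := by gcongr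
  have q3 : (‖D.a‖ + 2) * ‖Δ‖ ≤ ‖y‖ * ‖Δ‖ := by
    gcongr; linarith
  nlinarith

lemma Y_iter_succ (n z) : (D.H (D.H^[n] z)).2 = D.Y (n+1) z := by
  rw [← Function.iterate_succ_apply' D.H n z]; rfl

lemma cone {z w : ℂ × ℂ} (hz : z ∈ D.V) (h : ∀ n, ‖D.Y n w - D.Y n z‖ ≤ 6 * D.C1 + 2) (n : ℕ) :
    ‖D.Y (n+1) w - D.Y (n+1) z‖ ≤ ‖D.Y n w - D.Y n z‖ := by
  by_contra! hc
  have key : ∀ k, 2^k * ‖D.Y (n+1) w - D.Y (n+1) z‖ ≤ ‖D.Y (n+1+k) w - D.Y (n+1+k) z‖ ∧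
      ‖D.Y (n+k) w - D.Y (n+k) z‖ ≤ ‖D.Y (n+1+k) w - D.Y (n+1+k) z‖ := by
    intro k
    induction k with
    | zero => simpa using hc.le
    | succ k ih =>
      have := D.grow_step (w := D.H^[n+1+k] w) (D.Hn_V hz (n+1+k)) (h (n+1+k)) (by
        change ‖D.X (n+1+k) w - D.X (n+1+k) z‖ ≤ ‖D.Y (n+1+k) w - D.Y (n+1+k) z‖
        have e : n + 1 + k = (n + k) + 1 := by ring
        rw [e, X_succ, X_succ, ← e]
        exact ih.2)
      rw [Y_iter_succ, Y_iter_succ] at this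
      change 2 * ‖D.Y (n+1+k) w - D.Y (n+1+k) z‖ ≤ _ at this
      have e : n + 1 + (k+1) = n + 1 + k + 1 := by ring
      have e' : n + (k + 1) = n + 1 + k := by ring
      rw [e, e']
      refine ⟨?_, ?_⟩
      · rw [pow_succ]; linarith [ih.1]
      · have := norm_nonneg (D.Y (n+1+k) w - D.Y (n+1+k) z); linarith
  have hpos : 0 < ‖D.Y (n+1) w - D.Y (n+1) z‖ := (norm_nonneg _).trans_lt hc
  obtain ⟨k, hk⟩ := pow_unbounded_of_one_lt ((6 * D.C1 + 2) / ‖D.Y (n+1) w - D.Y (n+1) z‖) (by norm_num : (1:ℝ) < 2)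
  rw [div_lt_iff₀ hpos] at hk
  have := (key k).1
  have := h (n+1+k)
  linarith

/-- normalised leafwise displacement -/
def T (n : ℕ) (z w : ℂ × ℂ) : ℂ := D.lam ^ n * D.Y n z * (D.X n w - D.X n z)

lemma T_add (n m : ℕ) (z w) : D.T (n+m) z w = D.lam ^ m * D.T n (D.H^[m] z) (D.H^[m] w) := by
  simp only [T, Y_add, X_add, pow_add]; ring

def Tau (z w : ℂ × ℂ) (t : ℂ) : Prop := Tendsto (fun n => D.T n z w) atTop (𝓝 t)

lemma Tau_Hn (m : ℕ) (z w t) : D.Tau z w (D.lam ^ m * t) ↔ D.Tau (D.H^[m] z) (D.H^[m] w) t := by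
  unfold Tau
  rw [← tendsto_add_atTop_iff_nat m]
  simp only [T_add]
  constructor
  · intro h
    have := h.const_mul ((D.lam ^ m)⁻¹)
    have hl := pow_ne_zero m D.lam_ne
    simpa [← mul_assoc, hl] using this
  · intro h; exact h.const_mul _

lemma T_step {z w : ℂ × ℂ} (hz : z ∈ D.V) (h : ∀ n, ‖D.Y n w - D.Y n z‖ ≤ 6 * D.C1 + 2) (n : ℕ) :
    ‖D.T n z w - D.T (n+1) z w‖ ≤ 1/200 * (1/2)^n * ‖D.T (n+1) z w‖ := by
  have hn := D.Hn_V hz n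
  have hr := D.rec_raw (w := D.H^[n] w) (w' := D.H^[n] z) hn (h n)
    (by have := D.hC1; simp; linarith)
  have hc := D.cone hz h n
  rw [Y_iter_succ, Y_iter_succ] at hr
  change ‖D.Y n z * (D.X n w - D.X n z) - D.lam * D.Y (n+1) z * (D.Y n w - D.Y n z)‖ ≤
    2 * (D.C1 + D.C2) / ‖D.Y n z‖ * ‖D.lam * D.Y (n+1) z * (D.Y n w - D.Y n z)‖ +
      ‖D.Y n z‖ / ‖D.a‖ * ‖D.Y (n+1) w - D.Y (n+1) z‖ at hr
  have e0 : D.T n z w - D.T (n+1) z w = D.lam ^ n *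
      (D.Y n z * (D.X n w - D.X n z) - D.lam * D.Y (n+1) z * (D.Y n w - D.Y n z)) := by
    simp only [T, X_succ]; ring
  have e1 : D.T (n+1) z w = D.lam ^ n * (D.lam * D.Y (n+1) z * (D.Y n w - D.Y n z)) := by
    simp only [T, X_succ]; ring
  rw [e0, e1, norm_mul, norm_mul]
  have hRR := D.R_all
  have hp : 0 < ‖D.Y n z‖ := norm_pos_iff.2 (D.Y_ne hz n)
  have hsq := D.step_sq hn
  rw [Y_iter_succ] at hsq
  change ‖D.Y n z‖^2/2 ≤ _ at hsq
  have ap := D.a_pos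
  have hd := D.d_two
  have q1 : ‖D.Y n z‖ / ‖D.a‖ * ‖D.Y (n+1) w - D.Y (n+1) z‖ ≤
      1 / ‖D.Y n z‖ * ‖D.lam * D.Y (n+1) z * (D.Y n w - D.Y n z)‖ := by
    rw [norm_mul, norm_mul, lam_norm]
    have s1 : ‖D.Y n z‖ * ‖D.Y n z‖ ≤ D.d * ‖D.Y (n+1) z‖ := by
      have := norm_nonneg (D.Y (n+1) z); nlinarith
    calc ‖D.Y n z‖ / ‖D.a‖ * ‖D.Y (n+1) w - D.Y (n+1) z‖
        ≤ ‖D.Y n z‖ / ‖D.a‖ * ‖D.Y n w - D.Y n z‖ := by gcongr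
      _ = (‖D.Y n z‖ * ‖D.Y n z‖) / (‖D.Y n z‖ * ‖D.a‖) * ‖D.Y n w - D.Y n z‖ := by field_simp
      _ ≤ (D.d * ‖D.Y (n+1) z‖) / (‖D.Y n z‖ * ‖D.a‖) * ‖D.Y n w - D.Y n z‖ := by gcongr
      _ = _ := by field_simp
  have q2 : (2 * (D.C1 + D.C2) + 1) / ‖D.Y n z‖ ≤ 1/200 * (1/2)^n := by
    have hl := D.Y_lower hz n
    have hz1 := hz.1
    have l2 : 2^n * D.R ≤ ‖D.Y n z‖ := by
      refine le_trans ?_ hl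
      have : (2:ℝ)^n ≤ (D.R/2)^n := by gcongr; linarith
      have : 0 ≤ (D.R/2)^n := pow_nonneg (by linarith) n
      gcongr
      linarith
    rw [div_le_iff₀ hp]
    have : (1/2:ℝ)^n * 2^n = 1 := by rw [← mul_pow]; norm_num
    calc 2 * (D.C1 + D.C2) + 1 ≤ 1/200 * ((1/2:ℝ)^n * 2^n) * D.R := by rw [this]; linarith
      _ = 1/200 * (1/2)^n * (2^n * D.R) := by ring
      _ ≤ _ := by gcongr
  set W := ‖D.lam * D.Y (n+1) z * (D.Y n w - D.Y n z)‖
  have hW : 0 ≤ W := norm_nonneg _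
  calc ‖D.lam ^ n‖ * ‖D.Y n z * (D.X n w - D.X n z) - D.lam * D.Y (n+1) z * (D.Y n w - D.Y n z)‖
      ≤ ‖D.lam ^ n‖ * ((2 * (D.C1 + D.C2) + 1) / ‖D.Y n z‖ * W) := by
        gcongr
        rw [add_div, add_mul]
        linarith
    _ ≤ ‖D.lam ^ n‖ * (1/200 * (1/2)^n * W) := by gcongr
    _ = _ := by ring

lemma tau_close {z w : ℂ × ℂ} (hz : z ∈ D.V) (h : ∀ n, ‖D.Y n w - D.Y n z‖ ≤ 6 * D.C1 + 2) :
    ∃ τ, D.Tau z w τ ∧ ∀ n, ‖τ - D.T n z w‖ ≤ 1/25 * (1/2)^n * ‖D.T 0 z w‖ := by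
  obtain ⟨τ, h1, h2⟩ := seq1 (fun n => D.T n z w) (1/200) (by norm_num) (by norm_num) (D.T_step hz h)
  refine ⟨τ, h1, fun n => (h2 n).trans (le_of_eq (by ring))⟩

lemma lamY_tendsto {z} (hz : z ∈ D.V) : Tendsto (fun n => ‖D.lam ^ n * D.Y n z‖) atTop atTop := by
  have hRR := D.R_all
  have ap := D.a_pos
  have hd := D.d_two
  have hz1 := hz.1
  refine tendsto_atTop_mono (f := fun n : ℕ => (2:ℝ)^n) ?_ (tendsto_pow_atTop_atTop_of_one_lt (by norm_num))
  intro n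
  rw [norm_mul, norm_pow, lam_norm]
  have hl := D.Y_lower hz n
  have h1 : (2:ℝ) ≤ D.d / ‖D.a‖ * (D.R/2) := by
    rw [div_mul_eq_mul_div, le_div_iff₀ ap]; nlinarith
  have h2 : 0 ≤ (D.R/2)^n := pow_nonneg (by linarith) n
  calc (2:ℝ)^n ≤ (D.d / ‖D.a‖ * (D.R/2))^n := by gcongr
    _ = (D.d / ‖D.a‖)^n * ((D.R/2)^n * 1) := by rw [mul_pow]; ring
    _ ≤ (D.d / ‖D.a‖)^n * ((D.R/2)^n * ‖z.2‖) := by gcongr <;> linarith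
    _ ≤ _ := by gcongr

lemma Tau_Stab {z w : ℂ × ℂ} {t} (hz : z ∈ D.V) (h : D.Tau z w t) : D.Stab z w := by
  unfold Stab
  rw [← tendsto_add_atTop_iff_nat 0]
  have h1 : Tendsto (fun n => D.X n w - D.X n z) atTop (𝓝 0) := by
    have h2 := tendsto_inv₀_cobounded.comp (tendsto_norm_atTop_iff_cobounded.1 (D.lamY_tendsto hz))
    have h3 := h2.mul h
    rw [zero_mul] at h3
    refine h3.congr ?_
    intro n
    have := pow_ne_zero n D.lam_ne
    have := D.Y_ne hz n
    simp only [Function.comp, T]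
    field_simp
  have := (tendsto_add_atTop_iff_nat 1).2 h1
  simpa [X_succ] using this

lemma close_of_phi {z w : ℂ × ℂ} (hz : z ∈ D.V) (hw : w ∈ D.V) (h : D.phi z = D.phi w) (n : ℕ) :
    ‖D.Y n w - D.Y n z‖ ≤ 6 * D.C1 + 2 := by
  have h1 := D.phi_sub (D.Hn_V hz n)
  have h2 := D.phi_sub (D.Hn_V hw n)
  have h3 : D.phi (D.H^[n] z) = D.phi (D.H^[n] w) := by rw [D.phi_Hn hz, D.phi_Hn hw, h]
  rw [← h3] at h2
  change ‖_ - D.Y n w‖ ≤ _ at h2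
  change ‖_ - D.Y n z‖ ≤ _ at h1
  have : D.Y n w - D.Y n z = (D.phi (D.H^[n] z) - D.Y n z) - (D.phi (D.H^[n] z) - D.Y n w) := by ring
  rw [this]
  have := norm_sub_le (D.phi (D.H^[n] z) - D.Y n z) (D.phi (D.H^[n] z) - D.Y n w)
  linarith

lemma Stab_of_phi {z w : ℂ × ℂ} (hz : z ∈ D.V) (hw : w ∈ D.V) (h : D.phi z = D.phi w) :
    D.Stab z w := by
  obtain ⟨τ, h1, -⟩ := D.tau_close hz (D.close_of_phi hz hw h)
  exact D.Tau_Stab hz h1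

lemma Stab_of_phi_n {z w : ℂ × ℂ} (n : ℕ) (hz : D.H^[n] z ∈ D.V) (hw : D.H^[n] w ∈ D.V)
    (h : D.phi (D.H^[n] z) = D.phi (D.H^[n] w)) : D.Stab z w :=
  (D.Stab_Hn n z w).1 (D.Stab_of_phi hz hw h)

lemma Stab_eventually {z w : ℂ × ℂ} (hz : z ∈ D.V) (h : D.Stab z w) :
    ∃ m, (∀ n, ‖D.Y n (D.H^[m] w) - D.Y n (D.H^[m] z)‖ ≤ 1) ∧ D.H^[m] w ∈ D.V := by
  have h1 : ∀ᶠ n in atTop, ‖D.Y n w - D.Y n z‖ ≤ 1 := by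
    have := (Metric.tendsto_nhds.1 h) 1 one_pos
    filter_upwards [this] with n hn
    rw [dist_zero_right] at hn; exact hn.le
  obtain ⟨m, hm⟩ := eventually_atTop.1 h1
  refine ⟨m+1, ?_, ?_⟩
  · intro n; rw [← Y_add, ← Y_add]; exact hm _ (by omega)
  · have a1 := hm m le_rfl
    have a2 := hm (m+1) (by omega)
    have hRR := D.R_all
    have b1 := (D.Hn_V hz m).1
    have b2 := D.step_lin (D.Hn_V hz m)
    rw [Y_iter_succ] at b2
    change D.R < ‖D.Y m z‖ at b1
    change D.R / 2 * ‖D.Y m z‖ ≤ _ at b2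
    have c1 := norm_sub_norm_le (D.Y m w) (D.Y m z)
    have c2 := norm_sub_norm_le (D.Y (m+1) z) (D.Y (m+1) w)
    rw [norm_sub_rev] at c2
    have c3 : 2 * ‖D.Y m z‖ ≤ D.R / 2 * ‖D.Y m z‖ := by gcongr; linarith
    constructor
    · change D.R < ‖D.Y (m+1) w‖; linarith
    · change ‖D.X (m+1) w‖ < ‖D.Y (m+1) w‖
      rw [X_succ]; linarith

lemma Stab_G {z w : ℂ × ℂ} (hz : z ∈ D.V) (h : D.Stab z w) : D.G w = D.G z := by
  obtain ⟨m, h1, h2⟩ := D.Stab_eventually hz h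
  have hz' := D.Hn_V hz m
  have hd := D.d_two
  suffices hs : D.G (D.H^[m] w) = D.G (D.H^[m] z) by
    rw [G_Hn, G_Hn] at hs
    exact mul_left_cancel₀ (by positivity) hs
  set z' := D.H^[m] z
  set w' := D.H^[m] w
  have key : ∀ n : ℕ, (D.d:ℝ)^n * |D.G w' - D.G z'| ≤ 3 * Real.log 2 := by
    intro n
    have l1 := D.log_Y hz' n
    have l2 := D.log_Y h2 n
    have hn := h1 n
    have b1 := (D.Hn_V hz' n).1
    have b2 := (D.Hn_V h2 n).1
    change D.R < ‖D.Y n z'‖ at b1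
    change D.R < ‖D.Y n w'‖ at b2
    have hRR := D.R_all.1
    have c1 := norm_sub_norm_le (D.Y n w') (D.Y n z')
    have c2 := norm_sub_norm_le (D.Y n z') (D.Y n w')
    rw [norm_sub_rev] at c2
    have d1 : Real.log ‖D.Y n w'‖ ≤ Real.log (2 * ‖D.Y n z'‖) := Real.log_le_log (by linarith) (by linarith)
    have d2 : Real.log ‖D.Y n z'‖ ≤ Real.log (2 * ‖D.Y n w'‖) := Real.log_le_log (by linarith) (by linarith)
    rw [Real.log_mul (by norm_num) (by linarith)] at d1 d2
    have hp : (0:ℝ) < (D.d:ℝ)^n := by positivity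
    rw [← abs_of_pos hp, ← abs_mul]
    rw [abs_le] at l1 l2 ⊢
    constructor <;> nlinarith
  by_contra hne
  have hpos : 0 < |D.G w' - D.G z'| := abs_pos.2 (sub_ne_zero.2 hne)
  obtain ⟨k, hk⟩ := pow_unbounded_of_one_lt (3 * Real.log 2 / |D.G w' - D.G z'|) (by linarith : (1:ℝ) < D.d)
  rw [div_lt_iff₀ hpos] at hk
  linarith [key k]

lemma Tau_exists {z w : ℂ × ℂ} (hz : z ∈ D.V) (h : D.Stab z w) : ∃ t, D.Tau z w t := by
  obtain ⟨m, h1, h2⟩ := D.Stab_eventually hz h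
  obtain ⟨τ, ht, -⟩ := D.tau_close (D.Hn_V hz m) (w := D.H^[m] w)
    (fun n => (h1 n).trans (by have := D.hC1; linarith))
  exact ⟨_, (D.Tau_Hn m z w τ).2 ht⟩

lemma Tau_zero {z w : ℂ × ℂ} (hz : z ∈ D.V) (h : D.Tau z w 0) : w = z := by
  obtain ⟨m, h1, h2⟩ := D.Stab_eventually hz (D.Tau_Stab hz h)
  have hz' := D.Hn_V hz m
  obtain ⟨τ, ht, hb⟩ := D.tau_close hz' (w := D.H^[m] w)
    (fun n => (h1 n).trans (by have := D.hC1; linarith))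
  have h3 : D.Tau (D.H^[m] z) (D.H^[m] w) 0 := by
    rw [← Tau_Hn, mul_zero]; exact h
  have h4 : τ = 0 := tendsto_nhds_unique ht h3
  rw [h4] at hb
  have h5 : D.T 0 (D.H^[m] z) (D.H^[m] w) = 0 := by
    have := hb 0
    rw [zero_sub, norm_neg, pow_zero] at this
    have h0 := norm_nonneg (D.T 0 (D.H^[m] z) (D.H^[m] w))
    exact norm_eq_zero.1 (by linarith)
  have h6 : D.T 1 (D.H^[m] z) (D.H^[m] w) = 0 := by
    have := hb 1
    rw [h5, norm_zero, mul_zero, zero_sub, norm_neg] at this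
    exact norm_le_zero_iff.1 this
  have h7 : (D.H^[m] w) = (D.H^[m] z) := by
    ext
    · simp only [T, pow_zero, one_mul, mul_eq_zero, Y_zero, X_zero] at h5
      exact sub_eq_zero.1 (h5.resolve_left (D.V_ne hz'))
    · simp only [T, mul_eq_zero] at h6
      have : D.X (0+1) (D.H^[m] w) - D.X (0+1) (D.H^[m] z) = 0 :=
        h6.resolve_left (by
          push Not
          exact ⟨pow_ne_zero _ D.lam_ne, D.Y_ne hz' 1⟩)
      rw [X_succ, X_succ] at this
      exact sub_eq_zero.1 this
  have := congrArg (D.Hi^[m]) h7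
  rwa [Hin_Hn, Hin_Hn] at this

lemma Stab_ratio {z w : ℂ × ℂ} (hz : z ∈ D.V) (h : D.Stab z w) :
    Tendsto (fun n => D.Y n w / D.Y n z) atTop (𝓝 1) := by
  have h2 := tendsto_inv₀_cobounded.comp (tendsto_norm_atTop_iff_cobounded.1 (D.Y_tendsto hz))
  have h3 := (Filter.Tendsto.mul h h2).add_const 1
  rw [zero_mul, zero_add] at h3
  refine h3.congr ?_
  intro n
  have := D.Y_ne hz n
  simp only [Function.comp]
  field_simp
  ring

lemma Tau_add {z w v : ℂ × ℂ} {s t} (hz : z ∈ D.V) (h1 : D.Tau z w s) (h2 : D.Tau w v t) :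
    D.Tau z v (s + t) := by
  have hr := D.Stab_ratio hz (D.Tau_Stab hz h1)
  have hr' := hr.inv₀ one_ne_zero
  have h3 := hr'.mul h2
  rw [inv_one, one_mul] at h3
  refine (h1.add h3).congr' ?_
  have : ∀ᶠ n in atTop, D.Y n w / D.Y n z ≠ 0 := hr.eventually_ne one_ne_zero
  filter_upwards [this] with n hn
  have hy := D.Y_ne hz n
  have hw : D.Y n w ≠ 0 := fun h => hn (by rw [h, zero_div])
  simp only [T]
  field_simp
  ring

lemma Tau_symm {z w : ℂ × ℂ} {t} (hz : z ∈ D.V) (h : D.Tau z w t) : D.Tau w z (-t) := by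
  have hr := D.Stab_ratio hz (D.Tau_Stab hz h)
  have h3 := hr.mul h
  rw [one_mul] at h3
  refine h3.neg.congr ?_
  intro n
  have hy := D.Y_ne hz n
  simp only [T]
  field_simp
  ring

lemma Tau_inj {z w v : ℂ × ℂ} {t} (hz : z ∈ D.V) (h1 : D.Tau z w t) (h2 : D.Tau z v t) : v = w := by
  obtain ⟨m, h3, h4⟩ := D.Stab_eventually hz (D.Tau_Stab hz h1)
  have hz' := D.Hn_V hz m
  have e : ∀ u, D.Tau z u t → D.Tau (D.H^[m] z) (D.H^[m] u) ((D.lam ^ m)⁻¹ * t) := by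
    intro u hu
    rw [← Tau_Hn, mul_inv_cancel_left₀ (pow_ne_zero m D.lam_ne)]
    exact hu
  have a1 := D.Tau_symm hz' (e _ h1)
  have a2 := D.Tau_add h4 a1 (e _ h2)
  rw [neg_add_cancel] at a2
  have h7 := D.Tau_zero h4 a2
  have := congrArg (D.Hi^[m]) h7
  rwa [Hin_Hn, Hin_Hn] at this

end HD
end

open Filter Topology Set
noncomputable section
namespace HD
variable (D : HD)

/-- approximations of the leaf parametrization -/
def wA : ℕ → ℂ × ℂ → ℂ → ℂ × ℂ
  | 0, z, t => (z.1 + t / z.2, z.2)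
  | N+1, z, t => D.Hi (wA N (D.H z) (t / D.lam))

lemma wA_H (N z t) : D.H (D.wA (N+1) z t) = D.wA N (D.H z) (t / D.lam) := by
  rw [wA, H_Hi]

lemma wA_snd (N z t) : (D.wA (N+1) z t).2 = (D.wA N (D.H z) (t / D.lam)).1 := by
  rw [← wA_H]; rfl

lemma wA_diff (N z) : Differentiable ℂ (D.wA N z) := by
  induction N generalizing z with
  | zero =>
    have : D.wA 0 z = fun t => (z.1 + t / z.2, z.2) := by funext t; rfl
    rw [this]; fun_prop
  | succ N ih =>
    have : D.wA (N+1) z = D.Hi ∘ (D.wA N (D.H z)) ∘ (fun t => t / D.lam) := by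
      funext t; rfl
    rw [this]
    exact D.Hi_diff.comp ((ih _).comp (by fun_prop))

/-- constant -/
def K3 : ℝ := 10 * (D.C1 + D.C2)

lemma geom_facts {z} (hz : z ∈ D.V) :
    0 < ‖z.2‖ ∧ 0 < ‖(D.H z).2‖ ∧ 0 < ‖(D.H (D.H z)).2‖ ∧
    500 * ‖z.2‖ ≤ ‖(D.H z).2‖ ∧ 500 * (‖D.a‖ * ‖z.2‖) ≤ ‖(D.H z).2‖ ∧
    250 * (‖D.a‖ * ‖z.2‖ ^ 2) ≤ ‖(D.H (D.H z)).2‖ ∧ D.K3 ≤ 1/50 * ‖z.2‖ ∧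
    D.K3 ≤ 1/50 * ‖(D.H z).2‖ ∧ 20 ≤ D.K3 := by
  have hRR := D.R_all
  have h1 := D.step_lin hz
  have h2 := D.step_lin (D.H_V hz)
  have h3 := D.step_sq hz
  have e1 := hz.1
  have e2 := (D.H_V hz).1
  have ap := D.a_pos
  have c1 := D.hC1
  have c2 := D.hC2
  refine ⟨by linarith, by linarith, by linarith [(D.H_V (D.H_V hz)).1], ?_, ?_, ?_, ?_, ?_, ?_⟩
  · nlinarith [norm_nonneg z.2]
  · nlinarith [norm_nonneg z.2]
  · have : 500 * (‖D.a‖) * (‖z.2‖^2/2) ≤ D.R/2 * ‖(D.H z).2‖ := by gcongr <;> linarith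
    linarith
  · unfold K3; linarith
  · unfold K3; linarith
  · unfold K3; linarith

lemma t_fact {z t} (hz : z ∈ D.V) (ht : ‖t‖ ≤ ‖z.2‖) : ‖t / D.lam‖ ≤ ‖(D.H z).2‖ ∧
    ‖t/D.lam‖ ≤ ‖D.a‖ * ‖t‖ / 2 ∧ ‖D.lam‖ * ‖t / D.lam‖ = ‖t‖ := by
  have g := D.geom_facts hz
  have ap := D.a_pos
  have hd := D.d_two
  have h1 : ‖t/D.lam‖ ≤ ‖D.a‖ * ‖t‖ / 2 := by
    rw [norm_div, lam_norm, div_div_eq_mul_div, mul_comm]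
    gcongr
  refine ⟨?_, h1, ?_⟩
  · nlinarith
  · rw [← norm_mul, mul_div_cancel₀ _ D.lam_ne]

lemma wA_bound (N : ℕ) : ∀ {z t}, z ∈ D.V → ‖t‖ ≤ ‖z.2‖ →
    ‖z.2 * ((D.wA N z t).1 - z.1) - t‖ ≤ D.K3 / ‖z.2‖ * ‖t‖ ∧
    ‖(D.wA N z t).2 - z.2‖ ≤ ‖D.a‖ * ‖t‖ / ‖(D.H z).2‖ := by
  induction N with
  | zero =>
    intro z t hz ht
    have g := D.geom_facts hz
    have ap := D.a_pos
    have := D.V_ne hz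
    have e : z.2 * ((D.wA 0 z t).1 - z.1) - t = 0 := by simp only [wA]; field_simp; ring
    rw [e]
    simp only [wA, norm_zero, sub_self]
    have : 0 ≤ D.K3 := by linarith
    constructor <;> positivity
  | succ N ih =>
    intro z t hz ht
    have g := D.geom_facts hz
    obtain ⟨p0, p1, p2, g1, g2, g3, g4, g5, g6⟩ := g
    have ap := D.a_pos
    have hd := D.d_two
    obtain ⟨f1, f2, f3⟩ := D.t_fact hz ht
    obtain ⟨i1, i2⟩ := ih (D.H_V hz) f1
    have hs := D.wA_snd N z t
    have hH := D.wA_H N z t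
    set w := D.wA (N+1) z t
    set u := D.wA N (D.H z) (t / D.lam)
    set t' := t / D.lam with ht'
    set y1 := (D.H z).2
    have k1 : D.K3 / ‖y1‖ ≤ 1/50 := by rw [div_le_iff₀ p1]; exact g5
    have x1 : ‖y1 * (u.1 - (D.H z).1)‖ ≤ 3/2 * ‖t'‖ := by
      have := norm_sub_norm_le (y1 * (u.1 - (D.H z).1)) t'
      have := mul_le_mul_of_nonneg_right k1 (norm_nonneg t')
      linarith [norm_nonneg t']
    rw [D.H_fst] at x1 i1
    have eta : ‖w.2 - z.2‖ ≤ ‖D.a‖ * ‖t‖ / ‖y1‖ := by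
      rw [le_div_iff₀ p1, hs, mul_comm, ← norm_mul]
      refine x1.trans ?_
      nlinarith [norm_nonneg t]
    refine ⟨?_, eta⟩
    have c1 := D.hC1
    have eta1 : ‖D.a‖ * ‖t‖ / ‖y1‖ ≤ 1 := by
      rw [div_le_iff₀ p1]
      nlinarith
    have rr := D.rec_raw (w := w) (w' := z) hz (by linarith) (by simp; linarith)
    rw [hH, hs] at rr
    have n1 : ‖D.lam * y1 * (u.1 - z.2)‖ ≤ 3/2 * ‖t‖ := by
      rw [mul_assoc, norm_mul]
      calc _ ≤ ‖D.lam‖ * (3/2 * ‖t'‖) := by gcongr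
        _ = 3/2 * (‖D.lam‖ * ‖t'‖) := by ring
        _ = _ := by rw [f3]
    have n2 : ‖D.lam * y1 * (u.1 - z.2) - t‖ ≤ D.K3 / ‖y1‖ * ‖t‖ := by
      have : D.lam * y1 * (u.1 - z.2) - t = D.lam * (y1 * (u.1 - z.2) - t') := by
        rw [ht']; field_simp [D.lam_ne]
      rw [this, norm_mul]
      calc _ ≤ ‖D.lam‖ * (D.K3 / ‖y1‖ * ‖t'‖) := by gcongr
        _ = D.K3 / ‖y1‖ * (‖D.lam‖ * ‖t'‖) := by ring
        _ = _ := by rw [f3]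
    have n3 : ‖z.2‖ / ‖D.a‖ * ‖u.2 - (D.H z).2‖ ≤ 1 / ‖z.2‖ * ‖t‖ := by
      calc _ ≤ ‖z.2‖ / ‖D.a‖ * (‖D.a‖ * ‖t'‖ / ‖(D.H (D.H z)).2‖) := by gcongr
        _ = ‖z.2‖ * ‖t'‖ / ‖(D.H (D.H z)).2‖ := by field_simp
        _ ≤ ‖z.2‖ * (‖D.a‖ * ‖t‖ / 2) / (250 * (‖D.a‖ * ‖z.2‖ ^ 2)) := by gcongr
        _ = 1/500 * (1/‖z.2‖ * ‖t‖) := by field_simp; ring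
        _ ≤ _ := by
          have : 0 ≤ 1/‖z.2‖ * ‖t‖ := by positivity
          linarith
    have n4 : D.K3 / ‖y1‖ * ‖t‖ ≤ D.K3 / (500 * ‖z.2‖) * ‖t‖ := by
      have : 0 ≤ D.K3 := by linarith
      gcongr
    have tri := norm_add_le (z.2 * (w.1 - z.1) - D.lam * y1 * (u.1 - z.2)) (D.lam * y1 * (u.1 - z.2) - t)
    rw [sub_add_sub_cancel] at tri
    have n5 : 2 * (D.C1 + D.C2) / ‖z.2‖ * ‖D.lam * y1 * (u.1 - z.2)‖ ≤ 2 * (D.C1 + D.C2) / ‖z.2‖ * (3/2 * ‖t‖) := by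
      have c2 := D.hC2
      gcongr
    have fin : 2 * (D.C1 + D.C2) / ‖z.2‖ * (3/2 * ‖t‖) + 1 / ‖z.2‖ * ‖t‖ + D.K3 / (500 * ‖z.2‖) * ‖t‖
        ≤ D.K3 / ‖z.2‖ * ‖t‖ := by
      have : 2 * (D.C1 + D.C2) / ‖z.2‖ * (3/2 * ‖t‖) + 1 / ‖z.2‖ * ‖t‖ + D.K3 / (500 * ‖z.2‖) * ‖t‖
        = (3 * (D.C1 + D.C2) + 1 + D.K3/500) / ‖z.2‖ * ‖t‖ := by field_simp
      rw [this]
      have c2 := D.hC2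
      gcongr
      unfold K3; linarith
    linarith

lemma wA_delta (N : ℕ) : ∀ {z t}, z ∈ D.V → ‖t‖ ≤ ‖z.2‖ →
    ‖z.2 * ((D.wA (N+1) z t).1 - (D.wA N z t).1)‖ ≤ D.K3 * (1/2)^N * (‖t‖ / ‖z.2‖) ∧
    ‖(D.wA (N+1) z t).2 - (D.wA N z t).2‖ ≤ D.K3 * (1/2)^N * (‖D.a‖ * ‖t‖ / ‖(D.H z).2‖) := by
  induction N with
  | zero =>
    intro z t hz ht
    have hb := D.wA_bound 1 hz ht
    have g := D.geom_facts hz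
    have := D.V_ne hz
    have ap := D.a_pos
    have e : z.2 * ((D.wA 1 z t).1 - (D.wA 0 z t).1) = z.2 * ((D.wA 1 z t).1 - z.1) - t := by
      have : (D.wA 0 z t).1 = z.1 + t / z.2 := rfl
      rw [this]; field_simp; ring
    have e2 : (D.wA 0 z t).2 = z.2 := rfl
    rw [zero_add, e, e2, pow_zero, mul_one]
    refine ⟨hb.1.trans (le_of_eq (by ring)), hb.2.trans ?_⟩
    have : 0 ≤ ‖D.a‖ * ‖t‖ / ‖(D.H z).2‖ := by positivity
    nlinarith
  | succ N ih =>
    intro z t hz ht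
    have g := D.geom_facts hz
    obtain ⟨p0, p1, p2, g1, g2, g3, g4, g5, g6⟩ := g
    have ap := D.a_pos
    have hd := D.d_two
    obtain ⟨f1, f2, f3⟩ := D.t_fact hz ht
    obtain ⟨i1, i2⟩ := ih (D.H_V hz) f1
    have hb1 := (D.wA_bound (N+2) hz ht).2
    have hb2 := (D.wA_bound (N+1) hz ht).2
    have hs := D.wA_snd (N+1) z t
    have hH := D.wA_H (N+1) z t
    have hs' := D.wA_snd N z t
    have hH' := D.wA_H N z t
    change ‖(D.wA (N+1+1) z t).2 - z.2‖ ≤ _ at hb1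
    set w := D.wA (N+1+1) z t
    set w' := D.wA (N+1) z t
    set u := D.wA (N+1) (D.H z) (t / D.lam)
    set u' := D.wA N (D.H z) (t / D.lam)
    set t' := t / D.lam with ht'
    set y1 := (D.H z).2
    have c1 := D.hC1
    have c2 := D.hC2
    have kp : 0 ≤ D.K3 := by linarith
    have R1 : (1000:ℝ) ≤ D.R := D.R_all.1
    have y1b : 1 ≤ ‖y1‖ := by linarith [(D.H_V hz).1]
    constructor
    swap
    · rw [hs, hs']
      have : ‖u.1 - u'.1‖ * ‖y1‖ ≤ D.K3 * (1/2)^(N+1) * (‖D.a‖ * ‖t‖) := by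
        rw [mul_comm, ← norm_mul]
        refine i1.trans ?_
        calc D.K3 * (1/2)^N * (‖t'‖ / ‖y1‖) ≤ D.K3 * (1/2)^N * ((‖D.a‖ * ‖t‖ / 2) / 1) := by gcongr
          _ = _ := by rw [pow_succ]; ring
      rw [mul_div_assoc', le_div_iff₀ p1]
      exact this
    · have eta1 : ‖D.a‖ * ‖t‖ / ‖y1‖ ≤ 1 := by
        rw [div_le_iff₀ p1]
        nlinarith
      have rr := D.rec_raw (w := w) (w' := w') hz (by linarith) (by linarith)
      rw [hH, hs, hH', hs'] at rr
      have n1 : ‖D.lam * y1 * (u.1 - u'.1)‖ ≤ D.K3 * (1/2)^N * (‖t‖ / ‖y1‖) := by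
        rw [mul_assoc, norm_mul]
        calc _ ≤ ‖D.lam‖ * (D.K3 * (1/2)^N * (‖t'‖ / ‖y1‖)) := by gcongr
          _ = D.K3 * (1/2)^N * ((‖D.lam‖ * ‖t'‖) / ‖y1‖) := by ring
          _ = _ := by rw [f3]
      have n3 : ‖z.2‖ / ‖D.a‖ * ‖u.2 - u'.2‖ ≤ 1/500 * (D.K3 * (1/2)^N * (‖t‖ / ‖z.2‖)) := by
        calc _ ≤ ‖z.2‖ / ‖D.a‖ * (D.K3 * (1/2)^N * (‖D.a‖ * ‖t'‖ / ‖(D.H (D.H z)).2‖)) := by gcongr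
          _ = D.K3 * (1/2)^N * (‖z.2‖ * ‖t'‖ / ‖(D.H (D.H z)).2‖) := by field_simp
          _ ≤ D.K3 * (1/2)^N * (‖z.2‖ * (‖D.a‖ * ‖t‖ / 2) / (250 * (‖D.a‖ * ‖z.2‖ ^ 2))) := by gcongr
          _ = 1/500 * (D.K3 * (1/2)^N * (‖t‖ / ‖z.2‖)) := by field_simp; ring
      have n4 : D.K3 * (1/2)^N * (‖t‖ / ‖y1‖) ≤ D.K3 * (1/2)^N * (‖t‖ / (500 * ‖z.2‖)) := by
        gcongr
      have e4 : D.K3 * (1/2)^N * (‖t‖ / (500 * ‖z.2‖)) = 1/500 * (D.K3 * (1/2)^N * (‖t‖ / ‖z.2‖)) := by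
        field_simp
      have tri := norm_add_le (z.2 * (w.1 - w'.1) - D.lam * y1 * (u.1 - u'.1)) (D.lam * y1 * (u.1 - u'.1))
      rw [sub_add_cancel] at tri
      have n5 : 2 * (D.C1 + D.C2) / ‖z.2‖ * ‖D.lam * y1 * (u.1 - u'.1)‖ ≤ 1 * ‖D.lam * y1 * (u.1 - u'.1)‖ := by
        gcongr
        rw [div_le_one p0]
        unfold K3 at g4; linarith
      have e5 : D.K3 * (1/2)^(N+1) * (‖t‖ / ‖z.2‖) = 1/2 * (D.K3 * (1/2)^N * (‖t‖ / ‖z.2‖)) := by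
        rw [pow_succ]; ring
      have : 0 ≤ D.K3 * (1/2)^N * (‖t‖ / ‖z.2‖) := by positivity
      rw [e5]
      linarith

lemma wA_dist (N : ℕ) {z t} (hz : z ∈ D.V) (ht : ‖t‖ ≤ ‖z.2‖) :
    dist (D.wA N z t) (D.wA (N+1) z t) ≤ D.K3 * (1/2)^N := by
  have g := D.geom_facts hz
  obtain ⟨p0, p1, p2, g1, g2, g3, g4, g5, g6⟩ := g
  obtain ⟨h1, h2⟩ := D.wA_delta N hz ht
  have R1 : (1000:ℝ) ≤ D.R := D.R_all.1
  have hz1 := hz.1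
  have kp : 0 ≤ D.K3 := by linarith
  have ap := D.a_pos
  rw [dist_comm, dist_eq_norm, Prod.norm_def]
  apply max_le
  · rw [Prod.fst_sub]
    rw [norm_mul] at h1
    have h3 : D.K3 * (1/2)^N * (‖t‖ / ‖z.2‖) ≤ D.K3 * (1/2)^N * 1 := by
      gcongr; rw [div_le_one p0]; exact ht
    have := norm_nonneg ((D.wA (N + 1) z t).1 - (D.wA N z t).1)
    nlinarith
  · rw [Prod.snd_sub]
    refine h2.trans ?_
    have : ‖D.a‖ * ‖t‖ / ‖(D.H z).2‖ ≤ 1 := by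
      rw [div_le_iff₀ p1]
      nlinarith
    calc _ ≤ D.K3 * (1/2)^N * 1 := by gcongr
      _ = _ := by ring

/-- local leaf -/
def Lloc (z : ℂ × ℂ) (t : ℂ) : ℂ × ℂ := limUnder atTop (fun N => D.wA N z t)

lemma Lloc_tendsto {z t} (hz : z ∈ D.V) (ht : ‖t‖ ≤ ‖z.2‖) :
    Tendsto (fun N => D.wA N z t) atTop (𝓝 (D.Lloc z t)) :=
  (cauchySeq_of_le_geometric (1/2) D.K3 (by norm_num) (fun n => D.wA_dist n hz ht)).tendsto_limUnder

lemma Lloc_diff {z} (hz : z ∈ D.V) : DifferentiableOn ℂ (D.Lloc z) (Metric.ball 0 ‖z.2‖) := by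
  have hu : TendstoUniformlyOn (fun N => D.wA N z) (D.Lloc z) atTop (Metric.ball 0 ‖z.2‖) := by
    rw [Metric.tendstoUniformlyOn_iff]
    intro ε hε
    have : Tendsto (fun N : ℕ => D.K3 * (1/2:ℝ)^N / (1 - 1/2)) atTop (𝓝 (D.K3 * 0 / (1-1/2))) :=
      ((tendsto_pow_atTop_nhds_zero_of_lt_one (by norm_num) (by norm_num)).const_mul _).div_const _
    rw [mul_zero, zero_div] at this
    filter_upwards [this.eventually_lt_const hε] with N hN t ht
    have ht' : ‖t‖ ≤ ‖z.2‖ := by simpa using (Metric.mem_ball.1 ht).le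
    rw [dist_comm]
    exact (dist_le_of_le_geometric_of_tendsto (1/2) D.K3 (by norm_num) (fun n => D.wA_dist n hz ht')
      (D.Lloc_tendsto hz ht') N).trans_lt hN
  exact hu.tendstoLocallyUniformlyOn.differentiableOn
    (Eventually.of_forall fun N => (D.wA_diff N z).differentiableOn) Metric.isOpen_ball

lemma Lloc_H {z t} (hz : z ∈ D.V) (ht : ‖t‖ ≤ ‖z.2‖) : D.H (D.Lloc z t) = D.Lloc (D.H z) (t / D.lam) := by
  have h1 := (D.H_diff.continuous.tendsto _).comp ((tendsto_add_atTop_iff_nat 1).2 (D.Lloc_tendsto hz ht))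
  have h2 := D.Lloc_tendsto (D.H_V hz) (D.t_fact hz ht).1
  refine tendsto_nhds_unique h1 (h2.congr fun N => ?_)
  simp [wA_H]

lemma Lloc_Hn {z t} (hz : z ∈ D.V) (ht : ‖t‖ ≤ ‖z.2‖) (n : ℕ) :
    D.H^[n] (D.Lloc z t) = D.Lloc (D.H^[n] z) (t / D.lam ^ n) ∧ ‖t / D.lam ^ n‖ ≤ ‖D.Y n z‖ := by
  induction n with
  | zero => simpa [Y] using ht
  | succ n ih =>
    have hn := D.Hn_V hz n
    have e : t / D.lam ^ (n+1) = t / D.lam ^ n / D.lam := by rw [pow_succ, div_div]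
    constructor
    · rw [Function.iterate_succ_apply', ih.1, D.Lloc_H hn ih.2, e, Function.iterate_succ_apply']
    · rw [e, ← Y_iter_succ]; exact (D.t_fact hn ih.2).1

lemma Lloc_Tau {z t} (hz : z ∈ D.V) (ht : ‖t‖ ≤ ‖z.2‖) : D.Tau z (D.Lloc z t) t := by
  have hb : ∀ {z t}, z ∈ D.V → ‖t‖ ≤ ‖z.2‖ → ‖z.2 * ((D.Lloc z t).1 - z.1) - t‖ ≤ D.K3 / ‖z.2‖ * ‖t‖ := by
    intro z t hz ht
    have h1 := D.Lloc_tendsto hz ht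
    have h2 : Tendsto (fun N => ‖z.2 * ((D.wA N z t).1 - z.1) - t‖) atTop
        (𝓝 ‖z.2 * ((D.Lloc z t).1 - z.1) - t‖) :=
      (((((continuous_fst.tendsto _).comp h1).sub_const _).const_mul _).sub_const _).norm
    exact le_of_tendsto' h2 fun N => (D.wA_bound N hz ht).1
  unfold Tau
  rw [tendsto_iff_norm_sub_tendsto_zero]
  have hK : Tendsto (fun n => D.K3 / ‖D.Y n z‖ * ‖t‖) atTop (𝓝 0) := by
    simpa using ((D.Y_tendsto hz).const_div_atTop D.K3).mul_const ‖t‖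
  refine squeeze_zero (fun _ => norm_nonneg _) (fun n => ?_) hK
  obtain ⟨l1, l2⟩ := D.Lloc_Hn hz ht n
  have h := hb (D.Hn_V hz n) l2
  have hl := pow_ne_zero n D.lam_ne
  have e : D.T n z (D.Lloc z t) - t = D.lam ^ n *
      ((D.H^[n] z).2 * ((D.Lloc (D.H^[n] z) (t / D.lam ^ n)).1 - (D.H^[n] z).1) - t / D.lam ^ n) := by
    rw [← l1, mul_sub, mul_div_cancel₀ _ hl, T, X, X, Y, mul_assoc]
  rw [e, norm_mul]
  calc _ ≤ ‖D.lam ^ n‖ * (D.K3 / ‖(D.H^[n] z).2‖ * ‖t / D.lam ^ n‖) := by gcongr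
    _ = _ := by rw [norm_div, Y]; field_simp [norm_ne_zero_iff.2 hl]

/-- The global leaf through a point of `V`. -/
lemma leaf {z} (hz : z ∈ D.V) : ∃ L : ℂ → ℂ × ℂ, Differentiable ℂ L ∧ ∀ t, D.Tau z (L t) t := by
  have ex : ∀ r : ℝ, ∃ K : ℕ, r < ‖D.lam ^ K * D.Y K z‖ := fun r =>
    ((D.lamY_tendsto hz).eventually_gt_atTop r).exists
  have key : ∀ (K : ℕ) (t : ℂ), ‖t‖ ≤ ‖D.lam ^ K * D.Y K z‖ →
      D.Tau z (D.Hi^[K] (D.Lloc (D.H^[K] z) (t / D.lam ^ K))) t := by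
    intro K t ht
    have hl := pow_ne_zero K D.lam_ne
    have : t = D.lam ^ K * (t / D.lam ^ K) := by field_simp
    conv => rhs; rw [this]
    rw [Tau_Hn, Hn_Hin]
    apply D.Lloc_Tau (D.Hn_V hz K)
    rw [norm_div, div_le_iff₀ (norm_pos_iff.2 hl)]
    rw [norm_mul, mul_comm] at ht
    exact ht
  choose K hK using ex
  refine ⟨fun t => D.Hi^[K ‖t‖] (D.Lloc (D.H^[K ‖t‖] z) (t / D.lam ^ (K ‖t‖))), ?_, fun t => key _ _ (hK _).le⟩
  intro t0
  have hl := pow_ne_zero (K ‖t0‖) D.lam_ne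
  have hmem : t0 / D.lam ^ (K ‖t0‖) ∈ Metric.ball (0:ℂ) ‖(D.H^[K ‖t0‖] z).2‖ := by
    rw [mem_ball_zero_iff, norm_div, div_lt_iff₀ (norm_pos_iff.2 hl), mul_comm]
    have := hK ‖t0‖
    rwa [norm_mul] at this
  have hd : DifferentiableAt ℂ (fun t => D.Hi^[K ‖t0‖] (D.Lloc (D.H^[K ‖t0‖] z) (t / D.lam ^ (K ‖t0‖)))) t0 := by
    have h1 := ((D.Lloc_diff (D.Hn_V hz (K ‖t0‖))).differentiableAt (Metric.isOpen_ball.mem_nhds hmem))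
    have h2 : DifferentiableAt ℂ (fun t : ℂ => t / D.lam ^ (K ‖t0‖)) t0 := by fun_prop
    have h3 : DifferentiableAt ℂ (fun t => D.Lloc (D.H^[K ‖t0‖] z) (t / D.lam ^ (K ‖t0‖))) t0 :=
      DifferentiableAt.comp (g := D.Lloc (D.H^[K ‖t0‖] z)) t0 h1 h2
    exact DifferentiableAt.comp (g := D.Hi^[K ‖t0‖]) t0 ((D.Hin_diff (K ‖t0‖)) _) h3
  refine hd.congr_of_eventuallyEq ?_
  have : ∀ᶠ t in 𝓝 t0, ‖t‖ < ‖D.lam ^ (K ‖t0‖) * D.Y (K ‖t0‖) z‖ :=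
    continuous_norm.continuousAt.eventually_lt_const (hK ‖t0‖)
  filter_upwards [this] with t ht
  exact D.Tau_inj hz (key _ _ ht.le) (key _ _ (hK _).le)

end HD
end

open Filter Topology Set
noncomputable section

/-- `u` is near `t0` the real part of a holomorphic function. -/
def LocRe (u : ℂ → ℝ) (t0 : ℂ) : Prop :=
  ∃ g : ℂ → ℂ, (∀ᶠ t in 𝓝 t0, DifferentiableAt ℂ g t) ∧ ∀ᶠ t in 𝓝 t0, u t = (g t).re

lemma LocRe.congr {u v : ℂ → ℝ} {t0} (h : LocRe u t0) (e : ∀ᶠ t in 𝓝 t0, v t = u t) : LocRe v t0 := by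
  obtain ⟨g, h1, h2⟩ := h
  refine ⟨g, h1, ?_⟩
  filter_upwards [h2, e] with t a b
  rw [b, a]

lemma LocRe.lin {u v : ℂ → ℝ} {t0} (h : LocRe u t0) (h' : LocRe v t0) (c : ℝ) :
    LocRe (fun t => u t + c * v t) t0 := by
  obtain ⟨g, h1, h2⟩ := h
  obtain ⟨g', h1', h2'⟩ := h'
  refine ⟨fun t => g t + c * g' t, ?_, ?_⟩
  · filter_upwards [h1, h1'] with t a b
    exact a.add (b.const_mul _)
  · filter_upwards [h2, h2'] with t a b
    simp [a, b]

lemma LocRe.smul {u : ℂ → ℝ} {t0} (h : LocRe u t0) (c : ℝ) :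
    LocRe (fun t => c * u t) t0 := by
  obtain ⟨g, h1, h2⟩ := h
  refine ⟨fun t => c * g t, ?_, ?_⟩
  · filter_upwards [h1] with t a
    exact (a.const_mul _)
  · filter_upwards [h2] with t a
    simp [a]

lemma LocRe_log {F : ℂ → ℂ} {t0} (h : ∀ᶠ t in 𝓝 t0, DifferentiableAt ℂ F t) (h0 : F t0 ≠ 0) :
    LocRe (fun t => Real.log ‖F t‖) t0 := by
  have hc : ContinuousAt (fun t => F t / F t0) t0 := h.self_of_nhds.continuousAt.div_const _
  have hs : ∀ᶠ t in 𝓝 t0, F t / F t0 ∈ Complex.slitPlane := by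
    apply hc.eventually_mem
    apply Complex.isOpen_slitPlane.mem_nhds
    simp [h0]
  refine ⟨fun t => Complex.log (F t / F t0) + Real.log ‖F t0‖, ?_, ?_⟩
  · filter_upwards [h, hs] with t a b
    exact ((a.div_const _).clog b).add_const _
  · filter_upwards [hs] with t b
    have hb := Complex.slitPlane_ne_zero b
    have : F t ≠ 0 := by rintro h; simp [h] at hb
    rw [Complex.add_re, Complex.log_re, Complex.ofReal_re, norm_div, Real.log_div (norm_ne_zero_iff.2 this) (norm_ne_zero_iff.2 h0)]
    ring

lemma LocRe.max {u : ℂ → ℝ} {t0} (h : LocRe u t0) (hm : IsLocalMax u t0) : ∀ᶠ t in 𝓝 t0, u t = u t0 := by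
  obtain ⟨g, h1, h2⟩ := h
  have hd : ∀ᶠ t in 𝓝 t0, DifferentiableAt ℂ (fun t => Complex.exp (g t)) t := h1.mono fun t ht => ht.cexp
  have h3 : IsLocalMax (norm ∘ fun t => Complex.exp (g t)) t0 := by
    filter_upwards [hm, h2] with t a b
    simp only [Function.comp, Complex.norm_exp]
    rw [b, h2.self_of_nhds] at a
    exact Real.exp_le_exp.2 a
  have := Complex.norm_eventually_eq_of_isLocalMax hd h3
  filter_upwards [this, h2] with t a b
  simp only [Complex.norm_exp] at a
  rw [b, h2.self_of_nhds, Real.exp_injective a]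

lemma max_principle {U : Set ℂ} (hU : IsOpen U) (hb : Bornology.IsBounded U) {v : ℂ → ℝ} {M : ℝ}
    (hc : ContinuousOn v (closure U)) (hf : ∀ t ∈ frontier U, v t ≤ M)
    (hr : ∀ t ∈ U, M < v t → LocRe v t) : ∀ t ∈ U, v t ≤ M := by
  by_contra! hcon
  obtain ⟨t1, ht1, hM⟩ := hcon
  have hK : IsCompact (closure U) := hb.isCompact_closure
  obtain ⟨t2, ht2, hmax⟩ := hK.exists_isMaxOn ⟨t1, subset_closure ht1⟩ hc
  have hA : IsCompact (closure U ∩ v ⁻¹' {v t2}) :=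
    hK.of_isClosed_subset (hc.preimage_isClosed_of_isClosed isClosed_closure isClosed_singleton) inter_subset_left
  obtain ⟨t0, ⟨h0, h0'⟩, hre⟩ := hA.exists_isMaxOn ⟨t2, ht2, rfl⟩ Complex.continuous_re.continuousOn
  have h0' : v t0 = v t2 := h0'
  have hge : ∀ t ∈ closure U, v t ≤ v t0 := fun t ht => by rw [h0']; exact hmax ht
  have hM0 : M < v t0 := hM.trans_le (hge _ (subset_closure ht1))
  have hU0 : t0 ∈ U := by
    by_contra hn
    have : t0 ∈ frontier U := by
      rw [hU.frontier_eq]; exact ⟨h0, hn⟩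
    linarith [hf _ this]
  have hUn : ∀ᶠ t in 𝓝 t0, t ∈ U := hU.mem_nhds hU0
  have hl : IsLocalMax v t0 := by
    filter_upwards [hUn] with t ht
    exact hge t (subset_closure ht)
  have he := ((hr t0 hU0 hM0).max hl).and hUn
  obtain ⟨ε, hε, hball⟩ := Metric.eventually_nhds_iff.1 he
  obtain ⟨e1, e2⟩ := @hball (t0 + (ε/2 : ℝ)) (by simp [abs_of_pos hε]; linarith)
  have hm : t0 + (ε/2 : ℝ) ∈ closure U ∩ v ⁻¹' {v t2} :=
    ⟨subset_closure e2, by simp only [mem_preimage, mem_singleton_iff]; rw [e1, h0']⟩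
  have : (t0 + (ε/2 : ℝ)).re ≤ t0.re := hre hm
  rw [Complex.add_re, Complex.ofReal_re] at this
  linarith

namespace HD
variable (D : HD)

/-- near a point with positive `G`, things are in `V` after iteration -/
lemma near_V {q : ℂ → ℂ × ℂ} {t0} (hq : ContinuousAt q t0) (k : ℕ) (hk : D.H^[k] (q t0) ∈ D.V) :
    ∀ᶠ t in 𝓝 t0, D.H^[k] (q t) ∈ D.V :=
  ((D.Hn_diff k).continuous.continuousAt.comp hq).eventually_mem (D.V_open.mem_nhds hk)

lemma Phi_diff {q : ℂ → ℂ × ℂ} {t0} (hq : ∀ᶠ t in 𝓝 t0, DifferentiableAt ℂ q t) (k : ℕ)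
    (hk : D.H^[k] (q t0) ∈ D.V) :
    ∀ᶠ t in 𝓝 t0, DifferentiableAt ℂ (fun t => D.phi (D.H^[k] (q t))) t := by
  have h1 := D.near_V hq.self_of_nhds.continuousAt k hk
  obtain ⟨U, hU, hUo, hU0⟩ := eventually_nhds_iff.1 (h1.and hq)
  have hd : DifferentiableOn ℂ (fun t => D.phi (D.H^[k] (q t))) U := by
    refine D.phi_diff hUo (q := fun t => D.H^[k] (q t)) ?_ (fun t ht => (hU t ht).1)
    intro t ht
    exact (((D.Hn_diff k) _).comp t (hU t ht).2).differentiableWithinAt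
  filter_upwards [hUo.mem_nhds hU0] with t ht
  exact hd.differentiableAt (hUo.mem_nhds ht)

lemma G_Phi {z : ℂ × ℂ} (k : ℕ) (hk : D.H^[k] z ∈ D.V) : D.G z = ((D.d:ℝ)^k)⁻¹ * Real.log ‖D.phi (D.H^[k] z)‖ := by
  rw [← D.G_phi hk, G_Hn]
  have := D.d_pos
  field_simp

lemma G_LocRe {q : ℂ → ℂ × ℂ} {t0} (hq : ∀ᶠ t in 𝓝 t0, DifferentiableAt ℂ q t) (h : 0 < D.G (q t0)) :
    LocRe (fun t => D.G (q t)) t0 := by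
  obtain ⟨k, hk⟩ := D.escape h
  have h1 := D.near_V hq.self_of_nhds.continuousAt k hk
  refine ((LocRe_log (D.Phi_diff hq k hk) (D.phi_ne hk)).smul ((D.d:ℝ)^k)⁻¹).congr ?_
  filter_upwards [h1] with t ht
  exact D.G_Phi k ht

lemma liouville {q : ℂ → ℂ × ℂ} (hq : Differentiable ℂ q) {B : ℝ} (hB : ∀ t, D.G (q t) ≤ B) (t : ℂ) :
    D.G (q t) = D.G (q 0) := by
  have hcont : Continuous (fun t => D.G (q t)) := D.hGcont.comp hq.continuous
  obtain ⟨t1, ht1, hmax⟩ := (isCompact_closedBall (0:ℂ) 1).exists_isMaxOn ⟨0, by simp⟩ hcont.continuousOn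
  set M := D.G (q t1) with hM
  have hM0 : 0 ≤ M := D.hGnonneg _
  have hle : ∀ t, D.G (q t) ≤ M := by
    intro t
    by_cases ht : ‖t‖ ≤ 1
    · exact hmax (by simpa using ht)
    push Not at ht
    have hlog : 0 < Real.log ‖t‖ := Real.log_pos ht
    apply le_of_forall_pos_le_add
    intro ε' hε'
    set ε := ε' / Real.log ‖t‖ with hεd
    have hε : 0 < ε := by positivity
    obtain ⟨ρ, hρ1, hρ2⟩ : ∃ ρ : ℝ, ‖t‖ < ρ ∧ B - M ≤ ε * Real.log ρ := by
      have : Tendsto (fun ρ : ℝ => ε * Real.log ρ) atTop atTop := Real.tendsto_log_atTop.const_mul_atTop hε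
      exact ((eventually_gt_atTop ‖t‖).and (this.eventually_ge_atTop (B - M))).exists
    have hUo : IsOpen {s : ℂ | 1 < ‖s‖ ∧ ‖s‖ < ρ} :=
      (isOpen_lt continuous_const continuous_norm).inter (isOpen_lt continuous_norm continuous_const)
    have hcl : closure {s : ℂ | 1 < ‖s‖ ∧ ‖s‖ < ρ} ⊆ {s : ℂ | 1 ≤ ‖s‖ ∧ ‖s‖ ≤ ρ} := by
      apply closure_minimal
      · intro s hs; exact ⟨hs.1.le, hs.2.le⟩
      · exact (isClosed_le continuous_const continuous_norm).inter (isClosed_le continuous_norm continuous_const)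
    have hlogc : ∀ s ∈ closure {s : ℂ | 1 < ‖s‖ ∧ ‖s‖ < ρ}, s ≠ 0 := by
      intro s hs h
      have := (hcl hs).1
      simp [h] at this
      linarith
    have := max_principle (U := {s : ℂ | 1 < ‖s‖ ∧ ‖s‖ < ρ}) (v := fun s => D.G (q s) + (-ε) * Real.log ‖s‖) (M := M)
      hUo ((Metric.isBounded_ball (x := (0:ℂ)) (r := ρ)).subset fun s hs => by simpa using hs.2) ?_ ?_ ?_ t ⟨ht, hρ1⟩
    · have e : ε * Real.log ‖t‖ = ε' := by rw [hεd]; field_simp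
      linarith
    · apply hcont.continuousOn.add
      apply ContinuousOn.const_mul
      apply ContinuousOn.log continuous_norm.continuousOn
      intro s hs; exact norm_ne_zero_iff.2 (hlogc s hs)
    · intro s hs
      rw [hUo.frontier_eq] at hs
      have h1 := hcl hs.1
      have h2 := hs.2
      simp only [mem_ofPred_eq, not_and, not_lt] at h2 h1
      rcases h1.1.lt_or_eq with h | h
      · have e : ‖s‖ = ρ := le_antisymm h1.2 (h2 h)
        rw [e]
        linarith [hB s]
      · rw [← h]
        simp only [Real.log_one, mul_zero, add_zero]
        exact hmax (by simp [← h])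
    · intro s hs hgt
      have hlogs : 0 < Real.log ‖s‖ := Real.log_pos hs.1
      have hG : 0 < D.G (q s) := by
        have : 0 < ε * Real.log ‖s‖ := by positivity
        linarith
      refine (D.G_LocRe (Eventually.of_forall hq) hG).lin ?_ _
      exact LocRe_log (F := fun s => s) (Eventually.of_forall fun _ => differentiableAt_id) (hlogc s (subset_closure hs))
  rcases hM0.eq_or_lt with h0 | h0
  · have : ∀ t, D.G (q t) = 0 := fun t => le_antisymm (h0 ▸ hle t) (D.hGnonneg _)
    rw [this, this]
  · have hcl : IsClopen {t | D.G (q t) = M} := by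
      refine ⟨isClosed_eq hcont continuous_const, isOpen_iff_mem_nhds.2 ?_⟩
      intro s hs
      have hs : D.G (q s) = M := hs
      have := (D.G_LocRe (Eventually.of_forall hq) (by rw [hs]; exact h0)).max
        (Eventually.of_forall fun t => by show D.G (q t) ≤ D.G (q s); rw [hs]; exact hle t)
      filter_upwards [this] with t ht
      exact ht.trans hs
    have := hcl.eq_univ ⟨t1, rfl⟩
    have h1 : ∀ t, D.G (q t) = M := fun t => by
      have h := mem_univ t
      rw [← this] at h
      exact h
    rw [h1, h1]

end HD
end

open Filter Topology Set
noncomputable section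
namespace HD
variable (D : HD)

lemma Omega_open (l : ℝ) : IsOpen {z | D.G z < l} := isOpen_lt D.hGcont continuous_const

lemma leaf_props {z} (hz : z ∈ D.V) : ∃ L : ℂ → ℂ × ℂ, Differentiable ℂ L ∧ (∀ t, D.Tau z (L t) t) ∧
    L 0 = z ∧ (∀ t, D.Stab z (L t)) ∧ (∀ t, D.G (L t) = D.G z) ∧ (∀ w t, D.Tau z w t → w = L t) := by
  obtain ⟨L, h1, h2⟩ := D.leaf hz
  exact ⟨L, h1, h2, D.Tau_zero hz (h2 0), fun t => D.Tau_Stab hz (h2 t),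
    fun t => D.Stab_G hz (D.Tau_Stab hz (h2 t)), fun w t h => D.Tau_inj hz (h2 t) h⟩

lemma comp_entire {f : ℂ × ℂ → ℂ × ℂ} {l : ℝ} (hf : DifferentiableOn ℂ f {z | D.G z < l}) {L : ℂ → ℂ × ℂ}
    (hL : Differentiable ℂ L) (h : ∀ t, D.G (L t) < l) : Differentiable ℂ (fun t => f (L t)) := by
  intro t
  exact (hf.differentiableAt ((D.Omega_open l).mem_nhds (h t))).comp t (hL t)

lemma leaf_const {f : ℂ × ℂ → ℂ × ℂ} {l B : ℝ} (hf : DifferentiableOn ℂ f {z | D.G z < l})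
    (hB : ∀ z, D.G z < l → D.G (f z) ≤ B) {z w} (hz : z ∈ D.V) (hl : D.G z < l) (h : D.Stab z w) :
    D.G (f w) = D.G (f z) := by
  obtain ⟨L, hL, -, h0, -, hG, hu⟩ := D.leaf_props hz
  obtain ⟨t, ht⟩ := D.Tau_exists hz h
  have := D.liouville (D.comp_entire hf hL fun t => by rw [hG]; exact hl) (fun t => hB _ (by rw [hG]; exact hl)) t
  simp only [h0, ← hu w t ht] at this
  exact this

lemma phi_open {v} (hv : v ∈ D.V) : 𝓝 (D.phi (D.H v)) ≤ map D.phi (𝓝 (D.H v)) := by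
  have hRR := D.R_all
  have hl := D.step_lin hv
  have hv1 := hv.1
  set w := D.H v with hw
  have hwV : w ∈ D.V := D.H_V hv
  have hw1 : ‖w.1‖ = ‖v.2‖ := rfl
  have hin : ∀ y ∈ Metric.ball w.2 (‖w.2‖/2), (w.1, y) ∈ D.V := by
    intro y hy
    rw [Metric.mem_ball, dist_eq_norm] at hy
    have := norm_sub_norm_le w.2 y
    rw [norm_sub_rev] at this
    constructor
    · show D.R < ‖y‖
      nlinarith
    · show ‖w.1‖ < ‖y‖
      nlinarith
  have hpos : 0 < ‖w.2‖ := by linarith [hwV.1]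
  have hd : DifferentiableOn ℂ (fun y => D.phi (w.1, y)) (Metric.ball w.2 (‖w.2‖/2)) :=
    D.phi_diff Metric.isOpen_ball (q := fun y => (w.1, y)) (by fun_prop) hin
  have han := hd.analyticOnNhd Metric.isOpen_ball
  have hc : w.2 ∈ Metric.ball w.2 (‖w.2‖/2) := Metric.mem_ball_self (by positivity)
  rcases (han _ hc).eventually_constant_or_nhds_le_map_nhds with h | h
  · exfalso
    have := han.eqOn_of_preconnected_of_eventuallyEq (g := fun _ => D.phi (w.1, w.2)) analyticOnNhd_const
      (convex_ball _ _).isPreconnected hc h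
    have c1 := D.hC1
    have hm : w.2 + ((10 * D.C1 : ℝ) : ℂ) ∈ Metric.ball w.2 (‖w.2‖/2) := by
      rw [Metric.mem_ball, dist_eq_norm, add_sub_cancel_left, Complex.norm_real, Real.norm_of_nonneg (by linarith)]
      linarith [hwV.1]
    have e := this hm
    have s1 := D.phi_sub (hin _ hm)
    have s2 := D.phi_sub (hin _ hc)
    simp only at e s1 s2
    rw [e] at s1
    have := norm_sub_le (D.phi (w.1, w.2) - w.2) (D.phi (w.1, w.2) - (w.2 + ((10 * D.C1 : ℝ) : ℂ)))
    have e2 : D.phi (w.1, w.2) - w.2 - (D.phi (w.1, w.2) - (w.2 + ((10 * D.C1 : ℝ) : ℂ))) = ((10 * D.C1 : ℝ) : ℂ) := by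
      ring
    rw [e2, Complex.norm_real, Real.norm_of_nonneg (by linarith)] at this
    linarith
  · refine h.trans ?_
    have hcont : Tendsto (fun y : ℂ => (w.1, y)) (𝓝 w.2) (𝓝 w) := by
      have : Continuous (fun y : ℂ => (w.1, y)) := by fun_prop
      exact this.tendsto w.2
    calc map (fun y => D.phi (w.1, y)) (𝓝 w.2) = map D.phi (map (fun y : ℂ => (w.1, y)) (𝓝 w.2)) := by
          rw [map_map]; rfl
      _ ≤ _ := map_mono hcont

/-- lifting a convergent sequence through `phi` -/
lemma phi_lift {v} (hv : v ∈ D.V) {u : ℕ → ℂ} (hu : Tendsto u atTop (𝓝 (D.phi (D.H v)))) :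
    ∀ N ∈ 𝓝 (D.H v), ∀ᶠ j in atTop, ∃ w ∈ N, w ∈ D.V ∧ D.phi w = u j := by
  intro N hN
  have h1 : D.phi '' (N ∩ D.V) ∈ 𝓝 (D.phi (D.H v)) :=
    D.phi_open hv (image_mem_map (inter_mem hN (D.V_open.mem_nhds (D.H_V hv))))
  filter_upwards [hu h1] with j hj
  obtain ⟨w, hw, e⟩ := hj
  exact ⟨w, hw.1, hw.2, e⟩

lemma root_dense {ζ ω : ℂ} (h : ‖ζ‖ = ‖ω‖) (h0 : ζ ≠ 0) :
    ∃ u : ℕ → ℂ, (∀ j, u j ^ (D.d ^ j) = 1) ∧ Tendsto (fun j => u j * ζ) atTop (𝓝 ω) := by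
  set x : ℝ := (ω / ζ).arg / (2 * Real.pi) with hx
  have hpi := Real.pi_pos
  have e1 : Complex.exp (2 * Real.pi * Complex.I * x) * ζ = ω := by
    have n1 : ‖ω / ζ‖ = 1 := by rw [norm_div, h, div_self]; rw [← h]; exact norm_ne_zero_iff.2 h0
    have : (2 * Real.pi * Complex.I * x : ℂ) = (ω/ζ).arg * Complex.I := by
      rw [hx]; push_cast; field_simp
    rw [this]
    have h2 := Complex.norm_mul_exp_arg_mul_I (ω/ζ)
    rw [n1, Complex.ofReal_one, one_mul] at h2
    rw [h2, div_mul_cancel₀ _ h0]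
  have hdp := D.d_pos
  have hfl : Tendsto (fun j : ℕ => (⌊(D.d:ℝ)^j * x⌋ : ℝ) / (D.d:ℝ)^j) atTop (𝓝 x) := by
    rw [tendsto_iff_norm_sub_tendsto_zero]
    have h0 : Tendsto (fun j : ℕ => (1 / (D.d:ℝ))^j) atTop (𝓝 0) := by
      apply tendsto_pow_atTop_nhds_zero_of_lt_one (by positivity)
      rw [div_lt_one hdp]; linarith [D.d_two]
    refine squeeze_zero (fun _ => norm_nonneg _) (fun j => ?_) h0
    have hp : 0 < (D.d:ℝ)^j := by positivity
    have e : (⌊(D.d:ℝ)^j * x⌋ : ℝ) / (D.d:ℝ)^j - x = (⌊(D.d:ℝ)^j * x⌋ - (D.d:ℝ)^j * x) / (D.d:ℝ)^j := by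
      field_simp
    rw [e, norm_div, Real.norm_of_nonneg hp.le, one_div, inv_pow, ← one_div]
    gcongr
    rw [Real.norm_eq_abs, abs_le]
    constructor <;> linarith [Int.floor_le ((D.d:ℝ)^j * x), Int.lt_floor_add_one ((D.d:ℝ)^j * x)]
  refine ⟨fun j => Complex.exp (2 * Real.pi * Complex.I * ((⌊(D.d:ℝ)^j * x⌋ : ℝ) / (D.d:ℝ)^j : ℝ)), ?_, ?_⟩
  · intro j
    rw [← Complex.exp_nat_mul, Complex.exp_eq_one_iff]
    refine ⟨⌊(D.d:ℝ)^j * x⌋, ?_⟩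
    have := D.d_ne
    push_cast
    field_simp
  · have hc : Continuous (fun s : ℝ => Complex.exp (2 * Real.pi * Complex.I * s) * ζ) := by fun_prop
    have := (hc.tendsto x).comp hfl
    rw [e1] at this
    exact this

lemma K1 {f : ℂ × ℂ → ℂ × ℂ} {l B : ℝ} (hf : DifferentiableOn ℂ f {z | D.G z < l})
    (hB : ∀ z, D.G z < l → D.G (f z) ≤ B) {z v} (hz : z ∈ D.V) (hv : v ∈ D.V)
    (hl : D.G z < l) (hG : D.G z = D.G (D.H v)) : D.G (f z) = D.G (f (D.H v)) := by
  have hw := D.H_V hv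
  have hn : ‖D.phi z‖ = ‖D.phi (D.H v)‖ := by
    rw [D.G_phi hz, D.G_phi hw] at hG
    exact Real.log_injOn_pos (norm_pos_iff.2 (D.phi_ne hz)) (norm_pos_iff.2 (D.phi_ne hw)) hG
  obtain ⟨u, hu1, hu2⟩ := D.root_dense hn (D.phi_ne hz)
  by_contra hne
  have hlw : D.G (D.H v) < l := hG ▸ hl
  have hcont : ContinuousAt (fun w => D.G (f w)) (D.H v) :=
    D.hGcont.continuousAt.comp (hf.differentiableAt ((D.Omega_open l).mem_nhds hlw)).continuousAt
  have hN : {w | D.G (f w) ≠ D.G (f z)} ∈ 𝓝 (D.H v) := hcont.eventually_ne (fun h => hne h.symm)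
  obtain ⟨j, w, hwN, hwV, hw2⟩ := (D.phi_lift hv hu2 _ hN).exists
  apply hwN
  apply D.leaf_const hf hB hz hl
  apply D.Stab_of_phi_n j (D.Hn_V hz j) (D.Hn_V hwV j)
  rw [D.phi_Hn hz, D.phi_Hn hwV, hw2, mul_pow, hu1, one_mul]

end HD
end

open Filter Topology Set
noncomputable section

lemma inj_linear0 {F : ℂ → ℂ} (hF : Differentiable ℂ F) (hi : Function.Injective F) (h0 : F 0 = 0)
    (hd : deriv F 0 ≠ 0) : ∃ α : ℂ, ∀ t, F t = α * t := by
  have hFt : ∀ t, F t = t * dslope F 0 t := by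
    intro t
    have := sub_smul_dslope F 0 t
    simp only [sub_zero, h0, smul_eq_mul] at this
    exact this.symm
  have dd : ∀ {g : ℂ → ℂ}, Differentiable ℂ g → Differentiable ℂ (dslope g 0) := by
    intro g hg
    rw [← differentiableOn_univ, Complex.differentiableOn_dslope univ_mem]
    exact hg.differentiableOn
  have hg0 : ∀ t, dslope F 0 t ≠ 0 := by
    intro t ht
    by_cases h : t = 0
    · rw [h, dslope_same] at ht; exact hd ht
    · have := hFt t
      rw [ht, mul_zero, ← h0] at this
      exact h (hi this)
  set h : ℂ → ℂ := fun t => (dslope F 0 t)⁻¹ with hh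
  have hhd : Differentiable ℂ h := fun t => (dd hF t).inv (hg0 t)
  have hh0 : ∀ t, h t ≠ 0 := fun t => inv_ne_zero (hg0 t)
  have hopen : F '' Metric.ball 0 1 ∈ 𝓝 (0:ℂ) := by
    rcases (hF.analyticAt 0).eventually_constant_or_nhds_le_map_nhds with hc | hm
    · exfalso
      exact hd (by rw [Filter.EventuallyEq.deriv_eq (hc : F =ᶠ[𝓝 0] fun _ => F 0)]; simp)
    · rw [h0] at hm
      exact hm (image_mem_map (Metric.ball_mem_nhds 0 one_pos))
  obtain ⟨ε, hε, hball⟩ := Metric.mem_nhds_iff.1 hopen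
  have hbig : ∀ t : ℂ, 1 ≤ ‖t‖ → ε ≤ ‖F t‖ := by
    intro t ht
    by_contra! hlt
    obtain ⟨s, hs, e⟩ := hball (by simpa using hlt : F t ∈ Metric.ball 0 ε)
    rw [hi e] at hs
    have : ‖t‖ < 1 := by simpa using hs
    linarith
  have hhb : ∀ t : ℂ, 1 ≤ ‖t‖ → ‖h t‖ ≤ ‖t‖ / ε := by
    intro t ht
    have h1 := hbig t ht
    have ht0 : 0 < ‖t‖ := by linarith
    have hgp := norm_pos_iff.2 (hg0 t)
    rw [hFt, norm_mul] at h1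
    rw [hh]; simp only [norm_inv]
    rw [le_div_iff₀ hε, inv_mul_le_iff₀ hgp, mul_comm]
    exact h1
  set k := dslope h 0 with hk
  have hkd : Differentiable ℂ k := dd hhd
  have hht : ∀ t, h t = h 0 + t * k t := by
    intro t
    have := sub_smul_dslope h 0 t
    simp only [sub_zero, smul_eq_mul] at this
    rw [hk, this]; ring
  have hkb : Bornology.IsBounded (range k) := by
    obtain ⟨M, hM⟩ := (isCompact_closedBall (0:ℂ) 1).exists_bound_of_continuousOn hkd.continuous.continuousOn
    rw [isBounded_iff_forall_norm_le]
    refine ⟨max M (1/ε + ‖h 0‖), ?_⟩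
    rintro _ ⟨t, rfl⟩
    by_cases ht : ‖t‖ ≤ 1
    · exact (hM t (by simpa using ht)).trans (le_max_left _ _)
    · push Not at ht
      refine le_trans ?_ (le_max_right _ _)
      have e : t * k t = h t - h 0 := by rw [hht t]; ring
      have ht0 : 0 < ‖t‖ := by linarith
      have e2 : ‖t‖ * ‖k t‖ ≤ ‖t‖ / ε + ‖h 0‖ := by
        rw [← norm_mul, e]
        exact (norm_sub_le _ _).trans (by linarith [hhb t ht.le])
      have e3 : ‖t‖ / ε + ‖h 0‖ ≤ ‖t‖ * (1/ε + ‖h 0‖) := by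
        have := norm_nonneg (h 0)
        have : ‖t‖ / ε = ‖t‖ * (1/ε) := by ring
        nlinarith
      exact le_of_mul_le_mul_left (e2.trans e3) ht0
  have hkc : ∀ t, k t = k 0 := fun t => hkd.apply_eq_apply_of_bounded hkb t 0
  have hk0 : k 0 = 0 := by
    by_contra hne
    apply hh0 (-h 0 / k 0)
    rw [hht, hkc (-h 0 / k 0), div_mul_cancel₀ _ hne]
    ring
  have hhc : ∀ t, h t = h 0 := fun t => by rw [hht t, hkc, hk0]; ring
  refine ⟨dslope F 0 0, fun t => ?_⟩
  have : dslope F 0 t = dslope F 0 0 := inv_injective (hhc t)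
  rw [hFt, this, mul_comm]

lemma inj_linear {F : ℂ → ℂ} (hF : Differentiable ℂ F) (hi : Function.Injective F) (h0 : F 0 = 0) :
    ∃ α : ℂ, α ≠ 0 ∧ ∀ t, F t = α * t := by
  have hex : ∃ t0, deriv F t0 ≠ 0 := by
    by_contra! hc
    have := is_const_of_deriv_eq_zero hF hc 0 1
    exact zero_ne_one (hi this)
  obtain ⟨t0, ht0⟩ := hex
  have h1 : Differentiable ℂ (fun t => F (t + t0) - F t0) := by fun_prop
  obtain ⟨α, hα⟩ := inj_linear0 (F := fun t => F (t + t0) - F t0) h1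
    (fun s t hst => by simpa using hi (sub_left_inj.1 hst)) (by simp)
    (by rw [deriv_sub_const, deriv_comp_add_const]; simpa using ht0)
  have h2 : ∀ t, F t = α * t := by
    intro t
    have e1 := hα (t - t0)
    have e2 := hα (0 - t0)
    simp only [sub_add_cancel, h0] at e1 e2
    linear_combination e1 - e2
  refine ⟨α, ?_, h2⟩
  rintro rfl
  have : F 0 = F 1 := by rw [h2, h2]; ring
  exact zero_ne_one (hi this)

lemma numeric {d : ℕ} (hd : 2 ≤ d) (κ R R' C : ℝ) (hR : 0 < R) (hR' : 0 < R') (n : ℕ → ℕ)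
    (h : ∀ᶠ j in atTop, |(j * κ + (d:ℝ)^j * R) - (n j * κ + (d:ℝ)^(n j) * R')| ≤ C) :
    ∃ s : ℤ, R' = (d:ℝ)^s * R := by
  have hd1 : (1:ℝ) < d := by exact_mod_cast (by omega : 1 < d)
  have hd0 : (0:ℝ) < d := by linarith
  have hpow : Tendsto (fun j : ℕ => (d:ℝ)^j) atTop atTop := tendsto_pow_atTop_atTop_of_one_lt hd1
  have hsm : Tendsto (fun j : ℕ => (j:ℝ) / (d:ℝ)^j) atTop (𝓝 0) := by
    have := tendsto_pow_const_div_const_pow_of_one_lt 1 hd1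
    simpa using this
  have hA : ∀ ρ : ℝ, 0 < ρ → Tendsto (fun j : ℕ => (j * κ + (d:ℝ)^j * ρ) / ((d:ℝ)^j * ρ)) atTop (𝓝 1) := by
    intro ρ hρ
    have h1 : Tendsto (fun j : ℕ => (j:ℝ) / (d:ℝ)^j * (κ / ρ) + 1) atTop (𝓝 (0 * (κ/ρ) + 1)) :=
      (hsm.mul_const _).add_const _
    rw [zero_mul, zero_add] at h1
    refine h1.congr fun j => ?_
    have : (d:ℝ)^j ≠ 0 := by positivity
    field_simp
  have hx : Tendsto (fun j : ℕ => j * κ + (d:ℝ)^j * R) atTop atTop := by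
    have h1 := (hA R hR).pos_mul_atTop one_pos (hpow.atTop_mul_const hR)
    refine h1.congr fun j => ?_
    have : (d:ℝ)^j ≠ 0 := by positivity
    field_simp
  set x : ℕ → ℝ := fun j => j * κ + (d:ℝ)^j * R with hxdef
  set y : ℕ → ℝ := fun j => n j * κ + (d:ℝ)^(n j) * R' with hydef
  have hy : Tendsto y atTop atTop := by
    apply tendsto_atTop_mono' atTop (f₁ := fun j => x j + (-C)) _ (tendsto_atTop_add_const_right _ _ hx)
    filter_upwards [h] with j hj
    have := (abs_le.1 hj).2
    simp only [hxdef, hydef]; linarith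
  have hn : Tendsto n atTop atTop := by
    rw [tendsto_atTop]
    intro N
    have hb : ∃ M : ℝ, ∀ m < N, m * κ + (d:ℝ)^m * R' ≤ M := by
      obtain ⟨M, hM⟩ := ((Set.finite_lt_nat N).image (fun m : ℕ => m * κ + (d:ℝ)^m * R')).bddAbove
      exact ⟨M, fun m hm => hM ⟨m, hm, rfl⟩⟩
    obtain ⟨M, hM⟩ := hb
    filter_upwards [hy.eventually_gt_atTop M] with j hj
    by_contra! hc
    exact absurd (hM _ hc) (not_le.2 hj)
  have hyx : Tendsto (fun j => y j / x j) atTop (𝓝 1) := by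
    have h1 : Tendsto (fun j => (y j - x j) / x j) atTop (𝓝 0) := by
      rw [tendsto_zero_iff_norm_tendsto_zero]
      have h2 : Tendsto (fun j => C / x j) atTop (𝓝 0) := hx.const_div_atTop C
      refine squeeze_zero' (Eventually.of_forall fun _ => norm_nonneg _) ?_ h2
      filter_upwards [h, hx.eventually_gt_atTop 0] with j hj hj2
      rw [norm_div, Real.norm_of_nonneg hj2.le, Real.norm_eq_abs, abs_sub_comm]
      gcongr
    have h2 := h1.add_const 1
    rw [zero_add] at h2
    refine h2.congr' ?_
    filter_upwards [hx.eventually_gt_atTop 0] with j hj2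
    field_simp
    ring
  have hy2 : Tendsto (fun j => y j / ((d:ℝ)^(n j) * R')) atTop (𝓝 1) := (hA R' hR').comp hn
  have hx2 : Tendsto (fun j => x j / ((d:ℝ)^j * R)) atTop (𝓝 1) := hA R hR
  have hfin : Tendsto (fun j => (d:ℝ)^(n j) * R' / ((d:ℝ)^j * R)) atTop (𝓝 1) := by
    have := (hyx.mul hx2).div hy2 one_ne_zero
    simp only [mul_one, div_one] at this
    refine this.congr' ?_
    filter_upwards [hx.eventually_gt_atTop 0, hy.eventually_gt_atTop 0] with j hj hj2
    simp only [Pi.div_apply]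
    have : (d:ℝ)^j ≠ 0 := by positivity
    field_simp
  have hlog := (Real.continuousAt_log one_ne_zero).tendsto.comp hfin
  rw [Real.log_one] at hlog
  have hld : 0 < Real.log d := Real.log_pos hd1
  have hZtend : Tendsto (fun j : ℕ => (((j:ℤ) - (n j:ℤ) : ℤ) : ℝ)) atTop (𝓝 (Real.log (R'/R) / Real.log d)) := by
    have h3 := ((hlog.const_sub (Real.log (R'/R))).div_const (Real.log d))
    rw [sub_zero] at h3
    refine h3.congr fun j => ?_
    have e : (d:ℝ)^(n j) * R' / ((d:ℝ)^j * R) = (d:ℝ)^(n j) / (d:ℝ)^j * (R'/R) := by field_simp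
    simp only [Function.comp]
    rw [e, Real.log_mul (by positivity) (by positivity), Real.log_div (x := (d:ℝ)^(n j)) (by positivity) (by positivity), Real.log_pow, Real.log_pow]
    push_cast
    field_simp
    ring
  have hcl := Int.isClosedEmbedding_coe_real.isClosed_range
  obtain ⟨s, hs⟩ := hcl.mem_of_tendsto hZtend (Eventually.of_forall fun j => ⟨_, rfl⟩)
  refine ⟨s, ?_⟩
  have e1 : Real.log (R'/R) = s * Real.log d := by
    rw [hs]; field_simp
  rw [← Real.log_zpow] at e1
  have := Real.log_injOn_pos (by simp; positivity) (by simp; positivity) e1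
  rw [← this]; field_simp

lemma root_sep {ρ : ℂ} {d : ℕ} (hd : 0 < d) (h : ρ ^ d = 1) (h1 : ρ ≠ 1) : 1 / (d:ℝ) ≤ ‖ρ - 1‖ := by
  have hn : ‖ρ‖ = 1 := Complex.norm_eq_one_of_pow_eq_one h hd.ne'
  have hp : ∀ i : ℕ, ‖ρ ^ i - 1‖ ≤ i * ‖ρ - 1‖ := by
    intro i
    induction i with
    | zero => simp
    | succ i ih =>
      have : ρ ^ (i+1) - 1 = ρ ^ i * (ρ - 1) + (ρ ^ i - 1) := by ring
      rw [this]
      refine (norm_add_le _ _).trans ?_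
      rw [norm_mul, norm_pow, hn, one_pow]
      push_cast; linarith
  have hs : ∑ i ∈ Finset.range d, ρ ^ i = 0 := by
    have := mul_geom_sum ρ d
    rw [h, sub_self] at this
    exact (mul_eq_zero.1 this).resolve_left (sub_ne_zero.2 h1)
  have hs2 : (d:ℂ) = - ∑ i ∈ Finset.range d, (ρ ^ i - 1) := by
    rw [Finset.sum_sub_distrib, hs]; simp
  have h3 : (d:ℝ) ≤ ∑ i ∈ Finset.range d, (d * ‖ρ - 1‖) := by
    have e : (d:ℝ) = ‖(d:ℂ)‖ := by simp
    have e2 : (d:ℝ) = ‖∑ i ∈ Finset.range d, (ρ ^ i - 1)‖ := by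
      rw [e, hs2, norm_neg]
    refine e2.le.trans ((norm_sum_le _ _).trans (Finset.sum_le_sum fun i hi => (hp i).trans ?_))
    gcongr
    exact (Finset.mem_range.1 hi).le
  rw [Finset.sum_const, Finset.card_range, nsmul_eq_mul] at h3
  have hd' : (0:ℝ) < d := by exact_mod_cast hd
  rw [div_le_iff₀ hd']
  have := le_of_mul_le_mul_left (by linarith : (d:ℝ) * 1 ≤ d * (d * ‖ρ - 1‖)) hd'
  linarith
end

open Filter Topology Set
noncomputable section
namespace HD
variable (D : HD)

/-- eventual equality of Böttcher coordinates -/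
def PEq (z w : ℂ × ℂ) : Prop :=
  ∃ k : ℕ, D.H^[k] z ∈ D.V ∧ D.H^[k] w ∈ D.V ∧ D.phi (D.H^[k] z) = D.phi (D.H^[k] w)

lemma PEq_up {z w : ℂ × ℂ} {k : ℕ} (h1 : D.H^[k] z ∈ D.V) (h2 : D.H^[k] w ∈ D.V)
    (h : D.phi (D.H^[k] z) = D.phi (D.H^[k] w)) {m : ℕ} (hm : k ≤ m) :
    D.phi (D.H^[m] z) = D.phi (D.H^[m] w) := by
  obtain ⟨i, rfl⟩ := Nat.exists_eq_add_of_le' hm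
  rw [Function.iterate_add_apply, Function.iterate_add_apply, D.phi_Hn h1, D.phi_Hn h2, h]

variable {D} in
lemma PEq.symm {z w : ℂ × ℂ} (h : D.PEq z w) : D.PEq w z := by
  obtain ⟨k, h1, h2, h3⟩ := h
  exact ⟨k, h2, h1, h3.symm⟩

variable {D} in
lemma PEq.trans {z w v : ℂ × ℂ} (h : D.PEq z w) (h' : D.PEq w v) : D.PEq z v := by
  obtain ⟨k, h1, h2, h3⟩ := h
  obtain ⟨m, g1, g2, g3⟩ := h'
  exact ⟨max k m, D.escape' h1 (le_max_left _ _), D.escape' g2 (le_max_right _ _),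
    (D.PEq_up h1 h2 h3 (le_max_left _ _)).trans (D.PEq_up g1 g2 g3 (le_max_right _ _))⟩

lemma PEq_Stab {z w : ℂ × ℂ} (h : D.PEq z w) : D.Stab z w := by
  obtain ⟨k, h1, h2, h3⟩ := h
  exact D.Stab_of_phi_n k h1 h2 h3

/-- local constancy of the Böttcher coordinate along a disc in a level set -/
lemma phi_loc_const {E : ℂ → ℂ × ℂ} (hE : Differentiable ℂ E) {r : ℝ} (hG : ∀ t, D.G (E t) = r)
    {t0} {k : ℕ} (hk : D.H^[k] (E t0) ∈ D.V) :
    ∀ᶠ t in 𝓝 t0, D.H^[k] (E t) ∈ D.V ∧ D.phi (D.H^[k] (E t)) = D.phi (D.H^[k] (E t0)) := by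
  have hV := D.near_V (hE t0).continuousAt k hk
  have hd := D.Phi_diff (Eventually.of_forall hE) k hk
  have hn : ∀ t, D.H^[k] (E t) ∈ D.V → Real.log ‖D.phi (D.H^[k] (E t))‖ = (D.d:ℝ)^k * r := by
    intro t ht
    rw [← D.G_phi ht, G_Hn, hG]
  have hm : IsLocalMax (norm ∘ fun t => D.phi (D.H^[k] (E t))) t0 := by
    filter_upwards [hV] with t ht
    apply le_of_eq
    simp only [Function.comp]
    exact Real.log_injOn_pos (norm_pos_iff.2 (D.phi_ne ht)) (norm_pos_iff.2 (D.phi_ne hk)) ((hn t ht).trans (hn t0 hk).symm)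
  exact hV.and (Complex.eventually_eq_of_isLocalMax_norm hd hm)

lemma PEq_const {E : ℂ → ℂ × ℂ} (hE : Differentiable ℂ E) {r : ℝ} (hG : ∀ t, D.G (E t) = r) (hr : 0 < r)
    (t : ℂ) : D.PEq (E 0) (E t) := by
  have loc : ∀ t0, ∀ᶠ t in 𝓝 t0, D.PEq (E t0) (E t) := by
    intro t0
    obtain ⟨k, hk⟩ := D.escape (z := E t0) (by rw [hG]; exact hr)
    filter_upwards [D.phi_loc_const hE hG hk] with t ht
    exact ⟨k, hk, ht.1, ht.2.symm⟩
  have hcl : IsClopen {t | D.PEq (E 0) (E t)} := by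
    constructor
    · rw [← isOpen_compl_iff, isOpen_iff_mem_nhds]
      intro t0 h0
      filter_upwards [loc t0] with t ht h
      exact h0 (PEq.trans h ht.symm)
    · rw [isOpen_iff_mem_nhds]
      intro t0 h0
      filter_upwards [loc t0] with t ht
      exact PEq.trans h0 ht
  have h1 := hcl.eq_univ ⟨0, (loc 0).self_of_nhds⟩
  have h := mem_univ t
  rw [← h1] at h
  exact h

lemma T_diff (n : ℕ) (p : ℂ × ℂ) : Differentiable ℂ (D.T n p) := by
  have : D.T n p = fun w => D.lam ^ n * D.Y n p * (D.X n w - D.X n p) := rfl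
  rw [this]
  have := D.X_diff n
  fun_prop

lemma Tau_unique {z w : ℂ × ℂ} {s t} (h : D.Tau z w s) (h' : D.Tau z w t) : s = t :=
  tendsto_nhds_unique h h'

lemma F_diff {E : ℂ → ℂ × ℂ} (hE : Differentiable ℂ E) {r : ℝ} (hG : ∀ t, D.G (E t) = r) (hr : 0 < r)
    {z} (hz : z ∈ D.V) {F : ℂ → ℂ} (hF : ∀ t, D.Tau z (E t) (F t)) : Differentiable ℂ F := by
  intro t0
  obtain ⟨m, hm⟩ := D.escape (z := E t0) (by rw [hG]; exact hr)
  obtain ⟨U, hU, hUo, hU0⟩ := eventually_nhds_iff.1 (D.phi_loc_const hE hG hm)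
  set p := D.H^[m] (E t0) with hp
  have hcl : ∀ t ∈ U, ∃ τ, D.Tau p (D.H^[m] (E t)) τ ∧
      ∀ n, ‖τ - D.T n p (D.H^[m] (E t))‖ ≤ 1/25 * (1/2)^n * ‖D.T 0 p (D.H^[m] (E t))‖ :=
    fun t ht => D.tau_close hm (D.close_of_phi hm (hU t ht).1 (hU t ht).2.symm)
  choose! τ hτ1 hτ2 using hcl
  have hFτ : ∀ t ∈ U, F t = F t0 + D.lam ^ m * τ t := by
    intro t ht
    exact D.Tau_unique (hF t) (D.Tau_add hz (hF t0) ((D.Tau_Hn m _ _ _).2 (hτ1 t ht)))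
  have hTd : ∀ n, Differentiable ℂ (fun t => D.T n p (D.H^[m] (E t))) := fun n t =>
    DifferentiableAt.comp (g := D.T n p) t (D.T_diff n p _) (DifferentiableAt.comp (g := D.H^[m]) t (D.Hn_diff m _) (hE t))
  -- bounded neighbourhood
  have hbd : ∀ᶠ t in 𝓝 t0, ‖D.T 0 p (D.H^[m] (E t))‖ < ‖D.T 0 p (D.H^[m] (E t0))‖ + 1 :=
    ((hTd 0).continuous.norm.continuousAt).eventually_lt_const (by linarith)
  obtain ⟨W, hW, hWo, hW0⟩ := eventually_nhds_iff.1 (hbd.and (hUo.mem_nhds hU0))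
  set M := ‖D.T 0 p (D.H^[m] (E t0))‖ + 1 with hM
  have hu : TendstoUniformlyOn (fun n t => D.T n p (D.H^[m] (E t))) τ atTop W := by
    rw [Metric.tendstoUniformlyOn_iff]
    intro ε hε
    have : Tendsto (fun n : ℕ => 1/25 * (1/2:ℝ)^n * M) atTop (𝓝 (1/25 * 0 * M)) :=
      ((tendsto_pow_atTop_nhds_zero_of_lt_one (by norm_num) (by norm_num)).const_mul _).mul_const _
    rw [mul_zero, zero_mul] at this
    filter_upwards [this.eventually_lt_const hε] with n hn t ht
    rw [dist_eq_norm]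
    refine (hτ2 t (hW t ht).2 n).trans_lt (lt_of_le_of_lt ?_ hn)
    have := (hW t ht).1.le
    gcongr
  have hd := hu.tendstoLocallyUniformlyOn.differentiableOn
    (Eventually.of_forall fun n => (hTd n).differentiableOn) hWo
  have hd0 := hd.differentiableAt (hWo.mem_nhds hW0)
  have : DifferentiableAt ℂ (fun t => F t0 + D.lam ^ m * τ t) t0 := (hd0.const_mul _).const_add _
  refine this.congr_of_eventuallyEq ?_
  filter_upwards [hUo.mem_nhds hU0] with t ht
  exact hFτ t ht

/-- constant in the order estimate -/
def C4 : ℝ := 3 * Real.log 2 + Real.log (8 * D.d)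

lemma abs_log_le {x y c : ℝ} (hx : 0 < x) (hy : 0 < y) (hc : 0 < c) (h1 : x ≤ c * y) (h2 : y ≤ c * x) :
    |Real.log x - Real.log y| ≤ Real.log c := by
  rw [abs_le]
  have e1 := Real.log_le_log hx h1
  have e2 := Real.log_le_log hy h2
  rw [Real.log_mul hc.ne' hy.ne'] at e1
  rw [Real.log_mul hc.ne' hx.ne'] at e2
  constructor <;> linarith

lemma order_est {v v' : ℂ × ℂ} (hv : v ∈ D.V) (hv' : v' ∈ D.V) {n : ℕ}
    (h1 : D.phi v' ^ D.d ^ (n+1) = D.phi v ^ D.d ^ (n+1)) (h2 : D.phi v' ^ D.d ^ n ≠ D.phi v ^ D.d ^ n)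
    {τ} (hτ : D.Tau v v' τ) :
    |Real.log ‖τ‖ - (((n+1:ℕ):ℝ) * Real.log (D.d / ‖D.a‖) + (D.d:ℝ)^(n+1) * (D.G v * (1 + 1 / D.d)))| ≤ D.C4
      ∧ 0 < ‖τ‖ := by
  have hRR := D.R_all
  have c1 := D.hC1
  have hdp := D.d_pos
  have hd2 := D.d_two
  have ap := D.a_pos
  set u := D.H^[n] v with hu
  set u' := D.H^[n] v' with hu'
  have huV : u ∈ D.V := D.Hn_V hv n
  have huV' : u' ∈ D.V := D.Hn_V hv' n
  have pu : D.phi u = D.phi v ^ D.d ^ n := D.phi_Hn hv n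
  have pu' : D.phi u' = D.phi v' ^ D.d ^ n := D.phi_Hn hv' n
  have pne := D.phi_ne huV
  set p := D.H^[n+1] v with hp
  set p' := D.H^[n+1] v' with hp'
  have hpV : p ∈ D.V := D.Hn_V hv _
  have hpV' : p' ∈ D.V := D.Hn_V hv' _
  have pp : D.phi p = D.phi p' := by rw [D.phi_Hn hv, D.phi_Hn hv', h1]
  obtain ⟨τ0, t1, t2⟩ := D.tau_close hpV (D.close_of_phi hpV hpV' pp)
  have hτe : τ = D.lam ^ (n+1) * τ0 := D.Tau_unique hτ ((D.Tau_Hn (n+1) _ _ _).2 t1)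
  have hT0 : D.T 0 p p' = p.2 * (u'.2 - u.2) := by
    have e1 : D.X 0 p = u.2 := D.X_succ n v
    have e2 : D.X 0 p' = u'.2 := D.X_succ n v'
    rw [T, e1, e2, Y_zero]; simp
  have t3 := t2 0
  rw [pow_zero, mul_one] at t3
  -- separation
  set ρ := D.phi u' / D.phi u with hρ
  have hρd : ρ ^ D.d = 1 := by
    rw [hρ, div_pow, pu, pu', ← pow_mul, ← pow_mul, ← pow_succ, h1, div_self]
    exact pow_ne_zero _ (D.phi_ne hv)
  have hρ1 : ρ ≠ 1 := by
    rw [hρ]; intro h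
    rw [div_eq_one_iff_eq pne, pu, pu'] at h
    exact h2 h
  have sep := root_sep (by have := D.hd; omega) hρd hρ1
  have hρn : ‖ρ‖ = 1 := Complex.norm_eq_one_of_pow_eq_one hρd (by have := D.hd; omega)
  have hdiff : D.phi u' - D.phi u = (ρ - 1) * D.phi u := by rw [hρ]; field_simp
  have s1 := D.phi_sub huV
  have s2 := D.phi_sub huV'
  have s3 := D.phi_norm huV
  have hu1 := huV.1
  have hup : 0 < ‖u.2‖ := by linarith
  have dlow : ‖u.2‖ ≤ 8 * D.d * ‖u'.2 - u.2‖ := by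
    have e : (ρ - 1) * D.phi u = (D.phi u' - u'.2) - (D.phi u - u.2) + (u'.2 - u.2) := by rw [← hdiff]; ring
    have e2 : ‖(ρ - 1) * D.phi u‖ ≤ 6 * D.C1 + ‖u'.2 - u.2‖ := by
      rw [e]
      refine (norm_add_le _ _).trans ?_
      linarith [norm_sub_le (D.phi u' - u'.2) (D.phi u - u.2)]
    rw [norm_mul] at e2
    have e3 : 1 / (D.d:ℝ) * (‖u.2‖/2) ≤ ‖ρ - 1‖ * ‖D.phi u‖ := by gcongr; exact s3.1
    have e4 := e3.trans e2
    have e5 : D.d * (1 / (D.d:ℝ) * (‖u.2‖/2)) ≤ D.d * (6 * D.C1 + ‖u'.2 - u.2‖) := by gcongr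
    have e6 : D.d * (1 / (D.d:ℝ) * (‖u.2‖/2)) = ‖u.2‖/2 := by field_simp
    rw [e6] at e5
    nlinarith
  have dup : ‖u'.2 - u.2‖ ≤ 8 * D.d * ‖u.2‖ := by
    have e : u'.2 - u.2 = (ρ - 1) * D.phi u - (D.phi u' - u'.2) + (D.phi u - u.2) := by rw [← hdiff]; ring
    have e2 : ‖u'.2 - u.2‖ ≤ ‖(ρ - 1) * D.phi u‖ + 6 * D.C1 := by
      rw [e]
      refine (norm_add_le _ _).trans ?_
      linarith [norm_sub_le ((ρ - 1) * D.phi u) (D.phi u' - u'.2)]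
    have e3 : ‖(ρ - 1) * D.phi u‖ ≤ 2 * (2 * ‖u.2‖) := by
      rw [norm_mul]
      gcongr
      · refine (norm_sub_le _ _).trans ?_
        rw [hρn, norm_one]; norm_num
      · exact s3.2
    nlinarith
  have dpos : 0 < ‖u'.2 - u.2‖ := by
    by_contra! hc
    have : ‖u'.2 - u.2‖ = 0 := le_antisymm hc (norm_nonneg _)
    rw [this] at dlow
    linarith
  have hpp : 0 < ‖p.2‖ := by linarith [hpV.1]
  have hTp : 0 < ‖D.T 0 p p'‖ := by rw [hT0, norm_mul]; positivity
  have tl : ‖D.T 0 p p'‖ ≤ 2 * ‖τ0‖ := by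
    have := norm_sub_norm_le (D.T 0 p p') τ0
    rw [norm_sub_rev] at this
    linarith
  have tu : ‖τ0‖ ≤ 2 * ‖D.T 0 p p'‖ := by
    have := norm_sub_norm_le τ0 (D.T 0 p p')
    linarith
  have t0p : 0 < ‖τ0‖ := by linarith
  have l1 := abs_log_le t0p hTp two_pos tu tl
  have l2 := abs_log_le dpos hup (by positivity) dup dlow
  have l3 := D.log_Y hv (n+1)
  have l4 := D.log_Y hv n
  have eY1 : D.Y (n+1) v = p.2 := rfl
  have eY0 : D.Y n v = u.2 := rfl
  rw [eY1] at l3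
  rw [eY0] at l4
  have hlam : 0 < ‖D.lam ^ (n+1)‖ := norm_pos_iff.2 (pow_ne_zero _ D.lam_ne)
  refine ⟨?_, by rw [hτe, norm_mul]; positivity⟩
  have lt : Real.log ‖τ‖ = ((n+1:ℕ):ℝ) * Real.log (D.d / ‖D.a‖) + Real.log ‖τ0‖ := by
    rw [hτe, norm_mul, Real.log_mul hlam.ne' t0p.ne', norm_pow, Real.log_pow, lam_norm]
  have lT : Real.log ‖D.T 0 p p'‖ = Real.log ‖p.2‖ + Real.log ‖u'.2 - u.2‖ := by
    rw [hT0, norm_mul, Real.log_mul hpp.ne' dpos.ne']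
  rw [lT] at l1
  rw [lt]
  have eG : (D.d:ℝ)^(n+1) * (D.G v * (1 + 1 / D.d)) = (D.d:ℝ)^(n+1) * D.G v + (D.d:ℝ)^n * D.G v := by
    rw [pow_succ]; field_simp
  rw [eG]
  unfold C4
  rw [abs_le] at *
  constructor <;> linarith [l1.1, l1.2, l2.1, l2.2, l3.1, l3.2, l4.1, l4.2]

end HD
end

open Filter Topology Set
noncomputable section

lemma lin_pow_tendsto {d : ℕ} (hd : 2 ≤ d) (κ R : ℝ) (hR : 0 < R) :
    Tendsto (fun j : ℕ => j * κ + (d:ℝ)^j * R) atTop atTop := by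
  have hd1 : (1:ℝ) < d := by exact_mod_cast (by omega : 1 < d)
  have hd0 : (0:ℝ) < d := by linarith
  have hpow : Tendsto (fun j : ℕ => (d:ℝ)^j) atTop atTop := tendsto_pow_atTop_atTop_of_one_lt hd1
  have hsm : Tendsto (fun j : ℕ => (j:ℝ) / (d:ℝ)^j) atTop (𝓝 0) := by
    have := tendsto_pow_const_div_const_pow_of_one_lt 1 hd1
    simpa using this
  have h1 : Tendsto (fun j : ℕ => (j:ℝ) / (d:ℝ)^j * κ + R) atTop (𝓝 (0 * κ + R)) :=
    (hsm.mul_const _).add_const _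
  rw [zero_mul, zero_add] at h1
  refine (h1.pos_mul_atTop hR hpow).congr fun j => ?_
  have : (d:ℝ)^j ≠ 0 := by positivity
  field_simp

namespace HD
variable (D : HD)

/-- the sequence of roots of unity of exact order d^j -/
def rt (j : ℕ) : ℂ := Complex.exp (2 * Real.pi * Complex.I / ((D.d ^ j : ℕ) : ℂ))

lemma rt_pow (j : ℕ) : D.rt j ^ D.d ^ j = 1 :=
  (Complex.isPrimitiveRoot_exp (D.d ^ j) (pow_ne_zero _ (by have := D.hd; omega))).pow_eq_one

lemma rt_pow_ne (j : ℕ) : D.rt (j+1) ^ D.d ^ j ≠ 1 := by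
  have hd := D.hd
  have h := Complex.isPrimitiveRoot_exp (D.d ^ (j+1)) (pow_ne_zero _ (by omega))
  exact h.pow_ne_one_of_pos_of_lt (pow_ne_zero _ (by omega)) (Nat.pow_lt_pow_right (by omega) (by omega))

lemma rt_tendsto : Tendsto D.rt atTop (𝓝 1) := by
  have hd1 : (1:ℝ) < D.d := by exact_mod_cast (by have := D.hd; omega : 1 < D.d)
  have h0 : Tendsto (fun j : ℕ => (((1/D.d:ℝ))^j)) atTop (𝓝 0) :=
    tendsto_pow_atTop_nhds_zero_of_lt_one (by positivity) (by rw [div_lt_one (by linarith)]; exact hd1)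
  have h1 : Tendsto (fun j : ℕ => (2 * Real.pi * Complex.I) * (((((1/D.d:ℝ))^j : ℝ)) : ℂ)) atTop (𝓝 ((2 * Real.pi * Complex.I) * ((0:ℝ):ℂ))) :=
    ((Complex.continuous_ofReal.tendsto _).comp h0).const_mul _
  have h2 := (Complex.continuous_exp.tendsto _).comp h1
  simp only [Complex.ofReal_zero, mul_zero, Complex.exp_zero] at h2
  refine h2.congr fun j => ?_
  simp only [Function.comp, rt]
  congr 1
  push_cast
  simp [div_eq_mul_inv]

lemma K2 {f : ℂ × ℂ → ℂ × ℂ} {l B : ℝ} (hf : DifferentiableOn ℂ f {z | D.G z < l})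
    (hB : ∀ z, D.G z < l → D.G (f z) ≤ B) (hinj : InjOn f {z | D.G z < l}) {v} (hv : v ∈ D.V)
    (hl : D.G (D.H v) < l) (hfV : f (D.H v) ∈ D.V) :
    ∃ s : ℤ, D.G (f (D.H v)) = (D.d:ℝ)^s * D.G (D.H v) := by
  have hzV := D.H_V hv
  set z := D.H v with hz
  obtain ⟨L, hL, hLT, hL0, hLS, hLG, hLu⟩ := D.leaf_props hzV
  have hLl : ∀ t, D.G (L t) < l := fun t => by rw [hLG]; exact hl
  have hE := D.comp_entire hf hL hLl
  have hr : 0 < D.G (f z) := D.G_pos hfV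
  have hEG : ∀ t, D.G (f (L t)) = D.G (f z) := fun t => D.leaf_const hf hB hzV hl (hLS t)
  have hEP : ∀ t, D.PEq (f z) (f (L t)) := fun t => by
    have := D.PEq_const hE hEG hr t
    simpa only [hL0] using this
  have hFe : ∀ t, ∃ s, D.Tau (f z) (f (L t)) s := fun t => D.Tau_exists hfV (D.PEq_Stab (hEP t))
  choose F hF using hFe
  have hFd := D.F_diff hE hEG hr hfV hF
  have hF0 : F 0 = 0 := by
    refine D.Tau_unique (hF 0) ?_
    rw [hL0]
    simp [Tau, T]
  have hFi : Function.Injective F := by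
    intro s t hst
    have h1 := hF s
    rw [hst] at h1
    have h2 := D.Tau_inj hfV h1 (hF t)
    have h3 := hinj (hLl t) (hLl s) h2
    have h4 := hLT t
    rw [h3] at h4
    exact D.Tau_unique (hLT s) h4
  obtain ⟨α, hα, hFα⟩ := inj_linear hFd hFi hF0
  have hfc : ContinuousAt f z := (hf.differentiableAt ((D.Omega_open l).mem_nhds hl)).continuousAt
  have hN : {w | f w ∈ D.V ∧ ‖(f w).1 - (f z).1‖ < 1} ∈ 𝓝 z := by
    refine inter_mem (hfc (D.V_open.mem_nhds hfV)) ?_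
    have : ContinuousAt (fun w => ‖(f w).1 - (f z).1‖) z := by fun_prop
    exact this.eventually_lt_const (by simp)
  have hu : Tendsto (fun j => D.rt j * D.phi z) atTop (𝓝 (D.phi z)) := by
    have := D.rt_tendsto.mul_const (D.phi z)
    rwa [one_mul] at this
  have hR1 : 0 < D.G z * (1 + 1 / D.d) := mul_pos (D.G_pos hzV) (by have := D.d_pos; positivity)
  have hR2 : 0 < D.G (f z) * (1 + 1 / D.d) := mul_pos hr (by have := D.d_pos; positivity)
  have hbig := (lin_pow_tendsto D.hd (Real.log (D.d / ‖D.a‖)) _ hR1).eventually_gt_atTop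
    (Real.log (2 * ‖(f z).2‖) - Real.log ‖α‖ + D.C4)
  have key : ∀ᶠ j : ℕ in atTop, ∃ n : ℕ,
      |(j * Real.log (D.d / ‖D.a‖) + (D.d:ℝ)^j * (D.G z * (1 + 1 / D.d))) -
        (n * Real.log (D.d / ‖D.a‖) + (D.d:ℝ)^n * (D.G (f z) * (1 + 1 / D.d)))| ≤ 2 * D.C4 + |Real.log ‖α‖| := by
    filter_upwards [D.phi_lift hv hu _ hN, hbig, eventually_ge_atTop 1] with j hj hjb hj1
    obtain ⟨w, ⟨hw1, hw2⟩, hwV, hwp⟩ := hj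
    obtain ⟨i, rfl⟩ := Nat.exists_eq_add_of_le' hj1
    have pz := D.phi_ne hzV
    have e1 : D.phi w ^ D.d ^ (i+1) = D.phi z ^ D.d ^ (i+1) := by rw [hwp, mul_pow, rt_pow, one_mul]
    have e2 : D.phi w ^ D.d ^ i ≠ D.phi z ^ D.d ^ i := by
      rw [hwp, mul_pow]
      intro h
      exact D.rt_pow_ne i (mul_right_cancel₀ (pow_ne_zero (D.d ^ i) pz) (by rw [h, one_mul]))
    have hst : D.Stab z w := D.Stab_of_phi_n (i+1) (D.Hn_V hzV _) (D.Hn_V hwV _)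
      (by rw [D.phi_Hn hzV, D.phi_Hn hwV, e1])
    obtain ⟨t, ht⟩ := D.Tau_exists hzV hst
    have hwL := hLu w t ht
    have hT : D.Tau (f z) (f w) (α * t) := by rw [hwL, ← hFα]; exact hF t
    have hP : D.PEq (f z) (f w) := by rw [hwL]; exact hEP t
    obtain ⟨o1, o2⟩ := D.order_est hzV hwV e1 e2 ht
    have hex : ∃ n, D.phi (f w) ^ D.d ^ n = D.phi (f z) ^ D.d ^ n := by
      obtain ⟨k, -, -, h⟩ := hP
      exact ⟨k, by rw [← D.phi_Hn hfV, ← D.phi_Hn hw1, h]⟩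
    classical
    have hαp : 0 < ‖α‖ := norm_pos_iff.2 hα
    have hlm : Real.log ‖α * t‖ = Real.log ‖α‖ + Real.log ‖t‖ := by
      rw [norm_mul, Real.log_mul hαp.ne' o2.ne']
    have o1' := abs_le.1 o1
    rcases hn : Nat.find hex with _ | n
    · exfalso
      have h0 := Nat.find_spec hex
      rw [hn, pow_zero, pow_one, pow_one] at h0
      obtain ⟨τ, t1, t2⟩ := D.tau_close hfV (D.close_of_phi hfV hw1 h0.symm)
      have t3 := D.Tau_unique hT t1
      have t4 := t2 0
      rw [← t3] at t4
      have t5 : ‖D.T 0 (f z) (f w)‖ ≤ ‖(f z).2‖ := by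
        have : D.T 0 (f z) (f w) = (f z).2 * ((f w).1 - (f z).1) := by simp [T, Y, X]
        rw [this, norm_mul]
        nlinarith [norm_nonneg (f z).2]
      have t6 : ‖α * t‖ ≤ 2 * ‖(f z).2‖ := by
        have := norm_sub_norm_le (α * t) (D.T 0 (f z) (f w))
        norm_num at t4
        have := norm_nonneg (f z).2
        linarith
      have t7 := Real.log_le_log (by rw [norm_mul]; positivity) t6
      rw [hlm] at t7
      linarith [o1'.1]
    · have h1 := Nat.find_spec hex
      have h2 := Nat.find_min hex (m := n) (by omega)
      rw [hn] at h1
      obtain ⟨q1, -⟩ := D.order_est hfV hw1 h1 h2 hT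
      rw [hlm] at q1
      refine ⟨n+1, ?_⟩
      have q2 := abs_le.1 q1
      have q3 := neg_abs_le (Real.log ‖α‖)
      have q4 := le_abs_self (Real.log ‖α‖)
      rw [abs_le]
      constructor <;> linarith [o1'.1, o1'.2, q2.1, q2.2]
  obtain ⟨n, hn⟩ := key.choice
  obtain ⟨s, hs⟩ := numeric D.hd _ _ _ _ hR1 hR2 n hn
  refine ⟨s, ?_⟩
  have : (0:ℝ) < 1 + 1 / D.d := by have := D.d_pos; positivity
  rw [← mul_assoc] at hs
  exact mul_right_cancel₀ this.ne' hs
end HD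
end

open Filter Topology Set
noncomputable section
namespace HD
variable (D : HD)

lemma G_Hin (m : ℕ) (w) : (D.d:ℝ)^m * D.G (D.Hi^[m] w) = D.G w := by
  rw [← D.G_Hn, D.Hn_Hin]

/-- conjugate of `f` by the `m`-th iterate -/
def hat (f : ℂ × ℂ → ℂ × ℂ) (m : ℕ) (w : ℂ × ℂ) : ℂ × ℂ := D.H^[m] (f (D.Hi^[m] w))

lemma hat_H (f) (m : ℕ) (w) : D.hat f m (D.H^[m] w) = D.H^[m] (f w) := by
  rw [hat, D.Hin_Hn]

lemma hat_dom {l : ℝ} {m : ℕ} {w} (h : D.G w < (D.d:ℝ)^m * l) : D.G (D.Hi^[m] w) < l := by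
  rw [← D.G_Hin m] at h
  exact lt_of_mul_lt_mul_left h (by positivity)

lemma hat_diff {f : ℂ × ℂ → ℂ × ℂ} {l : ℝ} (hf : DifferentiableOn ℂ f {z | D.G z < l}) (m : ℕ) :
    DifferentiableOn ℂ (D.hat f m) {z | D.G z < (D.d:ℝ)^m * l} := by
  refine (D.Hn_diff m).comp_differentiableOn (hf.comp (D.Hin_diff m).differentiableOn ?_)
  intro w hw
  exact D.hat_dom hw

lemma hat_bd {f : ℂ × ℂ → ℂ × ℂ} {l B : ℝ} (hB : ∀ z, D.G z < l → D.G (f z) ≤ B) (m : ℕ) :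
    ∀ z, D.G z < (D.d:ℝ)^m * l → D.G (D.hat f m z) ≤ (D.d:ℝ)^m * B := by
  intro z hz
  rw [hat, G_Hn]
  have := D.d_pos
  exact mul_le_mul_of_nonneg_left (hB _ (D.hat_dom hz)) (by positivity)

lemma hat_inj {f : ℂ × ℂ → ℂ × ℂ} {l : ℝ} (hi : InjOn f {z | D.G z < l}) (m : ℕ) :
    InjOn (D.hat f m) {z | D.G z < (D.d:ℝ)^m * l} := by
  intro z hz w hw h
  have h1 := congrArg (D.Hi^[m]) h
  rw [hat, hat, Hin_Hn, Hin_Hn] at h1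
  have h2 := hi (D.hat_dom hz) (D.hat_dom hw) h1
  have h3 := congrArg (D.H^[m]) h2
  rwa [Hn_Hin, Hn_Hin] at h3

lemma K1' {f : ℂ × ℂ → ℂ × ℂ} {l B : ℝ} (hf : DifferentiableOn ℂ f {z | D.G z < l})
    (hB : ∀ z, D.G z < l → D.G (f z) ≤ B) {z w} (hz : 0 < D.G z) (hl : D.G z < l) (h : D.G z = D.G w) :
    D.G (f z) = D.G (f w) := by
  obtain ⟨i, hi⟩ := D.escape hz
  obtain ⟨j, hj⟩ := D.escape (z := w) (h ▸ hz)
  have hd := D.d_pos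
  have hp : 0 < (D.d:ℝ)^(i+j+1) := by positivity
  have h1 : D.H^[i+j+1] z ∈ D.V := D.escape' hi (by omega)
  have h2 : D.H^[i+j] w ∈ D.V := D.escape' hj (by omega)
  have e : D.H (D.H^[i+j] w) = D.H^[i+j+1] w := (Function.iterate_succ_apply' _ _ _).symm
  have := D.K1 (D.hat_diff hf (i+j+1)) (D.hat_bd hB (i+j+1)) h1 h2
    (by rw [G_Hn]; exact mul_lt_mul_of_pos_left hl hp) (by rw [e, G_Hn, G_Hn, h])
  rw [e, hat_H, hat_H, G_Hn, G_Hn] at this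
  exact mul_left_cancel₀ hp.ne' this

lemma K2' {f : ℂ × ℂ → ℂ × ℂ} {l B : ℝ} (hf : DifferentiableOn ℂ f {z | D.G z < l})
    (hB : ∀ z, D.G z < l → D.G (f z) ≤ B) (hinj : InjOn f {z | D.G z < l}) {z} (hz : 0 < D.G z)
    (hl : D.G z < l) (hfz : 0 < D.G (f z)) :
    ∃ s : ℤ, D.G (f z) = (D.d:ℝ)^s * D.G z := by
  obtain ⟨i, hi⟩ := D.escape hz
  obtain ⟨j, hj⟩ := D.escape hfz
  have hd := D.d_pos
  have hp : 0 < (D.d:ℝ)^(i+j+1) := by positivity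
  have h2 : D.H^[i+j] z ∈ D.V := D.escape' hi (by omega)
  have h1 : D.H^[i+j+1] (f z) ∈ D.V := D.escape' hj (by omega)
  have e : D.H (D.H^[i+j] z) = D.H^[i+j+1] z := (Function.iterate_succ_apply' _ _ _).symm
  obtain ⟨s, hs⟩ := D.K2 (D.hat_diff hf (i+j+1)) (D.hat_bd hB (i+j+1)) (D.hat_inj hinj (i+j+1)) h2
    (by rw [e, G_Hn]; exact mul_lt_mul_of_pos_left hl hp) (by rw [e, hat_H]; exact h1)
  rw [e, hat_H, G_Hn, G_Hn] at hs
  refine ⟨s, mul_left_cancel₀ hp.ne' (hs.trans ?_)⟩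
  ring

lemma slice_bd (x : ℂ) (r : ℝ) : Bornology.IsBounded {y : ℂ | D.G (x, y) < r} := by
  refine (Metric.isBounded_closedBall (x := (0:ℂ)) (r := max (max D.R ‖x‖) (2 * Real.exp r))).subset ?_
  intro y hy
  rw [mem_closedBall_zero_iff]
  by_contra! hc
  have h1 := (max_lt_iff.1 hc).1
  have h2 := (max_lt_iff.1 hc).2
  have hV : (x, y) ∈ D.V := by
    show D.R < ‖y‖ ∧ ‖x‖ < ‖y‖
    exact ⟨(max_lt_iff.1 h1).1, (max_lt_iff.1 h1).2⟩
  have h3 := D.G_lower hV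
  have h4 := Real.log_lt_log (by positivity) h2
  rw [Real.log_mul (by norm_num) (Real.exp_pos _).ne', Real.log_exp] at h4
  change D.G (x,y) < r at hy
  simp only at h3
  linarith

/-- a segment along which all the levels between 0 and l are attained -/
lemma path {z0} (h0 : D.G z0 = 0) {l : ℝ} (hl : 0 < l) : ∃ γ : ℝ → ℂ × ℂ, Continuous γ ∧ ∃ a b : ℝ, a < b ∧
    D.G (γ a) = 0 ∧ l ≤ D.G (γ b) ∧ ∀ s ∈ Ioo a b, 0 < D.G (γ s) ∧ D.G (γ s) < l := by
  set γ : ℝ → ℂ × ℂ := fun s => (z0.1, z0.2 + (s:ℂ)) with hγ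
  have hγc : Continuous γ := by fun_prop
  have hgc : Continuous (fun s => D.G (γ s)) := D.hGcont.comp hγc
  have hγ0 : D.G (γ 0) = 0 := by simp [hγ, h0]
  obtain ⟨S1, hS1, hS1l⟩ : ∃ S1 : ℝ, 0 < S1 ∧ l ≤ D.G (γ S1) := by
    obtain ⟨M, hM⟩ := (D.slice_bd z0.1 l).exists_norm_le
    refine ⟨|M| + ‖z0.2‖ + 1, by positivity, ?_⟩
    by_contra! hc
    have h1 := hM _ hc
    have h2 := norm_sub_norm_le (((|M| + ‖z0.2‖ + 1 : ℝ)) : ℂ) (-z0.2)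
    rw [sub_neg_eq_add, norm_neg, Complex.norm_real, Real.norm_of_nonneg (by positivity), add_comm _ z0.2] at h2
    have := le_abs_self M
    linarith
  have hK1 : IsCompact {s | s ∈ Icc 0 S1 ∧ D.G (γ s) = 0} :=
    isCompact_Icc.inter_right (isClosed_eq hgc continuous_const)
  obtain ⟨s0, ⟨hs0, hs0G⟩, hs0m⟩ := hK1.exists_isGreatest ⟨0, ⟨⟨le_rfl, hS1.le⟩, hγ0⟩⟩
  have hK2 : IsCompact {s | s ∈ Icc s0 S1 ∧ l ≤ D.G (γ s)} :=
    isCompact_Icc.inter_right (isClosed_le continuous_const hgc)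
  obtain ⟨S, ⟨hS, hSG⟩, hSm⟩ := hK2.exists_isLeast ⟨S1, ⟨⟨hs0.2, le_rfl⟩, hS1l⟩⟩
  have hne : s0 < S := by
    refine lt_of_le_of_ne hS.1 ?_
    rintro rfl
    linarith
  refine ⟨γ, hγc, s0, S, hne, hs0G, hSG, fun s hs => ⟨?_, ?_⟩⟩
  · refine lt_of_le_of_ne (D.hGnonneg _) fun h => ?_
    have := hs0m ⟨⟨hs0.1.trans hs.1.le, hs.2.le.trans hS.2⟩, h.symm⟩
    linarith [hs.1]
  · by_contra! h
    have := hSm ⟨⟨hs.1.le, hs.2.le.trans hS.2⟩, h⟩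
    linarith [hs.2]

lemma path_level {γ : ℝ → ℂ × ℂ} (hγ : Continuous γ) {a b l : ℝ} (hab : a < b)
    (ha : D.G (γ a) = 0) (hb : l ≤ D.G (γ b)) {r : ℝ} (hr : 0 < r) (hrl : r < l) :
    ∃ s ∈ Ioo a b, D.G (γ s) = r := by
  have := intermediate_value_Ioo hab.le ((D.hGcont.comp hγ).continuousOn (s := Icc a b))
  exact this ⟨by simp only [Function.comp, ha]; exact hr, by simp only [Function.comp]; linarith⟩

lemma level {z0} (h0 : D.G z0 = 0) {r : ℝ} (hr : 0 < r) : ∃ z, D.G z = r := by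
  obtain ⟨γ, hγ, a, b, hab, ha, hb, -⟩ := D.path h0 (l := r + 1) (by linarith)
  obtain ⟨s, -, hs⟩ := D.path_level hγ hab ha hb hr (by linarith)
  exact ⟨_, hs⟩

theorem KK {z0} (h0 : D.G z0 = 0) {f : ℂ × ℂ → ℂ × ℂ} {l B : ℝ} (hl0 : 0 < l)
    (hf : DifferentiableOn ℂ f {z | D.G z < l})
    (hB : ∀ z, D.G z < l → D.G (f z) ≤ B) (hinj : InjOn f {z | D.G z < l}) :
    ∃ κ : ℝ, (κ = 0 ∨ ∃ s : ℤ, κ = (D.d:ℝ)^s) ∧ ∀ z, D.G z < l → D.G (f z) = κ * D.G z := by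
  obtain ⟨γ, hγ, a, b, hab, ha, hb, hin⟩ := D.path h0 hl0
  have hfc : ContinuousOn (fun s => D.G (f (γ s))) (Ioo a b) :=
    D.hGcont.comp_continuousOn (hf.continuousOn.comp hγ.continuousOn fun s hs => (hin s hs).2)
  have hq : ContinuousOn (fun s => D.G (f (γ s)) / D.G (γ s)) (Ioo a b) :=
    hfc.div (D.hGcont.comp hγ).continuousOn fun s hs => (hin s hs).1.ne'
  have hval : ∀ s ∈ Ioo a b, D.G (f (γ s)) / D.G (γ s) = 0 ∨ ∃ k : ℤ, D.G (f (γ s)) / D.G (γ s) = (D.d:ℝ)^k := by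
    intro s hs
    rcases (D.hGnonneg (f (γ s))).eq_or_lt with h | h
    · left; rw [← h, zero_div]
    · right
      obtain ⟨k, hk⟩ := D.K2' hf hB hinj (hin s hs).1 (hin s hs).2 h
      exact ⟨k, by rw [hk, mul_div_cancel_right₀ _ (hin s hs).1.ne']⟩
  have hpre := isPreconnected_Ioo.image _ hq
  have hcount : (insert (0:ℝ) (range fun k : ℤ => (D.d:ℝ)^k)).Countable := (countable_range _).insert _
  have hsub := hcount.isTotallyDisconnected _ (by
    rintro _ ⟨s, hs, rfl⟩
    rcases hval s hs with h | ⟨k, h⟩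
    · left; exact h
    · right; exact ⟨k, h.symm⟩) hpre
  have hm : (a + b) / 2 ∈ Ioo a b := ⟨by linarith, by linarith⟩
  set κ := D.G (f (γ ((a+b)/2))) / D.G (γ ((a+b)/2)) with hκ
  have hκv := hval _ hm
  rw [← hκ] at hκv
  have hκ0 : 0 ≤ κ := div_nonneg (D.hGnonneg _) (D.hGnonneg _)
  have hpos : ∀ z, 0 < D.G z → D.G z < l → D.G (f z) = κ * D.G z := by
    intro z hz hzl
    obtain ⟨s, hs, e⟩ := D.path_level hγ hab ha hb hz hzl
    have h1 := hsub (mem_image_of_mem _ hs) (mem_image_of_mem _ hm)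
    change _ = κ at h1
    rw [div_eq_iff (hin s hs).1.ne'] at h1
    rw [D.K1' hf hB hz hzl e.symm, h1, e]
  refine ⟨κ, hκv, fun z hzl => ?_⟩
  rcases (D.hGnonneg z).eq_or_lt with hz | hz
  swap
  · exact hpos z hz hzl
  rw [← hz, mul_zero]
  refine le_antisymm ?_ (D.hGnonneg _)
  have hle : ∀ r, 0 < r → r < l → D.G (f z) ≤ κ * r := by
    intro r hr hrl
    have hιc : Continuous (fun y : ℂ => D.G (z.1, y)) := D.hGcont.comp (by fun_prop)
    set U := {y : ℂ | D.G (z.1, y) < r} with hU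
    have hUo : IsOpen U := isOpen_lt hιc continuous_const
    have hcl : closure U ⊆ {y | D.G (z.1, y) ≤ r} :=
      closure_minimal (fun y (hy : D.G (z.1, y) < r) => (show D.G (z.1, y) ≤ r from hy.le)) (isClosed_le hιc continuous_const)
    have hqd : ∀ y, D.G (z.1, y) < l → DifferentiableAt ℂ (fun y : ℂ => f (z.1, y)) y := by
      intro y hy
      exact (hf.differentiableAt ((D.Omega_open l).mem_nhds hy)).comp (g := f) y
        (f := fun y : ℂ => (z.1, y)) (by fun_prop)
    refine max_principle (U := U) (v := fun y => D.G (f (z.1, y))) hUo (D.slice_bd _ _) ?_ ?_ ?_ z.2 ?_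
    · intro y hy
      have : D.G (z.1, y) ≤ r := hcl hy
      exact (D.hGcont.continuousAt.comp (hqd y (by linarith)).continuousAt).continuousWithinAt
    · intro y hy
      have h1 : D.G (z.1, y) ≤ r := hcl hy.1
      have h2 : r ≤ D.G (z.1, y) := by
        by_contra! h
        exact hy.2 (hUo.interior_eq.symm ▸ h)
      have h3 := hpos (z.1, y) (by linarith) (by linarith)
      show D.G (f (z.1, y)) ≤ κ * r
      rw [h3, le_antisymm h1 h2]
    · intro y hy hM
      refine D.G_LocRe ?_ (lt_of_le_of_lt (by positivity) hM)
      filter_upwards [hUo.mem_nhds hy] with y' hy'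
      exact hqd y' (lt_trans hy' hrl)
    · show D.G (z.1, z.2) < r
      rw [Prod.mk.eta, ← hz]; exact hr
  have ht : Tendsto (fun r : ℝ => κ * r) (𝓝[>] 0) (𝓝 (κ * 0)) :=
    ((continuous_const.mul continuous_id).tendsto 0).mono_left nhdsWithin_le_nhds
  rw [mul_zero] at ht
  refine ge_of_tendsto ht ?_
  filter_upwards [Ioo_mem_nhdsGT hl0] with r hr
  exact hle r hr.1 hr.2

/-- the conclusion for a biholomorphism -/
theorem final {z0} (h0 : D.G z0 = 0) {f g : ℂ × ℂ → ℂ × ℂ} {l m : ℝ} (hl0 : 0 < l) (hm0 : 0 < m)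
    (hf : DifferentiableOn ℂ f {z | D.G z < l}) (hfm : ∀ z, D.G z < l → D.G (f z) < m)
    (hgm : ∀ z, D.G z < m → D.G (g z) < l) (hgf : ∀ z, D.G z < l → g (f z) = z)
    (hfg : ∀ z, D.G z < m → f (g z) = z) :
    ∃ s : ℤ, m = (D.d:ℝ)^s * l ∧ ∀ z, D.G z < l → D.G (f z) = (D.d:ℝ)^s * D.G z := by
  have hinj : InjOn f {z | D.G z < l} := by
    intro z hz w hw h
    rw [← hgf z hz, ← hgf w hw, h]
  obtain ⟨κ, hκ, hG⟩ := D.KK h0 hl0 hf (fun z hz => (hfm z hz).le) hinj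
  have hG' : ∀ w, D.G w < m → D.G w = κ * D.G (g w) := by
    intro w hw
    rw [← hG _ (hgm w hw), hfg w hw]
  have hd := D.d_pos
  have hs : ∃ s : ℤ, κ = (D.d:ℝ)^s := by
    refine hκ.resolve_left ?_
    rintro rfl
    obtain ⟨w, hw⟩ := D.level h0 (half_pos hm0)
    have := hG' w (by linarith)
    linarith
  obtain ⟨s, rfl⟩ := hs
  refine ⟨s, ?_, hG⟩
  have hκ0 : 0 < (D.d:ℝ)^s := by positivity
  apply le_antisymm
  · by_contra! hc
    obtain ⟨w, hw⟩ := D.level h0 (r := (D.d:ℝ)^s * l) (by positivity)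
    have h1 := hG' w (by linarith)
    have h2 := hgm w (by linarith)
    rw [hw] at h1
    linarith [mul_left_cancel₀ hκ0.ne' h1]
  · by_contra! hc
    have h1 : m / (D.d:ℝ)^s < l := by rw [div_lt_iff₀ hκ0]; linarith
    obtain ⟨z, hz⟩ := D.level h0 (r := m / (D.d:ℝ)^s) (by positivity)
    have h2 := hfm z (by linarith)
    rw [hG z (by linarith), hz] at h2
    field_simp at h2
    linarith
end HD
end

open Filter Topology Set
noncomputable section

lemma poly_bd (q : Polynomial ℂ) {n : ℕ} (hn : q.natDegree ≤ n) :
    ∃ A : ℝ, 0 ≤ A ∧ ∀ (w : ℂ) (M : ℝ), 1 ≤ M → ‖w‖ ≤ M → ‖q.eval w‖ ≤ A * M ^ n := by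
  refine ⟨∑ i ∈ Finset.range (q.natDegree + 1), ‖q.coeff i‖, Finset.sum_nonneg fun _ _ => norm_nonneg _, ?_⟩
  intro w M hM hw
  rw [Polynomial.eval_eq_sum_range, Finset.sum_mul]
  refine (norm_sum_le _ _).trans (Finset.sum_le_sum fun i hi => ?_)
  rw [norm_mul, norm_pow]
  have h1 : ‖w‖ ^ i ≤ M ^ n := (pow_le_pow_left₀ (norm_nonneg _) hw i).trans
    (pow_le_pow_right₀ hM (by have := Finset.mem_range.1 hi; omega))
  gcongr

lemma pow_sub_bd {u v : ℂ} {M : ℝ} (hu : ‖u‖ ≤ M) (hv : ‖v‖ ≤ M) (n : ℕ) :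
    ‖u ^ n - v ^ n‖ * M ≤ n * ‖u - v‖ * M ^ n := by
  have hM : 0 ≤ M := (norm_nonneg _).trans hu
  induction n with
  | zero => simp
  | succ n ih =>
    have e : u ^ (n+1) - v ^ (n+1) = u ^ n * (u - v) + (u ^ n - v ^ n) * v := by ring
    have h1 : ‖u ^ (n+1) - v ^ (n+1)‖ ≤ M ^ n * ‖u - v‖ + ‖u ^ n - v ^ n‖ * M := by
      rw [e]
      refine (norm_add_le _ _).trans ?_
      rw [norm_mul, norm_mul, norm_pow]
      gcongr
    calc ‖u ^ (n+1) - v ^ (n+1)‖ * M ≤ (M ^ n * ‖u - v‖ + n * ‖u - v‖ * M ^ n) * M := by gcongr; linarith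
      _ = _ := by push_cast; ring

lemma exists_HD (d : ℕ) (hd : 2 ≤ d) (a : ℂ) (ha : a ≠ 0)
    (p : Polynomial ℂ) (hpm : p.Monic) (hpd : p.natDegree = d)
    (G : ℂ × ℂ → ℝ) (hGcont : Continuous G) (hGnonneg : ∀ z, 0 ≤ G z)
    (hGlim : ∀ z : ℂ × ℂ,
      Tendsto (fun n : ℕ => Real.log (max ‖(hen (fun y => p.eval y) a)^[n] z‖ 1) / (d : ℝ) ^ n) atTop (𝓝 (G z))) :
    ∃ D : HD, D.d = d ∧ D.G = G ∧ ∃ z0, D.G z0 = 0 := by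
  set q := p.eraseLead with hq
  have hqd : q.natDegree ≤ d - 1 := hpd ▸ Polynomial.eraseLead_natDegree_le p
  have hpq : ∀ y, p.eval y = q.eval y + y ^ d := by
    intro y
    have := congrArg (Polynomial.eval y) (Polynomial.eraseLead_add_monomial_natDegree_leadingCoeff p)
    rw [hpm.leadingCoeff, hpd] at this
    simpa using this.symm
  obtain ⟨A, hA0, hA⟩ := poly_bd q hqd
  obtain ⟨A', hA'0, hA'⟩ := poly_bd q.derivative (n := d - 2)
    ((Polynomial.natDegree_derivative_le q).trans (by omega))
  set C1 : ℝ := A + ‖a‖ + 1 with hC1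
  set K : ℝ := 6 * C1 + 2 with hK
  set C2 : ℝ := 1 + A' * 2 ^ (d-1) + d * (d * K * 2 ^ (d-1)) with hC2
  have hC1p : 1 ≤ C1 := by have := norm_nonneg a; linarith
  have hK0 : 0 ≤ K := by linarith
  have hC2p : 1 ≤ C2 := by
    have : 0 ≤ A' * 2 ^ (d-1) + d * (d * K * 2 ^ (d-1)) := by positivity
    linarith
  set R0 : ℝ := 1000 * (d * (C1 * (C2 * ((1 + ‖a‖) * (1 + ‖a‖⁻¹))))) with hR0
  set R : ℝ := max R0 (K + 1) with hR
  have hR1 : 1 ≤ R := le_trans (by linarith) (le_max_right _ _)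
  have hRK : K ≤ R := le_trans (by linarith) (le_max_right _ _)
  have hAA : ∀ x y : ℂ, R ≤ ‖y‖ → ‖x‖ ≤ ‖y‖ → ‖p.eval y - a * x - y ^ d‖ * ‖y‖ ≤ C1 * ‖y‖ ^ d := by
    intro x y hy hx
    have hy1 : 1 ≤ ‖y‖ := hR1.trans hy
    have e : p.eval y - a * x - y ^ d = q.eval y - a * x := by rw [hpq]; ring
    have h1 : ‖q.eval y - a * x‖ ≤ A * ‖y‖ ^ (d-1) + ‖a‖ * ‖y‖ ^ (d-1) := by
      refine (norm_sub_le _ _).trans (add_le_add (hA y _ hy1 le_rfl) ?_)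
      rw [norm_mul]
      have : ‖x‖ ≤ ‖y‖ ^ (d-1) := hx.trans (le_self_pow₀ hy1 (by omega))
      gcongr
    have e2 : ‖y‖ ^ d = ‖y‖ ^ (d-1) * ‖y‖ := by rw [← pow_succ]; congr 1; omega
    rw [e, e2, ← mul_assoc]
    refine mul_le_mul_of_nonneg_right (h1.trans ?_) (norm_nonneg _)
    rw [hC1]
    have : 0 ≤ ‖y‖ ^ (d-1) := by positivity
    linarith
  have hBB : ∀ y δ δ' : ℂ, R ≤ ‖y‖ → ‖δ‖ ≤ 6 * C1 + 2 → ‖δ'‖ ≤ 6 * C1 + 2 →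
      ‖p.eval (y + δ) - p.eval (y + δ') - d * y ^ (d-1) * (δ - δ')‖ * ‖y‖ ≤ C2 * ‖y‖ ^ (d-1) * ‖δ - δ'‖ := by
    intro y δ δ' hy hδ hδ'
    have hy1 : 1 ≤ ‖y‖ := hR1.trans hy
    have hy0 : 0 < ‖y‖ := by linarith
    have hder : ∀ t : ℂ, HasDerivAt (fun t => p.eval (y + t) - d * y ^ (d-1) * t)
        (q.derivative.eval (y + t) + d * ((y + t) ^ (d-1) - y ^ (d-1))) t := by
      intro t
      have h1 : HasDerivAt (fun t => q.eval (y + t)) (q.derivative.eval (y + t)) t := by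
        have := (q.hasDerivAt (y + t)).comp_const_add y t
        exact this
      have h2 : HasDerivAt (fun t : ℂ => (y + t) ^ d) (d * (y + t) ^ (d-1)) t := by
        have := (hasDerivAt_pow d (y + t)).comp_const_add y t
        exact this
      have h3 : HasDerivAt (fun t : ℂ => (d:ℂ) * y ^ (d-1) * t) ((d:ℂ) * y ^ (d-1) * 1) t :=
        (hasDerivAt_id t).const_mul _
      refine ((h1.add h2).sub h3).congr_deriv (by ring) |>.congr_of_eventuallyEq ?_
      exact Eventually.of_forall fun t => by simp [hpq]
    have hbd : ∀ t ∈ Metric.closedBall (0:ℂ) K, ‖q.derivative.eval (y + t) + d * ((y + t) ^ (d-1) - y ^ (d-1))‖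
        ≤ C2 * ‖y‖ ^ (d-1) / ‖y‖ := by
      intro t ht
      rw [mem_closedBall_zero_iff] at ht
      have hM : ‖y + t‖ ≤ 2 * ‖y‖ := by
        have := norm_add_le y t; linarith
      have b1 := hA' (y + t) (2 * ‖y‖) (by linarith) hM
      have b2 := pow_sub_bd hM (by linarith : ‖y‖ ≤ 2 * ‖y‖) (d-1)
      rw [add_sub_cancel_left] at b2
      have hdd : ((d - 1 : ℕ) : ℝ) ≤ d := by exact_mod_cast Nat.sub_le _ _
      have b3 : ‖(y + t) ^ (d-1) - y ^ (d-1)‖ * ‖y‖ ≤ d * K * 2 ^ (d-1) * ‖y‖ ^ (d-1) := by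
        calc _ ≤ ‖(y + t) ^ (d-1) - y ^ (d-1)‖ * (2 * ‖y‖) := by gcongr; linarith
          _ ≤ _ := b2
          _ ≤ d * K * (2 * ‖y‖) ^ (d-1) := by gcongr
          _ = _ := by rw [mul_pow]; ring
      have b4 : ‖q.derivative.eval (y + t)‖ * ‖y‖ ≤ A' * 2 ^ (d-1) * ‖y‖ ^ (d-1) := by
        calc _ ≤ A' * (2 * ‖y‖) ^ (d-2) * (2 * ‖y‖) := by gcongr; linarith
          _ = A' * (2 * ‖y‖) ^ (d-1) := by rw [mul_assoc, ← pow_succ]; congr 2; omega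
          _ = _ := by rw [mul_pow]; ring
      rw [le_div_iff₀ hy0]
      calc _ ≤ (‖q.derivative.eval (y + t)‖ + d * ‖(y + t) ^ (d-1) - y ^ (d-1)‖) * ‖y‖ := by
            gcongr
            refine (norm_add_le _ _).trans ?_
            rw [norm_mul, Complex.norm_natCast]
        _ = ‖q.derivative.eval (y + t)‖ * ‖y‖ + d * (‖(y + t) ^ (d-1) - y ^ (d-1)‖ * ‖y‖) := by ring
        _ ≤ A' * 2 ^ (d-1) * ‖y‖ ^ (d-1) + d * (d * K * 2 ^ (d-1) * ‖y‖ ^ (d-1)) := by gcongr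
        _ ≤ C2 * ‖y‖ ^ (d-1) := by
            rw [hC2]
            have : 0 ≤ ‖y‖ ^ (d-1) := by positivity
            linarith
    have hmv := (convex_closedBall (0:ℂ) K).norm_image_sub_le_of_norm_hasDerivWithin_le
      (fun t _ => (hder t).hasDerivWithinAt) hbd (mem_closedBall_zero_iff.2 hδ') (mem_closedBall_zero_iff.2 hδ)
    have e : p.eval (y + δ) - d * y ^ (d-1) * δ - (p.eval (y + δ') - d * y ^ (d-1) * δ') =
      p.eval (y + δ) - p.eval (y + δ') - d * y ^ (d-1) * (δ - δ') := by ring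
    simp only [e] at hmv
    calc _ ≤ (C2 * ‖y‖ ^ (d-1) / ‖y‖ * ‖δ - δ'‖) * ‖y‖ := by gcongr
      _ = _ := by field_simp
  let D : HD := { d := d, hd := hd, a := a, ha := ha, P := fun y => p.eval y, hP := p.differentiable,
                  G := G, hGcont := hGcont, hGnonneg := hGnonneg, hGlim := hGlim, C1 := C1, C2 := C2, R := R,
                  hC1 := hC1p, hC2 := hC2p, hA := hAA, hB := hBB, hR := le_max_left _ _ }
  refine ⟨D, rfl, rfl, ?_⟩
  obtain ⟨y, hy⟩ : ∃ y, (p - Polynomial.C (a + 1) * Polynomial.X).IsRoot y := by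
    apply IsAlgClosed.exists_root
    have h1 : (Polynomial.C (a + 1) * Polynomial.X).natDegree < p.natDegree := by
      rw [hpd]
      exact lt_of_le_of_lt ((Polynomial.natDegree_C_mul_le _ _).trans Polynomial.natDegree_X_le) (by omega : 1 < d)
    have h2 := Polynomial.natDegree_sub_eq_left_of_natDegree_lt h1
    intro h
    have h3 := Polynomial.natDegree_eq_of_degree_eq_some (n := 0) h
    omega
  have hy2 : p.eval y = (a + 1) * y := by
    have : p.eval y - (a+1) * y = 0 := by simpa [Polynomial.IsRoot] using hy
    linear_combination this
  refine ⟨(y, y), ?_⟩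
  have hfix : D.H (y, y) = (y, y) := by
    show (y, p.eval y - a * y) = (y, y)
    rw [hy2]; congr 1; ring
  have h := D.G_H (y, y)
  rw [hfix] at h
  have := D.d_two
  nlinarith

end

/-- Let `c > 0`. For `c/d < ℓ₁ < ℓ₂ < c` there is no biholomorphism from
`Ω_{ℓ₁}` onto `Ω_{ℓ₂}` — the family `{Ω_ℓ : c/d < ℓ < c}` is a continuum of pairwise
non-biholomorphic Short ℂ²'s. Moreover, for every `ℓ` with `c/d < ℓ < c`, every
automorphism of `Ω_c` restricts to an automorphism of `Ω_ℓ`. -/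
theorem stmt_17 (d : ℕ) (hd : 2 ≤ d) (a : ℂ) (ha : a ≠ 0)
    (p : Polynomial ℂ) (hpm : p.Monic) (hpd : p.natDegree = d)
    (hpc : p.coeff (d - 1) = 0)
    (H : ℂ × ℂ → ℂ × ℂ) (hH : ∀ z : ℂ × ℂ, H z = (z.2, p.eval z.2 - a * z.1))
    (G : ℂ × ℂ → ℝ) (hGcont : Continuous G) (hGnonneg : ∀ z, 0 ≤ G z)
    (hGlim : ∀ z : ℂ × ℂ,
      Tendsto (fun n : ℕ => Real.log (max ‖H^[n] z‖ 1) / (d : ℝ) ^ n) atTop (𝓝 (G z)))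
    (c : ℝ) (hc : 0 < c) :
    (∀ ℓ₁ ℓ₂ : ℝ, c / d < ℓ₁ → ℓ₁ < ℓ₂ → ℓ₂ < c →
      ¬ ∃ f g : ℂ × ℂ → ℂ × ℂ,
          IsBiholoOn f g {z : ℂ × ℂ | G z < ℓ₁} {z : ℂ × ℂ | G z < ℓ₂}) ∧
    (∀ ℓ : ℝ, c / d < ℓ → ℓ < c →
      ∀ f g : ℂ × ℂ → ℂ × ℂ,
        IsBiholoOn f g {z : ℂ × ℂ | G z < c} {z : ℂ × ℂ | G z < c} →
        IsBiholoOn f g {z : ℂ × ℂ | G z < ℓ} {z : ℂ × ℂ | G z < ℓ}) := by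
  obtain rfl : H = hen (fun y => p.eval y) a := funext hH
  obtain ⟨D, rfl, rfl, z0, h0⟩ := exists_HD d hd a ha p hpm hpd G hGcont hGnonneg hGlim
  have hdp := D.d_pos
  have hd1 : (1:ℝ) < D.d := by linarith [D.d_two]
  have hcd : 0 < c / D.d := by positivity
  constructor
  · rintro l1 l2 h1 h12 h2 ⟨f, g, hf, hg, hfm, hgm, hgf, hfg⟩
    have hl1 : 0 < l1 := by linarith
    obtain ⟨s, hs, -⟩ := D.final h0 hl1 (hl1.trans h12) hf (fun z hz => hfm hz) (fun z hz => hgm hz) hgf hfg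
    rw [div_lt_iff₀ hdp] at h1
    have a1 : (D.d:ℝ)^(0:ℤ) < (D.d:ℝ)^s := by rw [zpow_zero]; exact lt_of_mul_lt_mul_right (by linarith : 1 * l1 < (D.d:ℝ)^s * l1) hl1.le
    have a2 : (D.d:ℝ)^s < (D.d:ℝ)^(1:ℤ) := by rw [zpow_one]; exact lt_of_mul_lt_mul_right (by linarith : (D.d:ℝ)^s * l1 < D.d * l1) hl1.le
    have a3 := (zpow_lt_zpow_iff_right₀ hd1).1 a1
    have a4 := (zpow_lt_zpow_iff_right₀ hd1).1 a2
    omega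
  · rintro l h1 h2 f g ⟨hf, hg, hfm, hgm, hgf, hfg⟩
    obtain ⟨s, hs, hG⟩ := D.final h0 hc hc hf (fun z hz => hfm hz) (fun z hz => hgm hz) hgf hfg
    have hs1 : (D.d:ℝ)^s = 1 := by
      have : (1 - (D.d:ℝ)^s) * c = 0 := by linarith
      rcases mul_eq_zero.1 this with h | h <;> linarith
    have hGf : ∀ z, D.G z < c → D.G (f z) = D.G z := fun z hz => by rw [hG z hz, hs1, one_mul]
    have hGg : ∀ z, D.G z < c → D.G (g z) = D.G z := fun z hz => by
      rw [← hGf _ (hgm hz), hfg z hz]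
    have hsub : {z | D.G z < l} ⊆ {z | D.G z < c} := fun z (hz : D.G z < l) => (show D.G z < c from hz.trans h2)
    refine ⟨hf.mono hsub, hg.mono hsub, fun z hz => ?_, fun z hz => ?_, fun z hz => hgf z (hsub hz),
      fun z hz => hfg z (hsub hz)⟩
    · show D.G (f z) < l
      rw [hGf z (hsub hz)]; exact hz
    · show D.G (g z) < l
      rw [hGg z (hsub hz)]; exact hz
end
end
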